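/- Let U ⊆ ℝ^d be open, V_U := ⋃_{x∈U}(x+𝔹). Let j be a positive integer and set k := ⌈log₂(j(j+1))⌉+7. Let M^{(1)},…,M^{(k)} be weight sequences with (m^{(i)}_ℓ)^{1/ℓ}→∞ for all i, such that there exists B≥1 with Γ̄_{m^{(2)}}(Bt) ≤ Γ̲_{m^{(1)}}(t) for all t>0, and mg(M^{(i)},M^{(i+1)}) < ∞ for all 2 ≤ i ≤ k−1. Then there is a constant D>0 such that for every ρ>0 and every function f : V_U → ℂ with f^j, f^{j+1} ∈ B^{M^{(1)}}_ρ(V_U), one has f|_U ∈ B^{M^{(k)}}_{Dρ}(U). -/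

import Mathlib

open Set Filter Topology Metric
open scoped ENNReal NNReal Topology

noncomputable section

namespace JorisPaper

/-- The sequence `m` with `m_k = M_k / k!`. -/
def lc (M : ℕ → ℝ) (k : ℕ) : ℝ := M k / (Nat.factorial k : ℝ)

/-- A weight sequence: positive, log-convex, `M_0 = 1 ≤ M_1`, `M_k^{1/k} → ∞`. -/
structure IsWeightSeq (M : ℕ → ℝ) : Prop where
  pos : ∀ k, 0 < M k
  first : M 0 = 1
  one_le : 1 ≤ M 1
  logconvex : ∀ k, 1 ≤ k → M k ^ 2 ≤ M (k - 1) * M (k + 1)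
  root : Filter.Tendsto (fun k : ℕ => M k ^ ((1 : ℝ) / (k : ℝ))) atTop atTop

/-- `m_k^{1/k} → ∞`. -/
def RootsTendsto (m : ℕ → ℝ) : Prop :=
  Filter.Tendsto (fun k : ℕ => m k ^ ((1 : ℝ) / (k : ℝ))) atTop atTop

/-- `h_m(t) = inf_k m_k t^k` for `t > 0`, and `0` for `t ≤ 0`. -/
def hfn (m : ℕ → ℝ) (t : ℝ) : ℝ := if t ≤ 0 then 0 else ⨅ k : ℕ, m k * t ^ k

/-- `Γ̄_m(t) = min {k | h_m(t) = m_k t^k}`. -/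
def GammaUpper (m : ℕ → ℝ) (t : ℝ) : ℕ := sInf {k : ℕ | hfn m t = m k * t ^ k}

/-- `Γ̲_m(t) = min {k | m_{k+1}/m_k ≥ 1/t}`. -/
def GammaLower (m : ℕ → ℝ) (t : ℝ) : ℕ := sInf {k : ℕ | 1 / t ≤ m (k + 1) / m k}

/-- `mg(M,N) = sup_{j+k ≥ 1} (M_{j+k}/(N_j N_k))^{1/(j+k)}`, as an extended real. -/
def mg (M N : ℕ → ℝ) : ℝ≥0∞ :=
  ⨆ (j : ℕ) (k : ℕ) (_ : 1 ≤ j + k),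
    ENNReal.ofReal ((M (j + k) / (N j * N k)) ^ (((j : ℝ) + (k : ℝ))⁻¹))

/-- A weight matrix: a totally ordered (pointwise) family of weight sequences. -/
structure IsWeightMatrix (W : Set (ℕ → ℝ)) : Prop where
  weight : ∀ M ∈ W, IsWeightSeq M
  ordered : ∀ M ∈ W, ∀ N ∈ W, (∀ k, M k ≤ N k) ∨ (∀ k, N k ≤ M k)

/-- R-admissible weight matrix. -/
structure RAdmissible (W : Set (ℕ → ℝ)) : Prop where
  matrix : IsWeightMatrix W
  roots : ∀ M ∈ W, RootsTendsto (lc M)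
  gamma : ∀ M ∈ W, ∃ N ∈ W, ∃ C : ℝ, 1 ≤ C ∧
    ∀ t : ℝ, 0 < t → GammaUpper (lc N) (C * t) ≤ GammaLower (lc M) t
  mgrowth : ∀ M ∈ W, ∃ N ∈ W, mg M N < ⊤

/-- B-admissible weight matrix. -/
structure BAdmissible (W : Set (ℕ → ℝ)) : Prop where
  matrix : IsWeightMatrix W
  roots : ∀ M ∈ W, RootsTendsto (lc M)
  gamma : ∀ M ∈ W, ∃ N ∈ W, ∃ C : ℝ, 1 ≤ C ∧
    ∀ t : ℝ, 0 < t → GammaUpper (lc M) (C * t) ≤ GammaLower (lc N) t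
  mgrowth : ∀ M ∈ W, ∃ N ∈ W, mg N M < ⊤

/-- `‖f‖^M_{K,ρ} < ∞` (derivatives taken within `U`). -/
def SeqBoundedOn {E F : Type*} [NormedAddCommGroup E] [NormedSpace ℝ E]
    [NormedAddCommGroup F] [NormedSpace ℝ F]
    (M : ℕ → ℝ) (ρ : ℝ) (f : E → F) (U K : Set E) : Prop :=
  ∃ C : ℝ, ∀ x ∈ K, ∀ k : ℕ, ‖iteratedFDerivWithin ℝ k f U x‖ ≤ C * ρ ^ k * M k

/-- `f ∈ B^M_ρ(V)`: smooth on `V` with global bounds `‖f‖^M_{V,ρ} < ∞`. -/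
def GlobalClass {E F : Type*} [NormedAddCommGroup E] [NormedSpace ℝ E]
    [NormedAddCommGroup F] [NormedSpace ℝ F]
    (M : ℕ → ℝ) (ρ : ℝ) (f : E → F) (V : Set E) : Prop :=
  ContDiffOn ℝ (⊤ : ℕ∞) f V ∧ SeqBoundedOn M ρ f V V

/-- The Roumieu class `E^{{W}}(U)`. -/
def Roumieu {E F : Type*} [NormedAddCommGroup E] [NormedSpace ℝ E]
    [NormedAddCommGroup F] [NormedSpace ℝ F]
    (W : Set (ℕ → ℝ)) (U : Set E) (f : E → F) : Prop :=
  ContDiffOn ℝ (⊤ : ℕ∞) f U ∧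
    ∀ K ⊆ U, IsCompact K → ∃ M ∈ W, ∃ ρ : ℝ, 0 < ρ ∧ SeqBoundedOn M ρ f U K

/-- The Beurling class `E^{(W)}(U)`. -/
def Beurling {E F : Type*} [NormedAddCommGroup E] [NormedSpace ℝ E]
    [NormedAddCommGroup F] [NormedSpace ℝ F]
    (W : Set (ℕ → ℝ)) (U : Set E) (f : E → F) : Prop :=
  ContDiffOn ℝ (⊤ : ℕ∞) f U ∧
    ∀ K ⊆ U, IsCompact K → ∀ M ∈ W, ∀ ρ : ℝ, 0 < ρ → SeqBoundedOn M ρ f U K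

/-- The open ellipse `Ω_ε` with vertices `±cosh ε` and co-vertices `±i sinh ε`. -/
def Omega (ε : ℝ) : Set ℂ :=
  {z : ℂ | (z.re / Real.cosh ε) ^ 2 + (z.im / Real.sinh ε) ^ 2 < 1}

/-- `V_U = ⋃_{x ∈ U} (x + 𝔹)`. -/
def VU {E : Type*} [NormedAddCommGroup E] [NormedSpace ℝ E] (U : Set E) : Set E :=
  ⋃ x ∈ U, Metric.closedBall x 1

/-- A weight function in the sense of Braun–Meise–Taylor. -/
structure IsWeightFunction (ω : ℝ → ℝ) : Prop where
  cont : ContinuousOn ω (Ici 0)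
  mono : MonotoneOn ω (Ici 0)
  nonneg : ∀ t, 0 ≤ t → 0 ≤ ω t
  bigO : (fun t => ω (2 * t)) =O[atTop] ω
  littleO : ω =o[atTop] (fun t => t)
  logLittleO : Real.log =o[atTop] ω
  convex : ConvexOn ℝ (Ici 0) (fun t => ω (Real.exp t))

/-- The Young conjugate `φ*_ω(s) = sup_{t ≥ 0} (s t - ω(e^t))`. -/
def youngConj (ω : ℝ → ℝ) (s : ℝ) : ℝ :=
  sSup {y : ℝ | ∃ t : ℝ, 0 ≤ t ∧ y = s * t - ω (Real.exp t)}

/-- The Roumieu class `E^{{ω}}(U)` for a weight function `ω`. -/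
def RoumieuW {E F : Type*} [NormedAddCommGroup E] [NormedSpace ℝ E]
    [NormedAddCommGroup F] [NormedSpace ℝ F]
    (ω : ℝ → ℝ) (U : Set E) (f : E → F) : Prop :=
  ContDiffOn ℝ (⊤ : ℕ∞) f U ∧
    ∀ K ⊆ U, IsCompact K → ∃ C : ℝ, 0 < C ∧ ∃ ρ : ℝ, 0 < ρ ∧
      ∀ x ∈ K, ∀ k : ℕ, ‖iteratedFDerivWithin ℝ k f U x‖ ≤
        C * Real.exp ((1 / ρ) * youngConj ω (ρ * k))

/-- The Beurling class `E^{(ω)}(U)` for a weight function `ω`. -/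
def BeurlingW {E F : Type*} [NormedAddCommGroup E] [NormedSpace ℝ E]
    [NormedAddCommGroup F] [NormedSpace ℝ F]
    (ω : ℝ → ℝ) (U : Set E) (f : E → F) : Prop :=
  ContDiffOn ℝ (⊤ : ℕ∞) f U ∧
    ∀ K ⊆ U, IsCompact K → ∀ ρ : ℝ, 0 < ρ → ∃ C : ℝ, 0 < C ∧
      ∀ x ∈ K, ∀ k : ℕ, ‖iteratedFDerivWithin ℝ k f U x‖ ≤
        C * Real.exp ((1 / ρ) * youngConj ω (ρ * k))

lemma lc_pos {M : ℕ → ℝ} (hM : IsWeightSeq M) (k : ℕ) : 0 < lc M k :=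
  div_pos (hM.pos k) (by exact_mod_cast Nat.factorial_pos k)

lemma lc_zero {M : ℕ → ℝ} (hM : IsWeightSeq M) : lc M 0 = 1 := by
  simp [lc, hM.first]

lemma bddBelow_range_mul_pow {m : ℕ → ℝ} (hm : ∀ k, 0 < m k) {t : ℝ} (ht : 0 < t) :
    BddBelow (range fun k : ℕ => m k * t ^ k) :=
  ⟨0, by rintro _ ⟨k, rfl⟩; have := hm k; positivity⟩

lemma hfn_le {m : ℕ → ℝ} (hm : ∀ k, 0 < m k) {t : ℝ} (ht : 0 < t) (k : ℕ) :
    hfn m t ≤ m k * t ^ k := by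
  rw [hfn, if_neg (not_le.2 ht)]
  exact ciInf_le (bddBelow_range_mul_pow hm ht) k

lemma le_hfn {m : ℕ → ℝ} {t c : ℝ} (ht : 0 < t) (h : ∀ k, c ≤ m k * t ^ k) : c ≤ hfn m t := by
  rw [hfn, if_neg (not_le.2 ht)]
  exact le_ciInf h

lemma hfn_nonneg {m : ℕ → ℝ} (hm : ∀ k, 0 < m k) {t : ℝ} (ht : 0 < t) : 0 ≤ hfn m t :=
  le_hfn ht fun k => by have := hm k; positivity

/-- Eventually `m_k` beats any geometric sequence. -/
lemma RootsTendsto.eventually_pow_le {m : ℕ → ℝ} (hm : ∀ k, 0 < m k) (h : RootsTendsto m)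
    {a : ℝ} (ha : 0 ≤ a) : ∀ᶠ k in atTop, a ^ k ≤ m k := by
  filter_upwards [h.eventually_ge_atTop a, eventually_ge_atTop 1] with k hk hk1
  have hk0 : (k : ℝ) ≠ 0 := by positivity
  calc a ^ k ≤ (m k ^ ((1 : ℝ) / (k : ℝ))) ^ k := pow_le_pow_left₀ ha hk k
    _ = m k := by
      rw [← Real.rpow_natCast, ← Real.rpow_mul (hm k).le, one_div_mul_cancel hk0, Real.rpow_one]

lemma RootsTendsto.exists_pow_le {m : ℕ → ℝ} (hm : ∀ k, 0 < m k) (h : RootsTendsto m)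
    {a : ℝ} (ha : 0 ≤ a) : ∃ C : ℝ, 0 < C ∧ ∀ k, a ^ k ≤ C * m k := by
  obtain ⟨n, hn⟩ := eventually_atTop.1 (h.eventually_pow_le hm ha)
  refine ⟨1 + ∑ i ∈ Finset.range n, a ^ i / m i, ?_, fun k => ?_⟩
  · have : 0 ≤ ∑ i ∈ Finset.range n, a ^ i / m i :=
      Finset.sum_nonneg fun i _ => div_nonneg (pow_nonneg ha i) (hm i).le
    linarith
  · have hnn : ∀ i ∈ Finset.range n, 0 ≤ a ^ i / m i :=
      fun i _ => div_nonneg (pow_nonneg ha i) (hm i).le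
    rcases lt_or_ge k n with hk | hk
    · have h1 := Finset.single_le_sum hnn (Finset.mem_range.2 hk)
      calc a ^ k = a ^ k / m k * m k := by rw [div_mul_cancel₀ _ (hm k).ne']
        _ ≤ _ := mul_le_mul_of_nonneg_right (by linarith) (hm k).le
    · calc a ^ k ≤ 1 * m k := by simpa using hn k hk
        _ ≤ _ := mul_le_mul_of_nonneg_right
          (by linarith [Finset.sum_nonneg hnn]) (hm k).le

lemma exists_hfn_eq {m : ℕ → ℝ} (hm : ∀ k, 0 < m k) (h : RootsTendsto m) {t : ℝ} (ht : 0 < t) :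
    ∃ k, hfn m t = m k * t ^ k := by
  obtain ⟨n, hn⟩ := eventually_atTop.1 (h.eventually_pow_le hm (a := (m 0 + 1) / t)
    (by have := hm 0; positivity))
  obtain ⟨k, -, hk⟩ := Finset.exists_min_image (Finset.range (n + 1)) (fun k => m k * t ^ k)
    ⟨0, by simp⟩
  refine ⟨k, le_antisymm (hfn_le hm ht k) (le_hfn ht fun i => ?_)⟩
  rcases lt_or_ge i (n + 1) with hi | hi
  · exact hk i (Finset.mem_range.2 hi)
  · have h0 := hk 0 (by simp)
    have h1 := hn i (by omega)
    have h2 : (m 0 + 1) ^ i ≤ m i * t ^ i := by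
      rw [div_pow, div_le_iff₀ (by positivity)] at h1
      exact h1
    have h3 : m 0 + 1 ≤ (m 0 + 1) ^ i :=
      le_self_pow₀ (by linarith [hm 0]) (by omega)
    simp only [pow_zero, mul_one] at h0
    linarith

lemma hfn_GammaUpper {m : ℕ → ℝ} (hm : ∀ k, 0 < m k) (h : RootsTendsto m) {t : ℝ} (ht : 0 < t) :
    hfn m t = m (GammaUpper m t) * t ^ GammaUpper m t :=
  Nat.sInf_mem (s := {k : ℕ | hfn m t = m k * t ^ k}) (exists_hfn_eq hm h ht)

lemma hfn_lt_of_lt_GammaUpper {m : ℕ → ℝ} (hm : ∀ k, 0 < m k) {t : ℝ} (ht : 0 < t)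
    {k : ℕ} (hk : k < GammaUpper m t) : hfn m t < m k * t ^ k :=
  lt_of_le_of_ne (hfn_le hm ht k) (Nat.notMem_of_lt_sInf hk)

lemma GammaUpper_eq {m : ℕ → ℝ} (hm : ∀ k, 0 < m k) {t : ℝ} (ht : 0 < t) {N : ℕ}
    (hlt : ∀ i < N, m N * t ^ N < m i * t ^ i) (hge : ∀ i, N ≤ i → m N * t ^ N ≤ m i * t ^ i) :
    GammaUpper m t = N := by
  have hN : hfn m t = m N * t ^ N := le_antisymm (hfn_le hm ht N) (le_hfn ht fun i =>
    (lt_or_ge i N).elim (fun h => (hlt i h).le) (hge i))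
  refine le_antisymm (Nat.sInf_le hN) (le_of_not_gt fun h => ?_)
  have : hfn m t = m (GammaUpper m t) * t ^ GammaUpper m t := 
    Nat.sInf_mem (s := {k : ℕ | hfn m t = m k * t ^ k}) ⟨N, hN⟩
  have := hlt _ h
  linarith

lemma mul_lt_of_lt_GammaLower {m : ℕ → ℝ} (hm : ∀ k, 0 < m k) {t : ℝ} (ht : 0 < t) {k : ℕ}
    (hk : k < GammaLower m t) : m (k + 1) * t < m k := by
  have := Nat.notMem_of_lt_sInf hk
  simp only [mem_ofPred_eq, not_le] at this
  rw [div_lt_div_iff₀ (hm k) ht] at this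
  linarith

/-- At the vertices of the Newton polygon of `n`, the sequence `m` is dominated by `n`. -/
lemma le_pow_mul_of_GammaUpper_le {m n : ℕ → ℝ} (hm : ∀ k, 0 < m k) (hn : ∀ k, 0 < n k)
    (hm0 : m 0 = 1) (hn0 : n 0 = 1) (hnr : RootsTendsto n) {B : ℝ} (hB : 1 ≤ B)
    (hΓ : ∀ t : ℝ, 0 < t → GammaUpper n (B * t) ≤ GammaLower m t) (N : ℕ) :
    ∀ t : ℝ, 0 < t → GammaUpper n (B * t) = N → m N ≤ B ^ N * n N := by
  have hB0 : 0 < B := by linarith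
  induction N using Nat.strong_induction_on with
  | _ N ih =>
  intro t ht htN
  rcases Nat.eq_zero_or_pos N with rfl | hN
  · simp [hm0, hn0]
  have hBt : 0 < B * t := by positivity
  obtain ⟨i₀, hi₀, hmax⟩ := Finset.exists_max_image (Finset.range N)
    (fun i => (n N / n i) ^ ((1 : ℝ) / ((N - i : ℕ) : ℝ))) ⟨0, by simpa using hN⟩
  rw [Finset.mem_range] at hi₀
  set l : ℝ := (n N / n i₀) ^ ((1 : ℝ) / ((N - i₀ : ℕ) : ℝ)) with hl
  have hl0 : 0 < l := Real.rpow_pos_of_pos (div_pos (hn _) (hn _)) _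
  have root_pow : ∀ i < N, ((n N / n i) ^ ((1 : ℝ) / ((N - i : ℕ) : ℝ))) ^ (N - i) = n N / n i := by
    intro i hi
    have : ((N - i : ℕ) : ℝ) ≠ 0 := by
      have : N - i ≠ 0 := by omega
      exact_mod_cast this
    rw [← Real.rpow_natCast, ← Real.rpow_mul (div_pos (hn _) (hn _)).le, one_div_mul_cancel this,
      Real.rpow_one]
  have hle : ∀ i < N, n N ≤ n i * l ^ (N - i) := by
    intro i hi
    have h1 := pow_le_pow_left₀ (Real.rpow_nonneg (div_pos (hn N) (hn i)).le _)
      (hmax i (Finset.mem_range.2 hi)) (N - i)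
    rw [root_pow i hi, div_le_iff₀ (hn i)] at h1
    linarith
  have heq : n N = n i₀ * l ^ (N - i₀) := by
    rw [hl, root_pow i₀ hi₀, mul_div_cancel₀ _ (hn i₀).ne']
  have hbelow : ∀ i < N, n N * (B * t) ^ N < n i * (B * t) ^ i := by
    intro i hi
    have h1 := hfn_lt_of_lt_GammaUpper hn hBt (htN.symm ▸ hi : i < GammaUpper n (B * t))
    rwa [hfn_GammaUpper hn hnr hBt, htN] at h1
  have habove : ∀ i, N ≤ i → n N ≤ n i * (B * t) ^ (i - N) := by
    intro i hi
    have h1 := hfn_le hn hBt i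
    rw [hfn_GammaUpper hn hnr hBt, htN] at h1
    have h2 : (B * t) ^ i = (B * t) ^ (i - N) * (B * t) ^ N := by rw [← pow_add]; congr 1; omega
    rw [h2, ← mul_assoc] at h1
    exact le_of_mul_le_mul_right h1 (by positivity)
  have hlt1 : l * (B * t) < 1 := by
    have h1 := hbelow i₀ hi₀
    have h2 : (B * t) ^ N = (B * t) ^ (N - i₀) * (B * t) ^ i₀ := by
      rw [← pow_add]; congr 1; omega
    rw [h2, heq, ← mul_assoc] at h1
    have h3 := lt_of_mul_lt_mul_right h1 (by positivity)
    rw [mul_assoc, ← mul_pow] at h3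
    have h4 : (l * (B * t)) ^ (N - i₀) < 1 := by
      by_contra hc
      push Not at hc
      nlinarith [hn i₀]
    by_contra hc
    push Not at hc
    exact absurd (one_le_pow₀ hc) (not_le.2 h4)
  have hslope : ∀ k < N, m (k + 1) ≤ B * l * m k := by
    intro k hk
    by_contra hc
    push Not at hc
    set s : ℝ := max t (m k / m (k + 1)) with hs
    have hs0 : 0 < s := lt_max_of_lt_left ht
    have hs1 : l * (B * s) < 1 := by
      rcases max_choice t (m k / m (k + 1)) with h | h
      · rw [hs, h]; exact hlt1
      · rw [hs, h, ← mul_assoc, mul_div_assoc', div_lt_one (hm _)]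
        linarith
    have hΓs : GammaUpper n (B * s) = N := by
      refine GammaUpper_eq hn (by positivity) (fun i hi => ?_) (fun i hi => ?_)
      · have h2 : (B * s) ^ N = (B * s) ^ (N - i) * (B * s) ^ i := by
          rw [← pow_add]; congr 1; omega
        rw [h2, ← mul_assoc]
        refine mul_lt_mul_of_pos_right ?_ (by positivity)
        calc n N * (B * s) ^ (N - i) ≤ n i * l ^ (N - i) * (B * s) ^ (N - i) :=
              mul_le_mul_of_nonneg_right (hle i hi) (by positivity)
          _ = n i * (l * (B * s)) ^ (N - i) := by rw [mul_pow l, mul_assoc]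
          _ < n i * 1 := mul_lt_mul_of_pos_left
              (pow_lt_one₀ (by positivity) hs1 (by omega)) (hn i)
          _ = n i := mul_one _
      · have h2 : (B * s) ^ i = (B * s) ^ (i - N) * (B * s) ^ N := by
          rw [← pow_add]; congr 1; omega
        rw [h2, ← mul_assoc]
        refine mul_le_mul_of_nonneg_right ((habove i hi).trans ?_) (by positivity)
        refine mul_le_mul_of_nonneg_left ?_ (hn i).le
        exact pow_le_pow_left₀ hBt.le
          (mul_le_mul_of_nonneg_left (le_max_left _ _) hB0.le) _
    have h5 := mul_lt_of_lt_GammaLower hm hs0 (lt_of_lt_of_le (hΓs.symm ▸ hk) (hΓ s hs0))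
    have h6 : m k ≤ m (k + 1) * s := by
      calc m k = m (k + 1) * (m k / m (k + 1)) := by rw [mul_div_cancel₀ _ (hm _).ne']
        _ ≤ _ := mul_le_mul_of_nonneg_left (le_max_right _ _) (hm _).le
    linarith
  -- the previous vertex
  have hl1 : 0 < 1 / l := by positivity
  have hval : ∀ i ≤ N, n i * l ^ (N - i) = l ^ N * (n i * (1 / l) ^ i) := by
    intro i hi
    have : l ^ N = l ^ (N - i) * l ^ i := by rw [← pow_add]; congr 1; omega
    rw [this, one_div, inv_pow]
    field_simp
  have hinf : hfn n (1 / l) = n i₀ * (1 / l) ^ i₀ := by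
    have hpN := pow_pos hl0 N
    refine le_antisymm (hfn_le hn hl1 _) (le_hfn hl1 fun i => ?_)
    rcases lt_or_ge i N with hi | hi
    · refine le_of_mul_le_mul_left ?_ hpN
      rw [← hval i hi.le, ← hval i₀ hi₀.le, ← heq]
      exact hle i hi
    · have h1 : n i₀ * (1 / l) ^ i₀ = n N * (1 / l) ^ N := by
        refine mul_left_cancel₀ hpN.ne' ?_
        rw [← hval i₀ hi₀.le, ← heq, ← hval N le_rfl]
        simp
      rw [h1]
      have h2 : (1 / l) ^ i = (1 / l) ^ (i - N) * (1 / l) ^ N := by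
        rw [← pow_add]; congr 1; omega
      rw [h2, ← mul_assoc]
      refine mul_le_mul_of_nonneg_right ((habove i hi).trans ?_) (by positivity)
      refine mul_le_mul_of_nonneg_left (pow_le_pow_left₀ hBt.le ?_ _) (hn i).le
      rw [le_div_iff₀ hl0]
      linarith
  set N' := GammaUpper n (1 / l) with hN'
  have hN'lt : N' < N := lt_of_le_of_lt (Nat.sInf_le hinf) hi₀
  have hN'eq : n N = n N' * l ^ (N - N') := by
    rw [hval N' hN'lt.le, hN', ← hfn_GammaUpper hn hnr hl1, hinf, ← hval i₀ hi₀.le, heq]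
  have hih := ih N' hN'lt (1 / l / B) (by positivity) (by rw [mul_div_cancel₀ _ hB0.ne'])
  have hstep : ∀ p, N' + p ≤ N → m (N' + p) ≤ (B * l) ^ p * m N' := by
    intro p
    induction p with
    | zero => intro _; simp
    | succ p ihp =>
      intro hp
      have h1 := hslope (N' + p) (by omega)
      have h2 := ihp (by omega)
      calc m (N' + (p + 1)) ≤ B * l * m (N' + p) := h1
        _ ≤ B * l * ((B * l) ^ p * m N') := mul_le_mul_of_nonneg_left h2 (by positivity)
        _ = _ := by ring
  have h7 := hstep (N - N') (by omega)
  rw [Nat.add_sub_cancel' hN'lt.le] at h7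
  calc m N ≤ (B * l) ^ (N - N') * m N' := h7
    _ ≤ (B * l) ^ (N - N') * (B ^ N' * n N') := mul_le_mul_of_nonneg_left hih (by positivity)
    _ = B ^ (N - N') * B ^ N' * (n N' * l ^ (N - N')) := by rw [mul_pow]; ring
    _ = B ^ N * n N := by rw [← hN'eq, ← pow_add, Nat.sub_add_cancel hN'lt.le]

lemma exists_le_pow_mul_of_mg_lt_top {M N : ℕ → ℝ} (hM : IsWeightSeq M) (hN : IsWeightSeq N)
    (h : mg M N < ⊤) :
    ∃ C : ℝ, 1 ≤ C ∧ ∀ a b : ℕ, lc M (a + b) ≤ C ^ (a + b) * (lc N a * lc N b) := by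
  refine ⟨max 1 (mg M N).toReal, le_max_left _ _, fun a b => ?_⟩
  set C := max 1 (mg M N).toReal
  have hC : 1 ≤ C := le_max_left _ _
  have key : M (a + b) ≤ C ^ (a + b) * (N a * N b) := by
    rcases Nat.eq_zero_or_pos (a + b) with h0 | h0
    · obtain ⟨rfl, rfl⟩ : a = 0 ∧ b = 0 := by omega
      simp [hM.first, hN.first]
    have hNN : 0 < N a * N b := mul_pos (hN.pos a) (hN.pos b)
    have hq : 0 < M (a + b) / (N a * N b) := div_pos (hM.pos _) hNN
    have h1 : ENNReal.ofReal ((M (a + b) / (N a * N b)) ^ (((a : ℝ) + (b : ℝ))⁻¹)) ≤ mg M N :=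
      le_iSup_of_le a (le_iSup_of_le b (le_iSup_of_le h0 le_rfl))
    have h2 : (M (a + b) / (N a * N b)) ^ (((a : ℝ) + (b : ℝ))⁻¹) ≤ C := by
      refine le_trans ?_ (le_max_right _ _)
      exact (ENNReal.ofReal_le_iff_le_toReal h.ne).1 h1
    have h3 := pow_le_pow_left₀ (Real.rpow_nonneg hq.le _) h2 (a + b)
    have h4 : ((a : ℝ) + b) ≠ 0 := by
      have : ((a + b : ℕ) : ℝ) ≠ 0 := by positivity
      push_cast at this; exact this
    rw [← Real.rpow_natCast, ← Real.rpow_mul hq.le, Nat.cast_add, inv_mul_cancel₀ h4,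
      Real.rpow_one, div_le_iff₀ hNN] at h3
    exact h3
  have hfac : ((a.factorial : ℝ) * b.factorial) ≤ (a + b).factorial := by
    exact_mod_cast Nat.le_of_dvd (Nat.factorial_pos _) (Nat.factorial_mul_factorial_dvd_factorial_add a b)
  have hab : (0 : ℝ) < (a.factorial : ℝ) * b.factorial := by positivity
  have hNN : 0 ≤ C ^ (a + b) * (N a * N b) :=
    mul_nonneg (by positivity) (mul_pos (hN.pos a) (hN.pos b)).le
  calc lc M (a + b) ≤ C ^ (a + b) * (N a * N b) / (a + b).factorial :=
        div_le_div_of_nonneg_right key (by positivity)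
    _ ≤ C ^ (a + b) * (N a * N b) / (a.factorial * b.factorial) :=
        div_le_div_of_nonneg_left hNN hab hfac
    _ = _ := by simp only [lc]; field_simp

lemma hfn_le_sq {m n : ℕ → ℝ} (hm : ∀ k, 0 < m k) (hn : ∀ k, 0 < n k) (hnr : RootsTendsto n)
    {C : ℝ} (hC : 1 ≤ C) (h : ∀ a b : ℕ, m (a + b) ≤ C ^ (a + b) * (n a * n b)) {t : ℝ}
    (ht : 0 < t) : hfn m t ≤ hfn n (C * t) ^ 2 := by
  have hCt : 0 < C * t := by positivity
  obtain ⟨a, ha⟩ := exists_hfn_eq hn hnr hCt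
  calc hfn m t ≤ m (a + a) * t ^ (a + a) := hfn_le hm ht _
    _ ≤ C ^ (a + a) * (n a * n a) * t ^ (a + a) :=
      mul_le_mul_of_nonneg_right (h a a) (by positivity)
    _ = hfn n (C * t) ^ 2 := by rw [ha]; ring

lemma hfn_le_one {m : ℕ → ℝ} (hm : ∀ k, 0 < m k) (hm0 : m 0 = 1) {t : ℝ} (ht : 0 < t) :
    hfn m t ≤ 1 := by simpa [hm0] using hfn_le hm ht 0

/-- Iterating moderate growth: `h` of the first sequence is dominated by a `2^p`-th power. -/
lemma exists_hfn_le_pow_two_pow (M : ℕ → ℕ → ℝ) (i₀ p : ℕ)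
    (hws : ∀ i, i₀ ≤ i → i ≤ i₀ + p → IsWeightSeq (M i))
    (hroots : ∀ i, i₀ ≤ i → i ≤ i₀ + p → RootsTendsto (lc (M i)))
    (hmg : ∀ i, i₀ ≤ i → i < i₀ + p → mg (M i) (M (i + 1)) < ⊤) :
    ∃ C : ℝ, 1 ≤ C ∧ ∀ t : ℝ, 0 < t →
      hfn (lc (M i₀)) t ≤ hfn (lc (M (i₀ + p))) (C * t) ^ (2 ^ p) := by
  induction p with
  | zero => exact ⟨1, le_rfl, fun t _ => by simp⟩
  | succ p ih =>
    obtain ⟨C, hC, h⟩ := ih (fun i h1 h2 => hws i h1 (by omega))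
      (fun i h1 h2 => hroots i h1 (by omega)) (fun i h1 h2 => hmg i h1 (by omega))
    have hw1 := hws (i₀ + p) (by omega) (by omega)
    have hw2 := hws (i₀ + p + 1) (by omega) (by omega)
    obtain ⟨C', hC', h'⟩ := exists_le_pow_mul_of_mg_lt_top hw1 hw2 (hmg (i₀ + p) (by omega) (by omega))
    refine ⟨C' * C, one_le_mul_of_one_le_of_one_le hC' hC, fun t ht => (h t ht).trans ?_⟩
    have hCt : 0 < C * t := by positivity
    have h1 := hfn_le_sq (lc_pos hw1) (lc_pos hw2) (hroots _ (by omega) (by omega)) hC' h' hCt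
    calc hfn (lc (M (i₀ + p))) (C * t) ^ 2 ^ p
        ≤ (hfn (lc (M (i₀ + p + 1))) (C' * (C * t)) ^ 2) ^ 2 ^ p :=
          pow_le_pow_left₀ (hfn_nonneg (lc_pos hw1) hCt) h1 _
      _ = _ := by rw [← pow_mul, ← pow_succ', mul_assoc]; rfl

/-- Two constants theorem for a disc and its real diameter. -/
lemma norm_le_of_norm_le_on_real {F : ℂ → ℂ} {r a b : ℝ} (hr : 0 < r)
    (hF : DifferentiableOn ℂ F (ball 0 r)) (ha : 0 ≤ a) (hab : a ≤ b)
    (hb : ∀ z ∈ ball (0 : ℂ) r, ‖F z‖ ≤ b) (hreal : ∀ x : ℝ, |x| < r → ‖F x‖ ≤ a) :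
    ∀ z ∈ ball (0 : ℂ) (r / 4), ‖F z‖ ≤ a ^ (1 / 2 : ℝ) * b ^ (1 / 2 : ℝ) := by
  intro z hz
  rw [mem_ball_zero_iff] at hz
  have hb0 : 0 ≤ b := ha.trans hab
  have norm_cos : ∀ w : ℂ, ‖Complex.cos w‖ ^ 2 = Real.cos w.re ^ 2 + Real.sinh w.im ^ 2 := by
    intro w
    rw [Complex.cos_eq, ← Complex.ofReal_cos, ← Complex.ofReal_sin, ← Complex.ofReal_cosh,
      ← Complex.ofReal_sinh, Complex.sq_norm, Complex.normSq_apply]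
    simp only [Complex.sub_re, Complex.mul_re, Complex.ofReal_re, Complex.ofReal_im, Complex.I_re,
      Complex.I_im, Complex.sub_im, Complex.mul_im]
    have h1 := Real.cosh_sq w.im
    have h2 := Real.sin_sq_add_cos_sq w.re
    ring_nf
    rw [h1]
    have h3 : Real.sin w.re ^ 2 = 1 - Real.cos w.re ^ 2 := by linarith
    rw [h3]
    ring
  have cos_mem : ∀ w : ℂ, |w.im| ≤ 1 → (r / 2 : ℂ) * Complex.cos w ∈ ball (0 : ℂ) r := by
    intro w hw
    rw [mem_ball_zero_iff, norm_mul]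
    have h1 : ‖(r / 2 : ℂ)‖ = r / 2 := by
      rw [norm_div, Complex.norm_real, Real.norm_of_nonneg hr.le]; simp
    have h2 : ‖Complex.cos w‖ < 2 := by
      have h3 : ‖Complex.cos w‖ ≤ Real.cosh w.im := by
        refine abs_le_of_sq_le_sq' ?_ (Real.cosh_pos _).le |>.2
        rw [norm_cos, Real.cosh_sq]
        have := Real.cos_sq_le_one w.re
        linarith
      have h4 : Real.cosh w.im ≤ Real.cosh 1 := by
        rw [Real.cosh_le_cosh, abs_one]; exact hw
      have h5 : Real.cosh 1 < 2 := by
        rw [Real.cosh_eq]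
        have := Real.exp_one_lt_d9
        have h6 : Real.exp (-1) ≤ 1 := Real.exp_le_one_iff.2 (by norm_num)
        linarith
      linarith
    rw [h1]
    nlinarith [norm_nonneg (Complex.cos w)]
  obtain ⟨w, hw, hw0⟩ : ∃ w : ℂ, (r / 2 : ℂ) * Complex.cos w = z ∧ 0 ≤ w.im := by
    have hr' : (r / 2 : ℂ) ≠ 0 := by
      have : (r : ℂ) ≠ 0 := by exact_mod_cast hr.ne'
      simpa using this
    obtain ⟨w, hw⟩ := Complex.cos_surjective (z / (r / 2))
    rcases le_total 0 w.im with h | h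
    · exact ⟨w, by rw [hw, mul_div_cancel₀ _ hr'], h⟩
    · exact ⟨-w, by rw [Complex.cos_neg, hw, mul_div_cancel₀ _ hr'], by simpa using h⟩
  have hw1 : w.im ≤ 1 / 2 := by
    have h1 : ‖Complex.cos w‖ < 1 / 2 := by
      rw [← hw, norm_mul, norm_div, Complex.norm_real, Real.norm_of_nonneg hr.le] at hz
      simp only [Complex.norm_ofNat] at hz
      nlinarith [norm_nonneg (Complex.cos w)]
    have h2 := norm_cos w
    have h3 : w.im ≤ Real.sinh w.im := Real.self_le_sinh_iff.2 hw0
    nlinarith [norm_nonneg (Complex.cos w), sq_nonneg (Real.cos w.re)]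
  set G : ℂ → ℂ := fun s => F ((r / 2 : ℂ) * Complex.cos (Complex.I * s)) with hG
  have him : ∀ s : ℂ, (Complex.I * s).im = s.re := fun s => by simp
  have hmem : ∀ s : ℂ, s.re ∈ Icc (0 : ℝ) 1 →
      (r / 2 : ℂ) * Complex.cos (Complex.I * s) ∈ ball (0 : ℂ) r := by
    intro s hs
    exact cos_mem _ (by rw [him, abs_of_nonneg hs.1]; exact hs.2)
  have hz' : -Complex.I * w ∈ Complex.HadamardThreeLines.verticalClosedStrip 0 1 := by
    simp only [Complex.HadamardThreeLines.verticalClosedStrip, mem_preimage]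
    constructor <;> simp <;> linarith
  have hdiff : ∀ s : ℂ, s.re ∈ Icc (0 : ℝ) 1 → DifferentiableAt ℂ G s := by
    intro s hs
    refine DifferentiableAt.comp (𝕜 := ℂ) s (g := F)
      (f := fun s => (r / 2 : ℂ) * Complex.cos (Complex.I * s)) ?_ (by fun_prop)
    exact (hF _ (hmem s hs)).differentiableAt (isOpen_ball.mem_nhds (hmem s hs))
  have hd : DiffContOnCl ℂ G (Complex.HadamardThreeLines.verticalStrip 0 1) := by
    refine DifferentiableOn.diffContOnCl fun s hs => (hdiff s ?_).differentiableWithinAt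
    have : closure (Complex.HadamardThreeLines.verticalStrip 0 1) ⊆
        Complex.HadamardThreeLines.verticalClosedStrip 0 1 :=
      closure_minimal (preimage_mono Ioo_subset_Icc_self) (isClosed_Icc.preimage Complex.continuous_re)
    exact this hs
  have key := Complex.HadamardThreeLines.norm_le_interp_of_mem_verticalClosedStrip' (a := a)
    (b := b) zero_lt_one hz' hd
    ⟨b, by rintro _ ⟨s, hs, rfl⟩; exact hb _ (hmem s hs)⟩
    (fun s hs => by
      have hs0 : s.re = 0 := hs
      have hs1 : Complex.I * s = ((-s.im : ℝ) : ℂ) := by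
        apply Complex.ext <;> simp [hs0]
      have hx : (r / 2 : ℂ) * Complex.cos (Complex.I * s) =
          ((r / 2 * Real.cos (-s.im) : ℝ) : ℂ) := by
        rw [hs1]; push_cast; rfl
      simp only [hG]
      have hm := hmem s (by rw [hs0]; simp)
      rw [hx] at hm ⊢
      rw [mem_ball_zero_iff, Complex.norm_real] at hm
      exact hreal _ hm)
    (fun s hs => by
      have hs0 : s.re = 1 := hs
      exact hb _ (hmem s (by rw [hs0]; simp)))
  have hIw : Complex.I * (-Complex.I * w) = w := by
    rw [neg_mul, mul_neg, ← mul_assoc, Complex.I_mul_I]; simp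
  simp only [hG, hIw, hw] at key
  have hre : (-Complex.I * w).re = w.im := by simp
  rw [hre, sub_zero, sub_zero, div_one] at key
  refine key.trans ?_
  rcases ha.eq_or_lt with rfl | ha'
  · rw [Real.zero_rpow (by linarith), Real.zero_rpow (by norm_num)]; simp
  have hb' : 0 < b := ha'.trans_le hab
  calc a ^ (1 - w.im) * b ^ w.im
      = a ^ (1 / 2 : ℝ) * (a ^ (1 / 2 - w.im) * b ^ w.im) := by
        rw [← mul_assoc, ← Real.rpow_add ha']; congr 2; ring
    _ ≤ a ^ (1 / 2 : ℝ) * (b ^ (1 / 2 - w.im) * b ^ w.im) := by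
        gcongr
    _ = _ := by rw [← Real.rpow_add hb']; congr 2; ring

/-- The `p`-th finite difference of a sequence at `0`. -/
def finDiff {F : Type*} [AddCommGroup F] [Module ℝ F] (p : ℕ) (a : ℕ → F) : F :=
  ∑ i ∈ Finset.range (p + 1), ((-1 : ℝ) ^ (p - i) * (p.choose i : ℝ)) • a i

section finDiff

variable {F : Type*} [NormedAddCommGroup F] [NormedSpace ℝ F]

lemma finDiff_add (p : ℕ) (a b : ℕ → F) :
    finDiff p (fun i => a i + b i) = finDiff p a + finDiff p b := by
  simp [finDiff, smul_add, Finset.sum_add_distrib]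

lemma finDiff_sub (p : ℕ) (a b : ℕ → F) :
    finDiff p (fun i => a i - b i) = finDiff p a - finDiff p b := by
  simp [finDiff, smul_sub, Finset.sum_sub_distrib]

lemma finDiff_sum {ι : Type*} (p : ℕ) (s : Finset ι) (a : ι → ℕ → F) :
    finDiff p (fun i => ∑ l ∈ s, a l i) = ∑ l ∈ s, finDiff p (a l) := by
  simp only [finDiff, Finset.smul_sum]
  exact Finset.sum_comm

lemma norm_finDiff_le (p : ℕ) {a : ℕ → F} {c : ℝ} (h : ∀ i ≤ p, ‖a i‖ ≤ c) :
    ‖finDiff p a‖ ≤ 2 ^ p * c := by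
  have hsum : ∑ i ∈ Finset.range (p + 1), (p.choose i : ℝ) = 2 ^ p := by
    exact_mod_cast Nat.sum_range_choose p
  rw [← hsum, Finset.sum_mul]
  refine norm_sum_le_of_le _ fun i hi => ?_
  rw [norm_smul, norm_mul, norm_pow, norm_neg, norm_one, one_pow, one_mul,
    Real.norm_of_nonneg (by positivity)]
  exact mul_le_mul_of_nonneg_left (h i (by simpa [Nat.lt_succ_iff] using hi)) (by positivity)

lemma finDiff_pow_smul_eq_zero {p q : ℕ} (hq : q < p) (v : F) :
    finDiff p (fun i => ((i : ℝ) ^ q) • v) = 0 := by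
  have h := congrFun (fwdDiff_iter_pow_eq_zero_of_lt (R := ℝ) hq) 0
  rw [fwdDiff_iter_eq_sum_shift] at h
  simp only [finDiff, smul_smul, ← Finset.sum_smul]
  convert zero_smul ℝ v
  simpa using h

lemma finDiff_pow_self_smul (p : ℕ) (v : F) :
    finDiff p (fun i => ((i : ℝ) ^ p) • v) = (p.factorial : ℝ) • v := by
  have h := congrFun (fwdDiff_iter_eq_factorial (R := ℝ) (n := p)) 0
  rw [fwdDiff_iter_eq_sum_shift] at h
  simp only [finDiff, smul_smul, ← Finset.sum_smul]
  congr 1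
  simpa using h

end finDiff

/-- Taylor expansion of a bounded holomorphic function on a disc. -/
lemma exists_taylor_of_norm_le {r : ℝ} (hr : 0 < r) (p : ℕ) :
    ∀ {G : ℂ → ℂ} {K : ℝ}, DifferentiableOn ℂ G (ball 0 r) → (∀ z ∈ ball (0 : ℂ) r, ‖G z‖ ≤ K) →
    ∃ c : ℕ → ℂ, ∀ z ∈ ball (0 : ℂ) r,
      ‖G z - ∑ i ∈ Finset.range p, c i * z ^ i‖ ≤ K * (2 * ‖z‖ / r) ^ p := by
  induction p with
  | zero => intro G K _ hK; exact ⟨0, fun z hz => by simpa using hK z hz⟩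
  | succ p ih =>
    intro G K hG hK
    have h0 : (0 : ℂ) ∈ ball (0 : ℂ) r := mem_ball_self hr
    have hd : DifferentiableOn ℂ (dslope G 0) (ball 0 r) :=
      (Complex.differentiableOn_dslope (isOpen_ball.mem_nhds h0)).2 hG
    have hb : ∀ z ∈ ball (0 : ℂ) r, ‖dslope G 0 z‖ ≤ 2 * K / r := by
      intro z hz
      refine Complex.norm_dslope_le_div_of_mapsTo_ball hG (fun w hw => ?_) hz
      rw [mem_closedBall, dist_eq_norm]
      exact (norm_sub_le _ _).trans (by linarith [hK w hw, hK 0 h0])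
    obtain ⟨c, hc⟩ := ih hd hb
    refine ⟨fun i => if i = 0 then G 0 else c (i - 1), fun z hz => ?_⟩
    have h1 : G z = G 0 + z * dslope G 0 z := by
      have := sub_smul_dslope G 0 z
      rw [sub_zero, smul_eq_mul] at this
      rw [this]; ring
    rw [Finset.sum_range_succ']
    have h2 : G z - (∑ i ∈ Finset.range p,
        (if i + 1 = 0 then G 0 else c (i + 1 - 1)) * z ^ (i + 1) +
        (if 0 = 0 then G 0 else c (0 - 1)) * z ^ 0) =
        z * (dslope G 0 z - ∑ i ∈ Finset.range p, c i * z ^ i) := by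
      simp only [Nat.add_eq_zero_iff, one_ne_zero, and_false, if_false, if_true, pow_zero, mul_one,
        Nat.add_sub_cancel, pow_succ, ← mul_assoc, ← Finset.sum_mul]
      rw [h1]; ring
    rw [h2, norm_mul]
    calc ‖z‖ * ‖dslope G 0 z - ∑ i ∈ Finset.range p, c i * z ^ i‖
        ≤ ‖z‖ * (2 * K / r * (2 * ‖z‖ / r) ^ p) :=
          mul_le_mul_of_nonneg_left (hc z hz) (norm_nonneg _)
      _ = _ := by rw [pow_succ]; ring

lemma norm_finDiff_le_of_holomorphic {r : ℝ} (hr : 0 < r) {G : ℂ → ℂ} {K : ℝ} (hK0 : 0 ≤ K)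
    (hG : DifferentiableOn ℂ G (ball 0 r)) (hK : ∀ z ∈ ball (0 : ℂ) r, ‖G z‖ ≤ K)
    (p : ℕ) {h : ℝ} (h0 : 0 ≤ h) (hp : p * h < r) :
    ‖finDiff p (fun i => G ((i * h : ℝ) : ℂ))‖ ≤ K * (4 * (p * h) / r) ^ p := by
  obtain ⟨c, hc⟩ := exists_taylor_of_norm_le hr p hG hK
  have hpoly : finDiff p (fun i : ℕ => ∑ q ∈ Finset.range p, c q * (((i * h : ℝ) : ℂ)) ^ q) = 0 := by
    rw [finDiff_sum]
    refine Finset.sum_eq_zero fun q hq => ?_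
    have := finDiff_pow_smul_eq_zero (Finset.mem_range.1 hq) (c q * (h : ℂ) ^ q)
    rw [← this]
    congr 1
    ext i
    rw [Complex.real_smul]
    push_cast
    ring
  have hsplit : finDiff p (fun i => G ((i * h : ℝ) : ℂ)) = finDiff p (fun i : ℕ =>
      G ((i * h : ℝ) : ℂ) - ∑ q ∈ Finset.range p, c q * (((i * h : ℝ) : ℂ)) ^ q) := by
    rw [finDiff_sub, hpoly, sub_zero]
  rw [hsplit]
  have hmul : K * (4 * (p * h) / r) ^ p = 2 ^ p * (K * (2 * (p * h) / r) ^ p) := by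
    rw [show 4 * (↑p * h) / r = 2 * (2 * (↑p * h) / r) by ring, mul_pow]; ring
  rw [hmul]
  refine norm_finDiff_le p fun i hi => ?_
  have hi' : (i : ℝ) * h ≤ p * h := mul_le_mul_of_nonneg_right (by exact_mod_cast hi) h0
  have hn : ‖((i * h : ℝ) : ℂ)‖ = i * h := by
    rw [Complex.norm_real, Real.norm_of_nonneg (by positivity)]
  refine (hc _ (by rw [mem_ball_zero_iff, hn]; linarith)).trans ?_
  rw [hn]
  gcongr

/-- The real-linear map `h ↦ a h + b \bar h`. -/
def wirt (a b : ℂ) : ℂ →L[ℝ] ℂ :=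
  a • (1 : ℂ →L[ℝ] ℂ) + b • (Complex.conjCLE : ℂ →L[ℝ] ℂ)

lemma wirt_apply (a b h : ℂ) : wirt a b h = a * h + b * (starRingEnd ℂ) h := by
  simp [wirt]

lemma norm_wirt_le (a b : ℂ) : ‖wirt a b‖ ≤ ‖a‖ + ‖b‖ := by
  refine ContinuousLinearMap.opNorm_le_bound _ (by positivity) fun h => ?_
  rw [wirt_apply, add_mul]
  refine (norm_add_le _ _).trans ?_
  simp

/-- `f` is real differentiable at `z` with `∂f = a` and `\bar∂f = b`. -/
def HasWirt (f : ℂ → ℂ) (a b z : ℂ) : Prop := HasFDerivAt f (wirt a b) z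

lemma HasWirt.congr {f : ℂ → ℂ} {a b a' b' z : ℂ} (h : HasWirt f a b z)
    (ha : a = a') (hb : b = b') : HasWirt f a' b' z := by
  rwa [← ha, ← hb]

lemma hasWirt_of_hasDerivAt {f : ℂ → ℂ} {a z : ℂ} (h : HasDerivAt f a z) :
    HasWirt f a 0 z :=
  h.complexToReal_fderiv.congr_fderiv (by ext <;> simp [wirt_apply])

lemma hasWirt_const (c z : ℂ) : HasWirt (fun _ : ℂ => c) 0 0 z :=
  hasWirt_of_hasDerivAt (hasDerivAt_const z c)

lemma HasWirt.comp {f g : ℂ → ℂ} {a b c z : ℂ} (hg : HasDerivAt g c (f z))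
    (hf : HasWirt f a b z) : HasWirt (fun z => g (f z)) (c * a) (c * b) z :=
  (hg.complexToReal_fderiv.comp z hf).congr_fderiv (by ext <;> simp [wirt_apply] <;> ring)

lemma HasWirt.conj {f : ℂ → ℂ} {a b z : ℂ} (hf : HasWirt f a b z) :
    HasWirt (fun z => (starRingEnd ℂ) (f z)) ((starRingEnd ℂ) b) ((starRingEnd ℂ) a) z :=
  ((Complex.conjCLE : ℂ →L[ℝ] ℂ).hasFDerivAt.comp z hf).congr_fderiv
    (by ext <;> simp [wirt_apply, add_comm])

lemma HasWirt.add {f g : ℂ → ℂ} {a b c d z : ℂ} (hf : HasWirt f a b z)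
    (hg : HasWirt g c d z) : HasWirt (fun z => f z + g z) (a + c) (b + d) z :=
  (HasFDerivAt.add hf hg).congr_fderiv (by ext <;> simp [wirt_apply] <;> ring)

lemma HasWirt.sub {f g : ℂ → ℂ} {a b c d z : ℂ} (hf : HasWirt f a b z)
    (hg : HasWirt g c d z) : HasWirt (fun z => f z - g z) (a - c) (b - d) z :=
  (HasFDerivAt.sub hf hg).congr_fderiv (by ext <;> simp [wirt_apply] <;> ring)

lemma HasWirt.mul {f g : ℂ → ℂ} {a b c d z : ℂ} (hf : HasWirt f a b z)
    (hg : HasWirt g c d z) :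
    HasWirt (fun z => f z * g z) (a * g z + f z * c) (b * g z + f z * d) z :=
  (HasFDerivAt.mul hf hg).congr_fderiv (by ext <;> simp [wirt_apply] <;> ring)

lemma HasWirt.div {f g : ℂ → ℂ} {a b c d z : ℂ} (hf : HasWirt f a b z)
    (hg : HasWirt g c d z) (h0 : g z ≠ 0) :
    HasWirt (fun z => f z / g z)
      ((a * g z - f z * c) / g z ^ 2) ((b * g z - f z * d) / g z ^ 2) z := by
  have h2 := hf.mul (hg.comp (hasDerivAt_inv h0))
  simp only [div_eq_mul_inv (f _)]
  refine h2.congr ?_ ?_ <;> · field_simp; ring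

/-- The closed square with side `2 a`. -/
def square (a : ℝ) : Set ℂ := Icc (-a) a ×ℂ Icc (-a) a

lemma isCompact_square (a : ℝ) : IsCompact (square a) := isCompact_Icc.reProdIm isCompact_Icc

lemma integrableOn_square {E : Type*} [NormedAddCommGroup E] {a : ℝ} {g : ℂ → E}
    (hg : Continuous g) : MeasureTheory.IntegrableOn g (square a) :=
  hg.continuousOn.integrableOn_compact (isCompact_square a)

lemma setIntegral_square {E : Type*} [NormedAddCommGroup E] [NormedSpace ℝ E] [CompleteSpace E]
    {a : ℝ} (ha : 0 ≤ a) {g : ℂ → E}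
    (hg : Continuous g) : ∫ z in square a, g z =
      ∫ x in (-a)..a, ∫ y in (-a)..a, g (x + y * Complex.I) := by
  have haa : -a ≤ a := by linarith
  let e : ℂ ≃ᵐ ℝ × ℝ := Complex.measurableEquivRealProd
  have h1 := (Complex.volume_preserving_equiv_real_prod.symm _).setIntegral_preimage_emb
    e.symm.measurableEmbedding g (square a)
  rw [← h1]
  have h2 : e.symm ⁻¹' square a = Icc (-a) a ×ˢ Icc (-a) a := by
    ext p; rfl
  rw [h2, MeasureTheory.Measure.volume_eq_prod, MeasureTheory.setIntegral_prod]
  · simp only [intervalIntegral.integral_of_le haa, MeasureTheory.integral_Icc_eq_integral_Ioc]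
    simp only [Complex.measurableEquivRealProd_symm_apply, ← Complex.mk_eq_add_mul_I]
  · rw [← MeasureTheory.Measure.volume_eq_prod]
    refine ContinuousOn.integrableOn_compact (isCompact_Icc.prod isCompact_Icc) ?_
    exact (hg.comp Complex.equivRealProdCLM.symm.continuous).continuousOn

/-- The integral over the boundary of the square with side `2 a`. -/
def bdInt (a : ℝ) (f : ℂ → ℂ) : ℂ :=
  (∫ x in (-a)..a, f (x - a * Complex.I)) - (∫ x in (-a)..a, f (x + a * Complex.I)) +
    Complex.I * (∫ y in (-a)..a, f (a + y * Complex.I)) -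
    Complex.I * (∫ y in (-a)..a, f (-a + y * Complex.I))

lemma bdInt_eq_setIntegral {a : ℝ} (ha : 0 ≤ a) {f fa fb : ℂ → ℂ}
    (hf : ∀ z, HasWirt f (fa z) (fb z) z) (hfb : Continuous fb) :
    bdInt a f = 2 * Complex.I * ∫ z in square a, fb z := by
  have haa : -a ≤ a := by linarith
  have key := Complex.integral_boundary_rect_of_continuousOn_of_hasFDerivAt_real f
    (fun z => wirt (fa z) (fb z)) ⟨-a, -a⟩ ⟨a, a⟩
    (fun z _ => (HasFDerivAt.continuousAt (hf z)).continuousWithinAt) (fun z _ => hf z)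
  have h1 : ∀ z, Complex.I • (wirt (fa z) (fb z)) 1 - (wirt (fa z) (fb z)) Complex.I =
      2 * Complex.I * fb z := by
    intro z; simp [wirt_apply]; ring
  simp only [h1, uIcc_of_le haa] at key
  have h2 := key (integrableOn_square (continuous_const.mul hfb))
  have h3 : Continuous fun z => 2 * Complex.I * fb z := continuous_const.mul hfb
  rw [← MeasureTheory.integral_const_mul, setIntegral_square ha h3, ← h2, bdInt]
  simp [sub_eq_add_neg]

/-- The boundary of the square with side `2`. -/
def frame : Set ℂ := {z | max |z.re| |z.im| = 1}

lemma norm_bdInt_le {f : ℂ → ℂ} {c : ℝ} (h : ∀ z ∈ frame, ‖f z‖ ≤ c) :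
    ‖bdInt 1 f‖ ≤ 8 * c := by
  have side : ∀ γ : ℝ → ℂ, (∀ t ∈ Icc (-1 : ℝ) 1, γ t ∈ frame) →
      ‖∫ x in (-1 : ℝ)..1, f (γ x)‖ ≤ 2 * c := by
    intro γ hγ
    refine (intervalIntegral.norm_integral_le_of_norm_le_const (C := c) fun t ht => ?_).trans ?_
    · rw [uIoc_of_le (by norm_num)] at ht
      exact h _ (hγ t (Ioc_subset_Icc_self ht))
    · norm_num; linarith
  have i1 := side (fun x => x - (1 : ℝ) * Complex.I) (fun t ht => by
    simpa [frame, abs_le] using ht)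
  have i2 := side (fun x => x + (1 : ℝ) * Complex.I) (fun t ht => by
    simpa [frame, abs_le] using ht)
  have i3 := side (fun x => (1 : ℝ) + x * Complex.I) (fun t ht => by
    simpa [frame, abs_le] using ht)
  have i4 := side (fun x => -(1 : ℝ) + x * Complex.I) (fun t ht => by
    simpa [frame, abs_le] using ht)
  rw [bdInt]
  refine (norm_sub_le _ _).trans ?_
  refine (add_le_add_left ((norm_add_le _ _).trans (add_le_add_left (norm_sub_le _ _) _)) _).trans ?_
  simp only [norm_mul, Complex.norm_I, one_mul]
  linarith

lemma intervalIntegrable_sides {f : ℂ → ℂ} (hf : ContinuousOn f frame) :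
    IntervalIntegrable (fun x : ℝ => f (x - (1 : ℝ) * Complex.I)) MeasureTheory.volume (-1) 1 ∧
    IntervalIntegrable (fun x : ℝ => f (x + (1 : ℝ) * Complex.I)) MeasureTheory.volume (-1) 1 ∧
    IntervalIntegrable (fun x : ℝ => f ((1 : ℝ) + x * Complex.I)) MeasureTheory.volume (-1) 1 ∧
    IntervalIntegrable (fun x : ℝ => f (-(1 : ℝ) + x * Complex.I)) MeasureTheory.volume (-1) 1 := by
  have side : ∀ γ : ℝ → ℂ, Continuous γ → (∀ t ∈ Icc (-1 : ℝ) 1, γ t ∈ frame) →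
      IntervalIntegrable (fun x => f (γ x)) MeasureTheory.volume (-1) 1 := by
    intro γ hc hγ
    refine ContinuousOn.intervalIntegrable ?_
    rw [uIcc_of_le (by norm_num)]
    exact hf.comp hc.continuousOn hγ
  refine ⟨side _ (by fun_prop) ?_, side _ (by fun_prop) ?_, side _ (by fun_prop) ?_,
    side _ (by fun_prop) ?_⟩ <;> · intro t ht; simpa [frame, abs_le] using ht

lemma bdInt_sub {f g : ℂ → ℂ} (hf : ContinuousOn f frame) (hg : ContinuousOn g frame) :
    bdInt 1 (fun z => f z - g z) = bdInt 1 f - bdInt 1 g := by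
  obtain ⟨f1, f2, f3, f4⟩ := intervalIntegrable_sides hf
  obtain ⟨g1, g2, g3, g4⟩ := intervalIntegrable_sides hg
  simp only [bdInt]
  rw [intervalIntegral.integral_sub f1 g1, intervalIntegral.integral_sub f2 g2,
    intervalIntegral.integral_sub f3 g3, intervalIntegral.integral_sub f4 g4]
  ring

lemma bdInt_const_mul (c : ℂ) (f : ℂ → ℂ) :
    bdInt 1 (fun z => c * f z) = c * bdInt 1 f := by
  simp only [bdInt, intervalIntegral.integral_const_mul]
  ring

lemma hasWirt_re (z : ℂ) : HasWirt (fun z : ℂ => (z.re : ℂ)) (1 / 2) (1 / 2) z :=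
  ((Complex.ofRealCLM.comp Complex.reCLM).hasFDerivAt (x := z)).congr_fderiv (by
    ext h
    apply Complex.ext <;> simp [wirt_apply]
    ring)

lemma hasWirt_im (z : ℂ) :
    HasWirt (fun z : ℂ => (z.im : ℂ)) (-Complex.I / 2) (Complex.I / 2) z :=
  ((Complex.ofRealCLM.comp Complex.imCLM).hasFDerivAt (x := z)).congr_fderiv (by
    ext h
    apply Complex.ext <;> simp [wirt_apply] <;> ring)

lemma hasDerivAt_cutoff (t : ℂ) :
    HasDerivAt (fun t : ℂ => (4 - t ^ 2) ^ 2) (-4 * t * (4 - t ^ 2)) t := by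
  have := ((hasDerivAt_id t).pow 2).const_sub 4 |>.pow 2
  refine this.congr_deriv ?_
  simp; ring

lemma hasDerivAt_cutoff_deriv (t : ℂ) :
    HasDerivAt (fun t : ℂ => -4 * t * (4 - t ^ 2)) (12 * t ^ 2 - 16) t := by
  have := ((hasDerivAt_id t).const_mul (-4)).mul (((hasDerivAt_id t).pow 2).const_sub 4)
  refine this.congr_deriv ?_
  simp; ring

lemma ofReal_normSq_add (w : ℂ) (δ : ℝ) :
    w * (starRingEnd ℂ) w + (δ : ℂ) ^ 2 = ((‖w‖ ^ 2 + δ ^ 2 : ℝ) : ℂ) := by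
  rw [Complex.mul_conj, Complex.normSq_eq_norm_sq]; push_cast; ring

lemma hasWirt_normSq_add {P : ℂ → ℂ} {p' z : ℂ} (hP : HasDerivAt P p' z) (δ : ℝ) :
    HasWirt (fun z => P z * (starRingEnd ℂ) (P z) + (δ : ℂ) ^ 2)
      (p' * (starRingEnd ℂ) (P z)) (P z * (starRingEnd ℂ) p') z := by
  have h := hasWirt_of_hasDerivAt hP
  exact ((h.mul h.conj).add (hasWirt_const _ z)).congr (by simp) (by simp)

lemma mem_square {a : ℝ} {z : ℂ} : z ∈ square a ↔ |z.re| ≤ a ∧ |z.im| ≤ a := by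
  simp only [square, Complex.mem_reProdIm, mem_Icc, abs_le]

lemma measurableSet_square (a : ℝ) : MeasurableSet (square a) :=
  (isCompact_square a).isClosed.measurableSet

lemma volume_square {a : ℝ} (ha : 0 ≤ a) :
    (MeasureTheory.volume (square a)).toReal = 4 * a ^ 2 := by
  have h := setIntegral_square (E := ℝ) ha (g := fun _ => 1) continuous_const
  rw [MeasureTheory.setIntegral_const, smul_eq_mul, mul_one] at h
  rw [← MeasureTheory.measureReal_def, h]
  simp; ring

lemma volume_square_lt_top (a : ℝ) : MeasureTheory.volume (square a) < ⊤ :=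
  (isCompact_square a).measure_lt_top

/-- The complex Laplacian of `log (|P|² + δ²)` has mass `O(1 + log (1/δ))`. -/
lemma integral_laplacian_log_le {P : ℂ → ℂ} (hP : Differentiable ℂ P) {δ C : ℝ} (hδ : 0 < δ)
    (hδ1 : δ ≤ 1) (hC : ∀ z ∈ square 2, ‖P z‖ ≤ C) :
    ∫ z in square 1, (δ * ‖deriv P z‖ / (‖P z‖ ^ 2 + δ ^ 2)) ^ 2 ≤
      4096 * (C ^ 2 + 2 * Real.log (1 / δ)) := by
  have hP' : Differentiable ℂ (deriv P) := fun z =>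
    (hP.analyticAt z).deriv.differentiableAt
  have hPc : Continuous P := hP.continuous
  have hPc' : Continuous (deriv P) := hP'.continuous
  set cj := starRingEnd ℂ with hcj
  have hcjc : Continuous cj := Complex.continuous_conj
  set σ : ℂ → ℂ := fun z => P z * cj (P z) + (δ : ℂ) ^ 2 with hσdef
  have hσr : ∀ z, σ z = ((‖P z‖ ^ 2 + δ ^ 2 : ℝ) : ℂ) := fun z => ofReal_normSq_add _ _
  have hσpos : ∀ z, 0 < ‖P z‖ ^ 2 + δ ^ 2 := fun z => by positivity
  have hσ0 : ∀ z, σ z ≠ 0 := fun z => by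
    rw [hσr]; exact_mod_cast (hσpos z).ne'
  have hσc : Continuous σ := by fun_prop
  have hσw : ∀ z, HasWirt σ (deriv P z * cj (P z)) (P z * cj (deriv P z)) z := fun z =>
    hasWirt_normSq_add (hP z).hasDerivAt δ
  set A : ℂ → ℂ := fun z => deriv P z * cj (P z) / σ z with hAdef
  set W : ℂ → ℝ := fun z => (δ * ‖deriv P z‖ / (‖P z‖ ^ 2 + δ ^ 2)) ^ 2 with hWdef
  have hWC : ∀ z, (W z : ℂ) = deriv P z * cj (deriv P z) * δ ^ 2 / σ z ^ 2 := fun z => by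
    rw [hσr, hcj, Complex.mul_conj, Complex.normSq_eq_norm_sq, hWdef]
    push_cast
    field_simp
  have hWc : Continuous W := by
    refine (Continuous.div (by fun_prop) (by fun_prop) fun z => (hσpos z).ne').pow 2
  have hAw : ∀ z, ∃ a, HasWirt A a (W z) z := fun z => by
    have h1 := (hasWirt_of_hasDerivAt (hP' z).hasDerivAt).mul
      (hasWirt_of_hasDerivAt (hP z).hasDerivAt).conj
    refine ⟨_, (h1.div (hσw z) (hσ0 z)).congr rfl ?_⟩
    rw [hWC]
    simp only [hσdef, zero_mul, zero_add]
    ring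
  set φ : ℂ → ℂ := fun z => Complex.log (σ z) with hφdef
  have hslit : ∀ z, σ z ∈ Complex.slitPlane := fun z => by
    rw [hσr]; exact Complex.ofReal_mem_slitPlane.2 (hσpos z)
  have hφc : Continuous φ := hσc.clog hslit
  have hφr : ∀ z, φ z = (Real.log (‖P z‖ ^ 2 + δ ^ 2) : ℂ) := fun z => by
    rw [hφdef]; simp only
    rw [hσr, Complex.ofReal_log (hσpos z).le]
  have hφw : ∀ z, HasWirt φ (A z) (cj (A z)) z := fun z => by
    refine ((hσw z).comp (Complex.hasDerivAt_log (hslit z))).congr ?_ ?_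
    · rw [hAdef]; simp only; rw [div_eq_inv_mul]
    · have : cj (σ z) = σ z := by rw [hσr]; exact Complex.conj_ofReal _
      rw [hAdef]; simp only
      rw [map_div₀, this, map_mul, hcj, Complex.conj_conj, div_eq_inv_mul]; ring
  let χ : ℂ → ℂ := fun t => (4 - t ^ 2) ^ 2
  let χ' : ℂ → ℂ := fun t => -4 * t * (4 - t ^ 2)
  let χ'' : ℂ → ℂ := fun t => 12 * t ^ 2 - 16
  have hχx : ∀ z, HasWirt (fun z : ℂ => χ z.re) (χ' z.re * (1 / 2)) (χ' z.re * (1 / 2)) z :=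
    fun z => (hasWirt_re z).comp (hasDerivAt_cutoff _)
  have hχy : ∀ z, HasWirt (fun z : ℂ => χ z.im) (χ' z.im * (-Complex.I / 2))
      (χ' z.im * (Complex.I / 2)) z :=
    fun z => (hasWirt_im z).comp (hasDerivAt_cutoff _)
  have hχx' : ∀ z, HasWirt (fun z : ℂ => χ' z.re) (χ'' z.re * (1 / 2)) (χ'' z.re * (1 / 2)) z :=
    fun z => (hasWirt_re z).comp (hasDerivAt_cutoff_deriv _)
  have hχy' : ∀ z, HasWirt (fun z : ℂ => χ' z.im) (χ'' z.im * (-Complex.I / 2))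
      (χ'' z.im * (Complex.I / 2)) z :=
    fun z => (hasWirt_im z).comp (hasDerivAt_cutoff_deriv _)
  let X : ℂ → ℂ := fun z => χ z.re * χ z.im
  let X1 : ℂ → ℂ := fun z => (1 / 2) * (χ' z.re * χ z.im) - (Complex.I / 2) * (χ z.re * χ' z.im)
  let X2 : ℂ → ℂ := fun z => (1 / 2) * (χ' z.re * χ z.im) + (Complex.I / 2) * (χ z.re * χ' z.im)
  let X12 : ℂ → ℂ := fun z => (1 / 4) * (χ'' z.re * χ z.im + χ z.re * χ'' z.im)
  have hX : ∀ z, HasWirt X (X1 z) (X2 z) z := fun z =>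
    ((hχx z).mul (hχy z)).congr (by simp only [X1]; ring) (by simp only [X2]; ring)
  have hX1 : ∀ z, ∃ a, HasWirt X1 a (X12 z) z := fun z => by
    refine ⟨_, (((hasWirt_const (1 / 2) z).mul ((hχx' z).mul (hχy z))).sub
      ((hasWirt_const (Complex.I / 2) z).mul ((hχx z).mul (hχy' z)))).congr rfl ?_⟩
    simp only [X12]
    linear_combination (-1 / 4) * χ z.re * χ'' z.im * Complex.I_mul_I
  set f : ℂ → ℂ := fun z => X z * A z - φ z * X1 z with hf
  set b : ℂ → ℂ := fun z => X2 z * A z + X z * W z - (cj (A z) * X1 z + φ z * X12 z) with hb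
  have hfw : ∀ z, ∃ a, HasWirt f a (b z) z := fun z => by
    obtain ⟨a, ha⟩ := hAw z
    obtain ⟨c, hc⟩ := hX1 z
    exact ⟨_, ((hX z).mul ha).sub ((hφw z).mul hc)⟩
  choose fa hfa using hfw
  have hAc : Continuous A := Continuous.div (by fun_prop) hσc hσ0
  have hX2c : Continuous X2 := by fun_prop
  have hXc : Continuous X := by fun_prop
  have hX1c : Continuous X1 := by fun_prop
  have hX12c : Continuous X12 := by fun_prop
  have hWcc : Continuous fun z => (W z : ℂ) := Complex.continuous_ofReal.comp hWc
  have hbc : Continuous b := by fun_prop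
  have hst := bdInt_eq_setIntegral (a := 2) (by norm_num) hfa hbc
  have hχ2 : ∀ t : ℂ, t ^ 2 = 4 → χ t = 0 ∧ χ' t = 0 := fun t ht => by
    simp only [χ, χ']; rw [ht]; simp
  have hfx : ∀ z : ℂ, (z.re : ℂ) ^ 2 = 4 → f z = 0 := fun z hz => by
    obtain ⟨h1, h2⟩ := hχ2 _ hz
    simp only [hf, X, X1, h1, h2]; ring
  have hfy : ∀ z : ℂ, (z.im : ℂ) ^ 2 = 4 → f z = 0 := fun z hz => by
    obtain ⟨h1, h2⟩ := hχ2 _ hz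
    simp only [hf, X, X1, h1, h2]; ring
  have hbd : bdInt 2 f = 0 := by
    have e1 : ∀ x : ℝ, f (x - (2 : ℝ) * Complex.I) = 0 := fun x => hfy _ (by norm_num)
    have e2 : ∀ x : ℝ, f (x + (2 : ℝ) * Complex.I) = 0 := fun x => hfy _ (by norm_num)
    have e3 : ∀ x : ℝ, f ((2 : ℝ) + x * Complex.I) = 0 := fun x => hfx _ (by norm_num)
    have e4 : ∀ x : ℝ, f (-(2 : ℝ) + x * Complex.I) = 0 := fun x => hfx _ (by norm_num)
    simp only [bdInt, e1, e2, e3, e4]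
    simp
  have hint0 : ∫ z in square 2, b z = 0 := by
    rw [hbd] at hst
    have := hst.symm
    simpa using this
  let Xr : ℂ → ℝ := fun z => (4 - z.re ^ 2) ^ 2 * (4 - z.im ^ 2) ^ 2
  let Yr : ℂ → ℝ := fun z => (1 / 4) * ((12 * z.re ^ 2 - 16) * (4 - z.im ^ 2) ^ 2 +
    (4 - z.re ^ 2) ^ 2 * (12 * z.im ^ 2 - 16))
  let φr : ℂ → ℝ := fun z => Real.log (‖P z‖ ^ 2 + δ ^ 2)
  have hre : ∀ z, (b z).re = Xr z * W z - φr z * Yr z := fun z => by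
    have e1 : X2 z = cj (X1 z) := by
      simp only [X1, X2, χ, χ', hcj, map_sub, map_mul, map_pow, map_div₀, Complex.conj_I,
        Complex.conj_ofReal, map_neg, map_one, Complex.conj_ofNat]
      ring
    have e2 : X z = (Xr z : ℂ) := by simp only [X, Xr, χ]; push_cast; rfl
    have e3 : X12 z = (Yr z : ℂ) := by simp only [X12, Yr, χ, χ'']; push_cast; rfl
    have e4 : φ z = (φr z : ℂ) := hφr z
    simp only [hb]
    rw [e1, e2, e3, e4, hcj]
    simp only [Complex.sub_re, Complex.add_re, Complex.mul_re, Complex.conj_re, Complex.conj_im,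
      Complex.ofReal_re, Complex.ofReal_im]
    ring
  have hφrc : Continuous φr := by
    refine Continuous.log (by fun_prop) fun z => (hσpos z).ne'
  have hXrc : Continuous Xr := by fun_prop
  have hYrc : Continuous Yr := by fun_prop
  have hI : ∫ z in square 2, Xr z * W z = ∫ z in square 2, φr z * Yr z := by
    have h1 : ∫ z in square 2, (b z).re = 0 := by
      have := integral_re (𝕜 := ℂ) (integrableOn_square (a := 2) hbc)
      rw [hint0] at this
      exact this
    simp only [hre] at h1
    have h2 := MeasureTheory.integral_sub (integrableOn_square (a := 2) (hXrc.mul hWc))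
      (integrableOn_square (hφrc.mul hYrc))
    exact sub_eq_zero.1 (h2.symm.trans h1)
  have hW0 : ∀ z, 0 ≤ W z := fun z => sq_nonneg _
  have hX0 : ∀ z, 0 ≤ Xr z := fun z => by positivity
  have hlog0 : 0 ≤ Real.log (1 / δ) := Real.log_nonneg (by rw [le_div_iff₀ hδ]; linarith)
  have hsub : square 1 ⊆ square 2 := fun z hz => by
    rw [mem_square] at hz ⊢; constructor <;> linarith [hz.1, hz.2]
  calc ∫ z in square 1, W z ≤ ∫ z in square 1, Xr z * W z := by
        refine MeasureTheory.setIntegral_mono_on (integrableOn_square hWc)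
          (integrableOn_square (hXrc.mul hWc)) (measurableSet_square 1) fun z hz => ?_
        rw [mem_square] at hz
        have h1 : z.re ^ 2 ≤ 1 := by rw [← sq_abs]; exact pow_le_one₀ (abs_nonneg _) hz.1
        have h2 : z.im ^ 2 ≤ 1 := by rw [← sq_abs]; exact pow_le_one₀ (abs_nonneg _) hz.2
        have h3 : 1 ≤ Xr z := by
          simp only [Xr]
          exact one_le_mul_of_one_le_of_one_le (one_le_pow₀ (by linarith)) (one_le_pow₀ (by linarith))
        exact le_mul_of_one_le_left (hW0 z) h3
    _ ≤ ∫ z in square 2, Xr z * W z :=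
        MeasureTheory.setIntegral_mono_set (integrableOn_square (hXrc.mul hWc))
          (MeasureTheory.ae_of_all _ fun z => mul_nonneg (hX0 z) (hW0 z)) hsub.eventuallyLE
    _ = ∫ z in square 2, φr z * Yr z := hI
    _ ≤ ‖∫ z in square 2, φr z * Yr z‖ := Real.le_norm_self _
    _ ≤ ((C ^ 2 + 2 * Real.log (1 / δ)) * 256) * MeasureTheory.volume.real (square 2) := by
        refine MeasureTheory.norm_setIntegral_le_of_norm_le_const (volume_square_lt_top 2)
          fun z hz => ?_
        rw [norm_mul]
        have hφb : ‖φr z‖ ≤ C ^ 2 + 2 * Real.log (1 / δ) := by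
          have hPz := hC z hz
          have hP2 : ‖P z‖ ^ 2 ≤ C ^ 2 := pow_le_pow_left₀ (norm_nonneg _) hPz 2
          have hδ2 : δ ^ 2 ≤ 1 := pow_le_one₀ hδ.le hδ1
          rw [Real.norm_eq_abs, abs_le]
          constructor
          · have : Real.log (δ ^ 2) ≤ φr z :=
              Real.log_le_log (by positivity) (by nlinarith [sq_nonneg ‖P z‖])
            rw [Real.log_pow] at this
            rw [one_div, Real.log_inv]
            push_cast at this
            nlinarith [sq_nonneg C]
          · have := Real.log_le_sub_one_of_pos (hσpos z)
            simp only [φr]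
            nlinarith
        have hYb : ‖Yr z‖ ≤ 256 := by
          rw [mem_square] at hz
          have h1 : z.re ^ 2 ≤ 4 := by
            rw [← sq_abs]; nlinarith [abs_nonneg z.re, hz.1]
          have h2 : z.im ^ 2 ≤ 4 := by
            rw [← sq_abs]; nlinarith [abs_nonneg z.im, hz.2]
          have hb1 : ∀ t : ℝ, t ^ 2 ≤ 4 → |12 * t ^ 2 - 16| ≤ 32 := fun t ht => by
            rw [abs_le]; constructor <;> nlinarith [sq_nonneg t]
          have hb2 : ∀ t : ℝ, t ^ 2 ≤ 4 → |(4 - t ^ 2) ^ 2| ≤ 16 := fun t ht => by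
            rw [abs_of_nonneg (sq_nonneg _)]; nlinarith [sq_nonneg t]
          rw [Real.norm_eq_abs]
          simp only [Yr]
          rw [abs_mul]
          have h3 : |(12 * z.re ^ 2 - 16) * (4 - z.im ^ 2) ^ 2 +
              (4 - z.re ^ 2) ^ 2 * (12 * z.im ^ 2 - 16)| ≤ 32 * 16 + 16 * 32 := by
            refine (abs_add_le _ _).trans (add_le_add ?_ ?_) <;> rw [abs_mul]
            · exact mul_le_mul (hb1 _ h1) (hb2 _ h2) (abs_nonneg _) (by norm_num)
            · exact mul_le_mul (hb2 _ h1) (hb1 _ h2) (abs_nonneg _) (by norm_num)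
          rw [abs_of_nonneg (by norm_num : (0 : ℝ) ≤ 1 / 4)]
          linarith
        exact mul_le_mul hφb hYb (norm_nonneg _) (by positivity)
    _ = 4096 * (C ^ 2 + 2 * Real.log (1 / δ)) := by
        rw [MeasureTheory.measureReal_def, volume_square (by norm_num)]; ring

lemma le_norm_sub_of_mem_frame {z ζ : ℂ} (hz : z ∈ ball (0 : ℂ) (1 / 8)) (hζ : ζ ∈ frame) :
    7 / 8 ≤ ‖ζ - z‖ := by
  have h1 : 1 ≤ ‖ζ‖ := by
    rw [← (show max |ζ.re| |ζ.im| = 1 from hζ)]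
    exact max_le (Complex.abs_re_le_norm _) (Complex.abs_im_le_norm _)
  have h2 := norm_sub_norm_le ζ z
  rw [mem_ball_zero_iff] at hz
  linarith

lemma sub_ne_zero_of_mem_frame {z ζ : ℂ} (hz : z ∈ ball (0 : ℂ) (1 / 8)) (hζ : ζ ∈ frame) :
    ζ - z ≠ 0 := by
  have := le_norm_sub_of_mem_frame hz hζ
  rw [← norm_pos_iff]; linarith

lemma frame_subset_square : frame ⊆ square 1 := fun z hz => by
  have h : max |z.re| |z.im| = 1 := hz
  exact mem_square.2 ⟨h ▸ le_max_left _ _, h ▸ le_max_right _ _⟩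

/-- Cauchy-type integrals over the boundary of the square are holomorphic inside. -/
lemma differentiableOn_bdInt_div {g : ℂ → ℂ} (hg : Continuous g) :
    DifferentiableOn ℂ (fun z => bdInt 1 (fun ζ => g ζ / (ζ - z))) (ball 0 (1 / 8)) := by
  have side : ∀ γ : ℝ → ℂ, Continuous γ → (∀ t ∈ Icc (-1 : ℝ) 1, γ t ∈ frame) →
      ∀ z ∈ ball (0 : ℂ) (1 / 8),
      DifferentiableAt ℂ (fun z => ∫ t in (-1 : ℝ)..1, g (γ t) / (γ t - z)) z := by
    intro γ hc hγ z hz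
    have hcont : ∀ w ∈ ball (0 : ℂ) (1 / 8), ContinuousOn (fun t => g (γ t) / (γ t - w))
        (Icc (-1 : ℝ) 1) := fun w hw =>
      ((hg.comp hc).continuousOn).div (by fun_prop)
        fun t ht => sub_ne_zero_of_mem_frame hw (hγ t ht)
    have hcont' : ContinuousOn (fun t => g (γ t) / (γ t - z) ^ 2) (Icc (-1 : ℝ) 1) :=
      ((hg.comp hc).continuousOn).div (by fun_prop)
        fun t ht => pow_ne_zero 2 (sub_ne_zero_of_mem_frame hz (hγ t ht))
    have hu : uIcc (-1 : ℝ) 1 = Icc (-1) 1 := uIcc_of_le (by norm_num)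
    have hu' : uIoc (-1 : ℝ) 1 ⊆ Icc (-1) 1 := by
      rw [uIoc_of_le (by norm_num)]; exact Ioc_subset_Icc_self
    refine (intervalIntegral.hasDerivAt_integral_of_dominated_loc_of_deriv_le
      (F' := fun w t => g (γ t) / (γ t - w) ^ 2) (bound := fun t => 2 * ‖g (γ t)‖)
      (s := ball 0 (1 / 8)) (isOpen_ball.mem_nhds hz)
      ?_ ?_ ?_ ?_ ?_ ?_).2.differentiableAt
    · filter_upwards [isOpen_ball.mem_nhds hz] with w hw
      exact ((hcont w hw).mono hu').aestronglyMeasurable measurableSet_uIoc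
    · exact ContinuousOn.intervalIntegrable (by rw [hu]; exact hcont z hz)
    · exact (hcont'.mono hu').aestronglyMeasurable measurableSet_uIoc
    · refine MeasureTheory.ae_of_all _ fun t ht w hw => ?_
      have h1 := le_norm_sub_of_mem_frame hw (hγ t (hu' ht))
      rw [norm_div, norm_pow, div_le_iff₀ (by positivity)]
      have h2 : 1 ≤ 2 * ‖γ t - w‖ ^ 2 := by nlinarith
      nlinarith [norm_nonneg (g (γ t))]
    · exact ((hg.comp hc).norm.const_mul 2).intervalIntegrable _ _
    · refine MeasureTheory.ae_of_all _ fun t ht w hw => ?_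
      have h0 := sub_ne_zero_of_mem_frame hw (hγ t (hu' ht))
      have := (hasDerivAt_const w (g (γ t))).div ((hasDerivAt_id w).const_sub (γ t)) h0
      refine this.congr_deriv ?_
      simp
  intro z hz
  have i1 := side (fun x => x - (1 : ℝ) * Complex.I) (by fun_prop) (fun t ht => by
    simpa [frame, abs_le] using ht) z hz
  have i2 := side (fun x => x + (1 : ℝ) * Complex.I) (by fun_prop) (fun t ht => by
    simpa [frame, abs_le] using ht) z hz
  have i3 := side (fun x => (1 : ℝ) + x * Complex.I) (by fun_prop) (fun t ht => by
    simpa [frame, abs_le] using ht) z hz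
  have i4 := side (fun x => -(1 : ℝ) + x * Complex.I) (by fun_prop) (fun t ht => by
    simpa [frame, abs_le] using ht) z hz
  exact (((i1.sub i2).add (i3.const_mul Complex.I)).sub
    (i4.const_mul Complex.I)).differentiableWithinAt

lemma one_le_norm_bdInt_inv {z : ℂ} (hz : z ∈ ball (0 : ℂ) (1 / 8)) :
    1 ≤ ‖bdInt 1 (fun ζ => 1 / (ζ - z))‖ := by
  have hc : ContinuousOn (fun ζ => 1 / (ζ - z)) frame :=
    continuousOn_const.div (by fun_prop) fun ζ hζ => sub_ne_zero_of_mem_frame hz hζ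
  obtain ⟨f1, f2, f3, f4⟩ := intervalIntegrable_sides hc
  rw [mem_ball_zero_iff] at hz
  have hre := (abs_lt.1 ((Complex.abs_re_le_norm z).trans_lt hz))
  have him := (abs_lt.1 ((Complex.abs_im_le_norm z).trans_lt hz))
  have hsq : ∀ t : ℝ, t ∈ Icc (-1 : ℝ) 1 → ∀ r : ℝ, -(1 / 8) < r → r < 1 / 8 → 
      (t - r) ^ 2 ≤ (9 / 8) ^ 2 := fun t ht r h1 h2 => by
    rw [sq_le_sq, abs_of_pos (by norm_num : (0 : ℝ) < 9 / 8), abs_le]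
    constructor <;> linarith [ht.1, ht.2]
  have hfrac : ∀ p q : ℝ, 7 / 8 < p → p < 9 / 8 → q ^ 2 ≤ (9 / 8) ^ 2 →
      1 / 4 ≤ p / (p * p + q * q) := fun p q h1 h2 h3 => by
    rw [le_div_iff₀ (by nlinarith [mul_self_nonneg q])]; nlinarith
  have hparam : ∀ g : ℝ → ℝ, IntervalIntegrable g MeasureTheory.volume (-1) 1 →
      (∀ t ∈ Icc (-1 : ℝ) 1, 1 / 4 ≤ g t) → 1 / 2 ≤ ∫ t in (-1 : ℝ)..1, g t := fun g hg h => by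
    have := intervalIntegral.integral_mono_on (by norm_num) intervalIntegrable_const hg h
    refine le_trans (le_of_eq ?_) this
    simp; norm_num
  have hIm : ∀ {h : ℝ → ℂ}, IntervalIntegrable h MeasureTheory.volume (-1) 1 →
      IntervalIntegrable (fun t => (h t).im) MeasureTheory.volume (-1) 1 := fun hh =>
    ⟨MeasureTheory.Integrable.im hh.1, MeasureTheory.Integrable.im hh.2⟩
  have hRe : ∀ {h : ℝ → ℂ}, IntervalIntegrable h MeasureTheory.volume (-1) 1 →
      IntervalIntegrable (fun t => (h t).re) MeasureTheory.volume (-1) 1 := fun hh =>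
    ⟨MeasureTheory.Integrable.re hh.1, MeasureTheory.Integrable.re hh.2⟩
  have e1 : 1 / 2 ≤ ∫ t in (-1 : ℝ)..1, (1 / (t - (1 : ℝ) * Complex.I - z)).im :=
    hparam _ (hIm f1) (fun t ht => by
      have := hfrac (1 + z.im) (t - z.re) (by linarith) (by linarith) (hsq t ht _ hre.1 hre.2)
      convert this using 1
      simp [Complex.normSq_apply]
      congr 1 <;> ring)
  have e2 : 1 / 2 ≤ ∫ t in (-1 : ℝ)..1, -(1 / (t + (1 : ℝ) * Complex.I - z)).im :=
    hparam _ (hIm f2).neg (fun t ht => by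
      have := hfrac (1 - z.im) (t - z.re) (by linarith) (by linarith) (hsq t ht _ hre.1 hre.2)
      convert this using 1
      simp [Complex.normSq_apply]
      rw [← neg_div]; congr 1 <;> ring)
  have e3 : 1 / 2 ≤ ∫ t in (-1 : ℝ)..1, (1 / ((1 : ℝ) + t * Complex.I - z)).re :=
    hparam _ (hRe f3) (fun t ht => by
      have := hfrac (1 - z.re) (t - z.im) (by linarith) (by linarith) (hsq t ht _ him.1 him.2)
      convert this using 1
      simp [Complex.normSq_apply])
  have e4 : 1 / 2 ≤ ∫ t in (-1 : ℝ)..1, -(1 / (-(1 : ℝ) + t * Complex.I - z)).re :=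
    hparam _ (hRe f4).neg (fun t ht => by
      have := hfrac (1 + z.re) (t - z.im) (by linarith) (by linarith) (hsq t ht _ him.1 him.2)
      convert this using 1
      simp [Complex.normSq_apply]
      rw [← neg_div]; congr 1 <;> ring)
  refine le_trans ?_ (Complex.abs_im_le_norm _)
  refine le_trans ?_ (le_abs_self _)
  have imI : ∀ {h : ℝ → ℂ}, IntervalIntegrable h MeasureTheory.volume (-1) 1 →
      (∫ t in (-1 : ℝ)..1, h t).im = ∫ t in (-1 : ℝ)..1, (h t).im := fun hh =>
    (Complex.imCLM.intervalIntegral_comp_comm hh).symm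
  have reI : ∀ {h : ℝ → ℂ}, IntervalIntegrable h MeasureTheory.volume (-1) 1 →
      (∫ t in (-1 : ℝ)..1, h t).re = ∫ t in (-1 : ℝ)..1, (h t).re := fun hh =>
    (Complex.reCLM.intervalIntegral_comp_comm hh).symm
  rw [intervalIntegral.integral_neg] at e2 e4
  rw [bdInt, Complex.sub_im, Complex.add_im, Complex.sub_im, Complex.I_mul_im, Complex.I_mul_im,
    imI f1, imI f2, reI f3, reI f4]
  linarith

lemma integral_inv_sqrt_le {s x : ℝ} (hs : 0 < s) (hx : |x| ≤ 1) :
    ∫ t in (-1 : ℝ)..1, (√((t - x) ^ 2 + s ^ 2))⁻¹ ≤ 2 * Real.arsinh (2 / s) := by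
  have hd : ∀ t : ℝ, HasDerivAt (fun t => Real.arsinh ((t - x) / s))
      (√((t - x) ^ 2 + s ^ 2))⁻¹ t := fun t => by
    have h := (((hasDerivAt_id t).sub_const x).div_const s).arsinh
    refine h.congr_deriv ?_
    simp only [id]
    have : (t - x) ^ 2 + s ^ 2 = (1 + ((t - x) / s) ^ 2) * s ^ 2 := by field_simp; ring
    rw [this, Real.sqrt_mul (by positivity), Real.sqrt_sq hs.le, smul_eq_mul, mul_inv]
    ring
  have hc : Continuous fun t : ℝ => (√((t - x) ^ 2 + s ^ 2))⁻¹ :=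
    Continuous.inv₀ (by fun_prop) fun t => (Real.sqrt_pos.2 (by positivity)).ne'
  rw [intervalIntegral.integral_eq_sub_of_hasDerivAt (fun t _ => hd t)
    (hc.intervalIntegrable _ _)]
  rw [abs_le] at hx
  have h1 : Real.arsinh ((1 - x) / s) ≤ Real.arsinh (2 / s) :=
    Real.arsinh_le_arsinh.2 (by gcongr; linarith)
  have h2 : -Real.arsinh (2 / s) ≤ Real.arsinh ((-1 - x) / s) := by
    rw [← Real.arsinh_neg, Real.arsinh_le_arsinh, ← neg_div]
    gcongr; linarith
  linarith

lemma setIntegral_inv_le {s x : ℝ} (hs : 0 < s) (hx : |x| ≤ 1) :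
    ∫ ζ in square 1, (‖ζ - x‖ ^ 2 + s ^ 2)⁻¹ ≤ (2 * Real.arsinh (2 / s)) ^ 2 := by
  have hpos : ∀ a b : ℝ, 0 < √((a - b) ^ 2 + s ^ 2) := fun a b => Real.sqrt_pos.2 (by positivity)
  have hc1 : Continuous fun ζ : ℂ => (‖ζ - x‖ ^ 2 + s ^ 2)⁻¹ :=
    Continuous.inv₀ (by fun_prop) fun t => by positivity
  have hc2 : Continuous fun ζ : ℂ =>
      (√((ζ.re - x) ^ 2 + s ^ 2))⁻¹ * (√((ζ.im - 0) ^ 2 + s ^ 2))⁻¹ :=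
    (Continuous.inv₀ (by fun_prop) fun t => (hpos _ _).ne').mul
      (Continuous.inv₀ (by fun_prop) fun t => (hpos _ _).ne')
  have hT : 0 ≤ 2 * Real.arsinh (2 / s) := by
    have := Real.arsinh_nonneg_iff.2 (by positivity : 0 ≤ 2 / s)
    positivity
  calc ∫ ζ in square 1, (‖ζ - x‖ ^ 2 + s ^ 2)⁻¹
      ≤ ∫ ζ in square 1,
          (√((ζ.re - x) ^ 2 + s ^ 2))⁻¹ * (√((ζ.im - 0) ^ 2 + s ^ 2))⁻¹ := by
        refine MeasureTheory.setIntegral_mono (integrableOn_square hc1)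
          (integrableOn_square hc2) fun ζ => ?_
        simp only
        rw [← mul_inv]
        refine inv_anti₀ (mul_pos (hpos _ _) (hpos _ _)) ?_
        have h1 : ‖ζ - x‖ ^ 2 = (ζ.re - x) ^ 2 + ζ.im ^ 2 := by
          rw [← Complex.normSq_eq_norm_sq, Complex.normSq_apply]; simp; ring
        rw [h1, sub_zero]
        have h2 := Real.sq_sqrt (by positivity : 0 ≤ (ζ.re - x) ^ 2 + s ^ 2)
        have h3 := Real.sq_sqrt (by positivity : 0 ≤ ζ.im ^ 2 + s ^ 2)
        nlinarith [sq_nonneg (√((ζ.re - x) ^ 2 + s ^ 2) - √(ζ.im ^ 2 + s ^ 2)), sq_nonneg (ζ.re - x),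
          sq_nonneg ζ.im]
    _ = (∫ t in (-1 : ℝ)..1, (√((t - x) ^ 2 + s ^ 2))⁻¹) *
          ∫ t in (-1 : ℝ)..1, (√((t - 0) ^ 2 + s ^ 2))⁻¹ := by
        rw [setIntegral_square zero_le_one hc2]
        simp
    _ ≤ _ := by
        rw [sq (2 * Real.arsinh (2 / s))]
        refine mul_le_mul (integral_inv_sqrt_le hs hx) (integral_inv_sqrt_le hs (by simp)) ?_ hT
        exact intervalIntegral.integral_nonneg (by norm_num) fun t _ => by positivity

/-- A function with small `\bar∂`-derivative is close to a holomorphic function. -/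
lemma exists_holomorphic_near {u ua ub : ℂ → ℂ} {w : ℂ → ℝ} {c κ L s T : ℝ}
    (hu : ∀ z, HasWirt u (ua z) (ub z) z) (hub : Continuous ub) (hw : Continuous w)
    (hc : ∀ z ∈ square 1, ‖u z‖ ≤ c) (hκ : 0 ≤ κ) (hκw : ∀ z ∈ square 1, ‖ub z‖ ≤ κ * w z)
    (hL0 : 0 ≤ L) (hL : ∀ z ∈ square 1, ∀ z' ∈ square 1, ‖u z - u z'‖ ≤ L * ‖z - z'‖)
    (hs : 0 < s) (hT : T = 2 * Real.arsinh (2 / s)) :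
    ∃ R : ℂ → ℂ, DifferentiableOn ℂ R (ball 0 (1 / 8)) ∧
      (∀ z ∈ ball (0 : ℂ) (1 / 8), ‖R z‖ ≤ 10 * c) ∧
      ∀ x : ℝ, |x| < 1 / 8 → ‖R x - u x‖ ≤
        32 * c * s ^ 2 + κ * (∫ z in square 1, w z ^ 2) + (κ + L * s) * T ^ 2 := by
  have huc : Continuous u := continuous_iff_continuousAt.2 fun z =>
    HasFDerivAt.continuousAt (hu z)
  have hc0 : 0 ≤ c := (norm_nonneg _).trans (hc 0 (mem_square.2 (by simp)))
  set N : ℂ → ℂ := fun z => bdInt 1 (fun ζ => u ζ / (ζ - z)) with hN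
  set J : ℂ → ℂ := fun z => bdInt 1 (fun ζ => 1 / (ζ - z)) with hJ
  have hJ1 : ∀ z ∈ ball (0 : ℂ) (1 / 8), 1 ≤ ‖J z‖ := fun z hz => one_le_norm_bdInt_inv hz
  have hJ0 : ∀ z ∈ ball (0 : ℂ) (1 / 8), J z ≠ 0 := fun z hz => by
    rw [← norm_pos_iff]; linarith [hJ1 z hz]
  refine ⟨fun z => N z / J z, (differentiableOn_bdInt_div huc).div
    (differentiableOn_bdInt_div continuous_const) hJ0, fun z hz => ?_, fun x hx => ?_⟩
  · rw [norm_div]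
    refine (div_le_self (norm_nonneg _) (hJ1 z hz)).trans ?_
    refine (norm_bdInt_le (c := c / (7 / 8)) fun ζ hζ => ?_).trans (by linarith)
    rw [norm_div]
    exact div_le_div₀ hc0 (hc ζ (frame_subset_square hζ)) (by norm_num)
      (le_norm_sub_of_mem_frame hz hζ)
  have hxb : (x : ℂ) ∈ ball (0 : ℂ) (1 / 8) := by
    rwa [mem_ball_zero_iff, Complex.norm_real]
  have hxs : (x : ℂ) ∈ square 1 := mem_square.2 (by simp; linarith)
  have hR : ‖N x / J x - u x‖ ≤ ‖N x - u x * J x‖ := by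
    have : N x / J x - u x = (N x - u x * J x) / J x := by
      field_simp [hJ0 x hxb]
    rw [this, norm_div]
    exact div_le_self (norm_nonneg _) (hJ1 x hxb)
  refine hR.trans ?_
  set cj := starRingEnd ℂ with hcj
  have hcjc : Continuous cj := Complex.continuous_conj
  set σ : ℂ → ℂ := fun ζ => (ζ - x) * cj (ζ - x) + (s : ℂ) ^ 2 with hσ
  have hσr : ∀ ζ, σ ζ = ((‖ζ - x‖ ^ 2 + s ^ 2 : ℝ) : ℂ) := fun z => ofReal_normSq_add _ _
  have hσpos : ∀ ζ : ℂ, 0 < ‖ζ - x‖ ^ 2 + s ^ 2 := fun z => by positivity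
  have hσ0 : ∀ ζ, σ ζ ≠ 0 := fun z => by rw [hσr]; exact_mod_cast (hσpos z).ne'
  have hσn : ∀ ζ, ‖σ ζ‖ = ‖ζ - x‖ ^ 2 + s ^ 2 := fun ζ => by
    rw [hσr, Complex.norm_real, Real.norm_of_nonneg (hσpos ζ).le]
  have hsub : ∀ ζ : ℂ, HasDerivAt (fun ζ : ℂ => ζ - x) 1 ζ := fun ζ =>
    (hasDerivAt_id ζ).sub_const _
  set K : ℂ → ℂ := fun ζ => cj (ζ - x) / σ ζ with hK
  have hKw : ∀ ζ, ∃ a, HasWirt K a ((s : ℂ) ^ 2 / σ ζ ^ 2) ζ := fun ζ => by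
    refine ⟨_, ((hasWirt_of_hasDerivAt (hsub ζ)).conj.div (hasWirt_normSq_add (hsub ζ) s)
      (hσ0 ζ)).congr rfl ?_⟩
    simp only [hσ, map_one]
    ring
  have hσc : Continuous σ := by fun_prop
  have hKc : Continuous K := Continuous.div (by fun_prop) hσc hσ0
  set v : ℂ → ℂ := fun ζ => (u ζ - u x) * K ζ with hv
  set b : ℂ → ℂ := fun ζ => ub ζ * K ζ + (u ζ - u x) * ((s : ℂ) ^ 2 / σ ζ ^ 2) with hb
  have hvw : ∀ ζ, ∃ a, HasWirt v a (b ζ) ζ := fun ζ => by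
    obtain ⟨a, ha⟩ := hKw ζ
    exact ⟨_, (((hu ζ).sub (hasWirt_const (u x) ζ)).mul ha).congr rfl (by simp [hb])⟩
  choose va hva using hvw
  have hbc : Continuous b := (hub.mul hKc).add ((huc.sub continuous_const).mul
    (continuous_const.div (hσc.pow 2) fun ζ => pow_ne_zero 2 (hσ0 ζ)))
  have hst := bdInt_eq_setIntegral zero_le_one hva hbc
  have hcf : ∀ g : ℂ → ℂ, Continuous g → ContinuousOn (fun ζ => g ζ / (ζ - x)) frame :=
    fun g hg => hg.continuousOn.div (by fun_prop) fun ζ hζ => sub_ne_zero_of_mem_frame hxb hζ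
  have hsplit : N x - u x * J x = bdInt 1 (fun ζ => (u ζ - u x) / (ζ - x)) := by
    have h1 : ContinuousOn (fun ζ => u x * (1 / (ζ - x))) frame :=
      continuousOn_const.mul (hcf (fun _ => 1) continuous_const)
    rw [hN, hJ]
    simp only
    rw [← bdInt_const_mul, ← bdInt_sub (hcf u huc) h1]
    congr 1
    ext ζ
    ring
  have hdiff : ‖bdInt 1 (fun ζ => (u ζ - u x) / (ζ - x)) - bdInt 1 v‖ ≤ 32 * c * s ^ 2 := by
    have hvc : Continuous v := (huc.sub continuous_const).mul hKc
    rw [← bdInt_sub (hcf (fun ζ => u ζ - u x) (huc.sub continuous_const)) hvc.continuousOn]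
    refine (norm_bdInt_le (c := 4 * c * s ^ 2) fun ζ hζ => ?_).trans (by linarith)
    have h0 := sub_ne_zero_of_mem_frame hxb hζ
    have h78 := le_norm_sub_of_mem_frame hxb hζ
    have e1 : (u ζ - u x) / (ζ - x) - v ζ = (u ζ - u x) * ((s : ℂ) ^ 2 / ((ζ - x) * σ ζ)) := by
      have := hσ0 ζ
      simp only [hv, hK]
      field_simp
      simp only [hσ]
      ring
    rw [e1, norm_mul, norm_div, norm_mul, hσn, norm_pow, Complex.norm_real,
      Real.norm_of_nonneg hs.le]
    have e2 : ‖u ζ - u x‖ ≤ 2 * c :=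
      (norm_sub_le _ _).trans (by linarith [hc ζ (frame_subset_square hζ), hc x hxs])
    have e3 : s ^ 2 / (‖ζ - x‖ * (‖ζ - x‖ ^ 2 + s ^ 2)) ≤ 2 * s ^ 2 := by
      rw [div_le_iff₀ (by have := hσpos ζ; positivity)]
      have h1 : 1 ≤ 2 * (‖ζ - x‖ * (‖ζ - x‖ ^ 2 + s ^ 2)) := by
        have h2 : (7 / 8 : ℝ) ^ 2 ≤ ‖ζ - x‖ ^ 2 := pow_le_pow_left₀ (by norm_num) h78 2
        have h3 : 7 / 8 * (7 / 8 : ℝ) ^ 2 ≤ ‖ζ - x‖ * (‖ζ - x‖ ^ 2 + s ^ 2) :=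
          mul_le_mul h78 (by nlinarith) (by norm_num) (by positivity)
        linarith
      nlinarith [sq_nonneg s]
    calc _ ≤ 2 * c * (2 * s ^ 2) := mul_le_mul e2 e3 (by have := hσpos ζ; positivity) (by linarith)
      _ = _ := by ring
  have hinvc : Continuous fun ζ : ℂ => (‖ζ - x‖ ^ 2 + s ^ 2)⁻¹ :=
    Continuous.inv₀ (by fun_prop) fun t => by positivity
  have hbound : ‖∫ ζ in square 1, b ζ‖ ≤
      κ / 2 * (∫ z in square 1, w z ^ 2) + (κ + L * s) / 2 * T ^ 2 := by
    have hdom : Continuous fun ζ => κ / 2 * w ζ ^ 2 + (κ + L * s) / 2 * (‖ζ - x‖ ^ 2 + s ^ 2)⁻¹ := by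
      fun_prop
    have h1 : ‖∫ ζ in square 1, b ζ‖ ≤ ∫ ζ in square 1,
        (κ / 2 * w ζ ^ 2 + (κ + L * s) / 2 * (‖ζ - x‖ ^ 2 + s ^ 2)⁻¹) := by
      refine MeasureTheory.norm_integral_le_of_norm_le (integrableOn_square hdom) ?_
      refine (MeasureTheory.ae_restrict_iff' (measurableSet_square 1)).2
        (MeasureTheory.ae_of_all _ fun ζ hζ => ?_)
      set q := ‖ζ - x‖ with hq
      have hq0 : 0 ≤ q := norm_nonneg _
      have hσp : 0 < q ^ 2 + s ^ 2 := hσpos ζ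
      have hKn : ‖K ζ‖ = q / (q ^ 2 + s ^ 2) := by
        simp only [hK]; rw [norm_div, hσn, hcj, Complex.norm_conj]
      have hK2 : ‖K ζ‖ ^ 2 ≤ (q ^ 2 + s ^ 2)⁻¹ := by
        rw [hKn, div_pow, inv_eq_one_div, div_le_div_iff₀ (by positivity) hσp]
        nlinarith [sq_nonneg s]
      have t1 : ‖ub ζ * K ζ‖ ≤ κ / 2 * w ζ ^ 2 + κ / 2 * (q ^ 2 + s ^ 2)⁻¹ := by
        rw [norm_mul]
        calc ‖ub ζ‖ * ‖K ζ‖ ≤ κ * w ζ * ‖K ζ‖ :=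
              mul_le_mul_of_nonneg_right (hκw ζ hζ) (norm_nonneg _)
          _ = κ * (w ζ * ‖K ζ‖) := by ring
          _ ≤ κ * ((w ζ ^ 2 + (q ^ 2 + s ^ 2)⁻¹) / 2) := by
              gcongr; nlinarith [sq_nonneg (w ζ - ‖K ζ‖)]
          _ = _ := by ring
      have t2 : ‖(u ζ - u x) * ((s : ℂ) ^ 2 / σ ζ ^ 2)‖ ≤ L * s / 2 * (q ^ 2 + s ^ 2)⁻¹ := by
        rw [norm_mul, norm_div, norm_pow, norm_pow, hσn, Complex.norm_real,
          Real.norm_of_nonneg hs.le]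
        calc ‖u ζ - u x‖ * (s ^ 2 / (q ^ 2 + s ^ 2) ^ 2)
            ≤ L * q * (s ^ 2 / (q ^ 2 + s ^ 2) ^ 2) :=
              mul_le_mul_of_nonneg_right (hL ζ hζ x hxs) (by positivity)
          _ = L * s * (q * s / (q ^ 2 + s ^ 2) ^ 2) := by ring
          _ ≤ L * s * (1 / 2 * (q ^ 2 + s ^ 2)⁻¹) := by
              gcongr
              rw [div_le_iff₀ (by positivity), sq (q ^ 2 + s ^ 2)]
              have : 1 / 2 * (q ^ 2 + s ^ 2)⁻¹ * ((q ^ 2 + s ^ 2) * (q ^ 2 + s ^ 2)) =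
                1 / 2 * (q ^ 2 + s ^ 2) := by field_simp
              rw [this]
              nlinarith [sq_nonneg (q - s)]
          _ = _ := by ring
      calc ‖b ζ‖ ≤ _ := norm_add_le _ _
        _ ≤ _ := add_le_add t1 t2
        _ = _ := by ring
    refine h1.trans ?_
    have hi1 : MeasureTheory.IntegrableOn (fun ζ => κ / 2 * w ζ ^ 2) (square 1) :=
      integrableOn_square (by fun_prop)
    have hi2 : MeasureTheory.IntegrableOn
        (fun ζ : ℂ => (κ + L * s) / 2 * (‖ζ - x‖ ^ 2 + s ^ 2)⁻¹) (square 1) :=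
      integrableOn_square (by fun_prop)
    rw [MeasureTheory.integral_add hi1 hi2, MeasureTheory.integral_const_mul,
      MeasureTheory.integral_const_mul, hT]
    gcongr
    exact setIntegral_inv_le hs (by linarith)
  have hbv : ‖bdInt 1 v‖ ≤ κ * (∫ z in square 1, w z ^ 2) + (κ + L * s) * T ^ 2 := by
    rw [hst, norm_mul, norm_mul, Complex.norm_I]
    simp only [Complex.norm_ofNat, mul_one]
    linarith
  rw [hsplit]
  have := norm_add_le (bdInt 1 (fun ζ => (u ζ - u x) / (ζ - x)) - bdInt 1 v) (bdInt 1 v)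
  rw [sub_add_cancel] at this
  linarith

lemma le_of_pow_le_rpow_inv {j : ℕ} (hj : 1 ≤ j) {c y t : ℝ} (hc : 1 ≤ c) (ht : 0 ≤ t)
    (h : y ^ j ≤ c * t) : y ≤ c * t ^ (1 / j : ℝ) := by
  have hj0 : j ≠ 0 := by omega
  refine le_of_pow_le_pow_left₀ hj0 (by positivity) (h.trans ?_)
  rw [mul_pow, one_div, Real.rpow_inv_natCast_pow ht hj0]
  exact mul_le_mul_of_nonneg_right (le_self_pow₀ hc hj0) ht

lemma rpow_inv_mul_le {j : ℕ} (hj : 1 ≤ j) {δ t : ℝ} (hδ : 0 ≤ δ) (h : δ ≤ t) :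
    t ^ (1 / j : ℝ) * δ ≤ δ ^ (1 / j : ℝ) * t := by
  have hj0 : j ≠ 0 := by omega
  have ht : 0 ≤ t := hδ.trans h
  have h1 : δ ^ (1 / j : ℝ) ≤ t ^ (1 / j : ℝ) := Real.rpow_le_rpow hδ h (by positivity)
  have e1 : (δ ^ (1 / j : ℝ)) ^ j = δ := by rw [one_div, Real.rpow_inv_natCast_pow hδ hj0]
  have e2 : (t ^ (1 / j : ℝ)) ^ j = t := by rw [one_div, Real.rpow_inv_natCast_pow ht hj0]
  set d := δ ^ (1 / j : ℝ)
  set θ := t ^ (1 / j : ℝ)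
  have hd : 0 ≤ d := Real.rpow_nonneg hδ _
  have hθ : 0 ≤ θ := Real.rpow_nonneg ht _
  obtain ⟨i, rfl⟩ : ∃ i, j = i + 1 := ⟨j - 1, by omega⟩
  calc θ * δ = θ * d * d ^ i := by rw [← e1, pow_succ]; ring
    _ ≤ θ * d * θ ^ i := by gcongr
    _ = d * t := by rw [← e2, pow_succ]; ring

lemma arsinh_two_div_pow_le {δ : ℝ} (hδ : 0 < δ) (hδ1 : δ ≤ 1) :
    Real.arsinh (2 / δ ^ 5) ≤ 5 * (1 + Real.log (1 / δ)) := by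
  have h5 : 0 < δ ^ 5 := by positivity
  have h51 : δ ^ 5 ≤ 1 := pow_le_one₀ hδ.le hδ1
  set x := 2 / δ ^ 5 with hx
  have hx0 : 0 < x := by positivity
  have h1 : √(1 + x ^ 2) ≤ 1 + x := by
    rw [Real.sqrt_le_left (by positivity)]; nlinarith
  have h2 : x + √(1 + x ^ 2) ≤ 5 * (1 / δ) ^ 5 := by
    have h3 : 1 ≤ (1 / δ) ^ 5 := by
      rw [one_div, inv_pow]; exact (one_le_inv₀ h5).2 h51
    have h4 : x = 2 * (1 / δ) ^ 5 := by rw [hx, div_pow, one_pow]; ring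
    linarith
  have hexp : (5 : ℝ) ≤ Real.exp 5 := by have := Real.add_one_le_exp (5 : ℝ); linarith
  calc Real.arsinh x ≤ Real.log (5 * (1 / δ) ^ 5) :=
        Real.log_le_log (by positivity) h2
    _ = Real.log 5 + 5 * Real.log (1 / δ) := by
        rw [Real.log_mul (by norm_num) (by positivity), Real.log_pow]; norm_num
    _ ≤ 5 + 5 * Real.log (1 / δ) := by
        have := Real.log_le_log (by norm_num) hexp
        rw [Real.log_exp] at this
        linarith
    _ = _ := by ring

lemma rpow_inv_mul_sq_log_le {j : ℕ} (hj : 1 ≤ j) {δ : ℝ} (hδ : 0 < δ) (hδ1 : δ ≤ 1) :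
    δ ^ (1 / j : ℝ) * (1 + Real.log (1 / δ)) ^ 2 ≤ (1 + 4 * j) ^ 2 * δ ^ (1 / (2 * j) : ℝ) := by
  have hjr : (1 : ℝ) ≤ j := by exact_mod_cast hj
  have h1δ : 1 ≤ 1 / δ := by rw [le_div_iff₀ hδ]; linarith
  have hlog0 : 0 ≤ Real.log (1 / δ) := Real.log_nonneg h1δ
  have hlog := Real.log_le_rpow_div (x := 1 / δ) (ε := 1 / (4 * j)) (by positivity) (by positivity)
  set q := (1 / δ) ^ (1 / (4 * j) : ℝ) with hq
  have hq1 : 1 ≤ q := Real.one_le_rpow h1δ (by positivity)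
  have h1 : 1 + Real.log (1 / δ) ≤ (1 + 4 * j) * q := by
    have : q / (1 / (4 * j)) = 4 * j * q := by field_simp
    rw [this] at hlog
    nlinarith
  have h2 : (1 + Real.log (1 / δ)) ^ 2 ≤ ((1 + 4 * j) * q) ^ 2 :=
    pow_le_pow_left₀ (by positivity) h1 2
  have hq2 : δ ^ (1 / j : ℝ) * q ^ 2 = δ ^ (1 / (2 * j) : ℝ) := by
    rw [hq, one_div δ, Real.inv_rpow hδ.le, ← Real.rpow_neg hδ.le, ← Real.rpow_natCast,
      ← Real.rpow_mul hδ.le, ← Real.rpow_add hδ]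
    congr 1
    field_simp
    norm_num
  calc _ ≤ δ ^ (1 / j : ℝ) * ((1 + 4 * j) * q) ^ 2 := by gcongr
    _ = (1 + 4 * j) ^ 2 * (δ ^ (1 / j : ℝ) * q ^ 2) := by ring
    _ = _ := by rw [hq2]

lemma norm_deriv_le_of_norm_le {P : ℂ → ℂ} (hP : Differentiable ℂ P) {C : ℝ}
    (hC : ∀ z ∈ ball (0 : ℂ) 8, ‖P z‖ ≤ C) {z : ℂ} (hz : z ∈ square 2) : ‖deriv P z‖ ≤ C := by
  have h := Complex.norm_deriv_le_of_forall_mem_sphere_norm_le (c := z) (R := 1) (f := P) (C := C)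
    one_pos hP.diffContOnCl fun w hw => hC w ?_
  · simpa using h
  · rw [mem_square] at hz
    have h1 := Complex.norm_le_abs_re_add_abs_im z
    rw [mem_sphere_iff_norm] at hw
    have h2 := norm_add_le (w - z) z
    rw [sub_add_cancel] at h2
    rw [mem_ball_zero_iff]
    linarith [hz.1, hz.2]

lemma square_subset_ball : square 2 ⊆ ball (0 : ℂ) 8 := fun z hz => by
  rw [mem_square] at hz
  have h1 := Complex.norm_le_abs_re_add_abs_im z
  rw [mem_ball_zero_iff]
  linarith [hz.1, hz.2]

/-- Holomorphic approximation of the regularized quotient `\bar P Q / (|P|² + δ²)`. -/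
lemma exists_holomorphic_near_quotient {j : ℕ} (hj : 1 ≤ j) {C₀ C₃ : ℝ} (hC₀ : 1 ≤ C₀)
    (hC₃ : 1 ≤ C₃) :
    ∃ C, 0 < C ∧ ∀ δ : ℝ, 0 < δ → δ ≤ 1 → ∀ P Q : ℂ → ℂ, Differentiable ℂ P →
      Differentiable ℂ Q → (∀ z ∈ ball (0 : ℂ) 8, ‖P z‖ ≤ C₀) →
      (∀ z ∈ ball (0 : ℂ) 8, ‖Q z‖ ≤ C₀) →
      (∀ z ∈ square 1, ‖Q z‖ ^ j ≤ C₃ * √(‖P z‖ ^ 2 + δ ^ 2) ^ (j + 1)) →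
      ∃ R : ℂ → ℂ, DifferentiableOn ℂ R (ball 0 (1 / 8)) ∧
        (∀ z ∈ ball (0 : ℂ) (1 / 8), ‖R z‖ ≤ C) ∧
        ∀ x : ℝ, |x| < 1 / 8 →
          ‖R x - (starRingEnd ℂ) (P x) * Q x / (P x * (starRingEnd ℂ) (P x) + (δ : ℂ) ^ 2)‖ ≤
            C * δ ^ (1 / (2 * j) : ℝ) := by
  have hj0 : j ≠ 0 := by omega
  set c : ℝ := 2 * C₀ * C₃ with hcdef
  set E : ℝ := 32 * c + 8192 * C₀ ^ 2 * C₃ + 100 * C₃ + 400 * C₀ ^ 4 with hE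
  have hc0 : 0 < c := by positivity
  have hE0 : 0 < E := by positivity
  refine ⟨10 * c + E * (1 + 4 * j) ^ 2, by positivity, ?_⟩
  intro δ hδ hδ1 P Q hP hQ hPC hQC hQP
  set cj := starRingEnd ℂ with hcj
  have hcjc : Continuous cj := Complex.continuous_conj
  have hsub : square 1 ⊆ square 2 := fun z hz => by
    rw [mem_square] at hz ⊢; constructor <;> linarith [hz.1, hz.2]
  set σ : ℂ → ℂ := fun z => P z * cj (P z) + (δ : ℂ) ^ 2 with hσdef
  have hσr : ∀ z, σ z = ((‖P z‖ ^ 2 + δ ^ 2 : ℝ) : ℂ) := fun z => ofReal_normSq_add _ _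
  have hσpos : ∀ z, 0 < ‖P z‖ ^ 2 + δ ^ 2 := fun z => by positivity
  have hσ0 : ∀ z, σ z ≠ 0 := fun z => by rw [hσr]; exact_mod_cast (hσpos z).ne'
  have hσn : ∀ z, ‖σ z‖ = ‖P z‖ ^ 2 + δ ^ 2 := fun z => by
    rw [hσr, Complex.norm_real, Real.norm_of_nonneg (hσpos z).le]
  have hPc : Continuous P := hP.continuous
  have hQc : Continuous Q := hQ.continuous
  have hP' : Differentiable ℂ (deriv P) := fun z => (hP.analyticAt z).deriv.differentiableAt
  have hPc' : Continuous (deriv P) := hP'.continuous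
  have hσc : Continuous σ := by fun_prop
  set u : ℂ → ℂ := fun z => cj (P z) * Q z / σ z with hu
  set ua : ℂ → ℂ := fun z => (cj (P z) * deriv Q z * σ z -
    cj (P z) * Q z * (deriv P z * cj (P z))) / σ z ^ 2 with hua
  set ub : ℂ → ℂ := fun z => cj (deriv P z) * Q z * (δ : ℂ) ^ 2 / σ z ^ 2 with hub
  have huw : ∀ z, HasWirt u (ua z) (ub z) z := fun z => by
    refine (((hasWirt_of_hasDerivAt (hP z).hasDerivAt).conj.mul
      (hasWirt_of_hasDerivAt (hQ z).hasDerivAt)).div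
      (hasWirt_normSq_add (hP z).hasDerivAt δ) (hσ0 z)).congr ?_ ?_
    · simp [hua, hσdef, hcj]
    · simp only [hub, hσdef, hcj, mul_zero, add_zero]; ring
  have hubc : Continuous ub := Continuous.div (by fun_prop) (by fun_prop)
    fun z => pow_ne_zero 2 (hσ0 z)
  set w : ℂ → ℝ := fun z => δ * ‖deriv P z‖ / (‖P z‖ ^ 2 + δ ^ 2) with hw
  have hwc : Continuous w := Continuous.div (by fun_prop) (by fun_prop) fun z => (hσpos z).ne'
  set t : ℂ → ℝ := fun z => √(‖P z‖ ^ 2 + δ ^ 2) with ht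
  have ht0 : ∀ z, 0 < t z := fun z => Real.sqrt_pos.2 (hσpos z)
  have ht2 : ∀ z, ‖P z‖ ^ 2 + δ ^ 2 = t z ^ 2 := fun z => (Real.sq_sqrt (hσpos z).le).symm
  have hPt : ∀ z, ‖P z‖ ≤ t z := fun z => Real.le_sqrt_of_sq_le (by nlinarith)
  have hδt : ∀ z, δ ≤ t z := fun z => Real.le_sqrt_of_sq_le (by nlinarith [sq_nonneg ‖P z‖])
  have htC : ∀ z ∈ square 2, t z ≤ 2 * C₀ := fun z hz => by
    have h1 := hPC z (square_subset_ball hz)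
    rw [ht]; simp only
    rw [Real.sqrt_le_left (by positivity)]
    nlinarith [norm_nonneg (P z)]
  have hQt : ∀ z ∈ square 1, ‖Q z‖ ≤ C₃ * t z ^ (1 / j : ℝ) * t z := fun z hz => by
    have h1 : (‖Q z‖ / t z) ^ j ≤ C₃ * t z := by
      rw [div_pow, div_le_iff₀ (pow_pos (ht0 z) j)]
      calc _ ≤ _ := hQP z hz
        _ = _ := by rw [pow_succ]; ring
    have h2 := le_of_pow_le_rpow_inv hj hC₃ (ht0 z).le h1
    rwa [div_le_iff₀ (ht0 z)] at h2
  have huC : ∀ z ∈ square 1, ‖u z‖ ≤ c := fun z hz => by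
    have h1 : t z ^ (1 / j : ℝ) ≤ 2 * C₀ := by
      calc t z ^ (1 / j : ℝ) ≤ (2 * C₀) ^ (1 / j : ℝ) :=
            Real.rpow_le_rpow (ht0 z).le (htC z (hsub hz)) (by positivity)
        _ ≤ (2 * C₀) ^ (1 : ℝ) := by
            refine Real.rpow_le_rpow_of_exponent_le (by linarith) ?_
            rw [div_le_one (by positivity)]; exact_mod_cast hj
        _ = _ := Real.rpow_one _
    simp only [hu]
    rw [norm_div, norm_mul, hσn, ht2, hcj, Complex.norm_conj, div_le_iff₀ (pow_pos (ht0 z) 2)]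
    calc ‖P z‖ * ‖Q z‖ ≤ t z * (C₃ * t z ^ (1 / j : ℝ) * t z) :=
          mul_le_mul (hPt z) (hQt z hz) (norm_nonneg _) (ht0 z).le
      _ = (C₃ * t z ^ 2) * t z ^ (1 / j : ℝ) := by ring
      _ ≤ (C₃ * t z ^ 2) * (2 * C₀) := by gcongr
      _ = _ := by rw [hcdef]; ring
  set d : ℝ := δ ^ (1 / j : ℝ) with hd
  have hd0 : 0 < d := Real.rpow_pos_of_pos hδ _
  have hubw : ∀ z ∈ square 1, ‖ub z‖ ≤ C₃ * d * w z := fun z hz => by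
    simp only [hub, hw]
    rw [norm_div, norm_mul, norm_mul, norm_pow, norm_pow, hσn, ht2, hcj, Complex.norm_conj,
      Complex.norm_real, Real.norm_of_nonneg hδ.le, ← mul_div_assoc,
      div_le_div_iff₀ (by have := ht0 z; positivity) (pow_pos (ht0 z) 2)]
    have h1 := rpow_inv_mul_le hj hδ.le (hδt z)
    calc ‖deriv P z‖ * ‖Q z‖ * δ ^ 2 * t z ^ 2
        ≤ ‖deriv P z‖ * (C₃ * t z ^ (1 / j : ℝ) * t z) * δ ^ 2 * t z ^ 2 := by
          gcongr; exact hQt z hz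
      _ = C₃ * ‖deriv P z‖ * δ * t z ^ 3 * (t z ^ (1 / j : ℝ) * δ) := by ring
      _ ≤ C₃ * ‖deriv P z‖ * δ * t z ^ 3 * (d * t z) := by
          have := (ht0 z).le
          gcongr
      _ = _ := by ring
  set L : ℝ := 4 * C₀ ^ 4 / δ ^ 4 with hLdef
  have hL : ∀ z ∈ square 1, ∀ z' ∈ square 1, ‖u z - u z'‖ ≤ L * ‖z - z'‖ := by
    intro z hz z' hz'
    have hconv : Convex ℝ (square 1) := by
      have h : square 1 = Complex.reLm ⁻¹' Icc (-1) 1 ∩ Complex.imLm ⁻¹' Icc (-1) 1 := by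
        ext y; simp [mem_square, abs_le]
      rw [h]
      exact ((convex_Icc _ _).linear_preimage _).inter ((convex_Icc _ _).linear_preimage _)
    refine hconv.norm_image_sub_le_of_norm_hasFDerivWithin_le
      (f' := fun z => wirt (ua z) (ub z))
      (fun y _ => HasFDerivAt.hasFDerivWithinAt (huw y)) (fun y hy => ?_) hz' hz
    refine (norm_wirt_le _ _).trans ?_
    have p1 := hPC y (square_subset_ball (hsub hy))
    have q1 := hQC y (square_subset_ball (hsub hy))
    have p2 := norm_deriv_le_of_norm_le hP hPC (hsub hy)
    have q2 := norm_deriv_le_of_norm_le hQ hQC (hsub hy)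
    have s1 : ‖σ y‖ ≤ 2 * C₀ ^ 2 := by
      rw [hσn]; nlinarith [norm_nonneg (P y)]
    have s2 : δ ^ 4 ≤ ‖σ y‖ ^ 2 := by
      rw [hσn]
      calc δ ^ 4 = (δ ^ 2) ^ 2 := by ring
        _ ≤ _ := pow_le_pow_left₀ (by positivity) (by nlinarith [sq_nonneg ‖P y‖]) 2
    have a1 : ‖ua y‖ ≤ 3 * C₀ ^ 4 / δ ^ 4 := by
      simp only [hua]
      rw [norm_div, norm_pow]
      refine div_le_div₀ (by positivity) ((norm_sub_le _ _).trans ?_) (by positivity) s2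
      simp only [norm_mul, hcj, Complex.norm_conj]
      calc ‖P y‖ * ‖deriv Q y‖ * ‖σ y‖ + ‖P y‖ * ‖Q y‖ * (‖deriv P y‖ * ‖P y‖)
          ≤ C₀ * C₀ * (2 * C₀ ^ 2) + C₀ * C₀ * (C₀ * C₀) := by gcongr
        _ = _ := by ring
    have a2 : ‖ub y‖ ≤ C₀ ^ 4 / δ ^ 4 := by
      simp only [hub]
      rw [norm_div, norm_pow]
      refine div_le_div₀ (by positivity) ?_ (by positivity) s2
      simp only [norm_mul, hcj, Complex.norm_conj, norm_pow, Complex.norm_real]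
      rw [Real.norm_of_nonneg hδ.le]
      calc ‖deriv P y‖ * ‖Q y‖ * δ ^ 2 ≤ C₀ * C₀ * 1 := by
            gcongr; exact pow_le_one₀ hδ.le hδ1
        _ = C₀ ^ 2 := by ring
        _ ≤ C₀ ^ 4 := pow_le_pow_right₀ hC₀ (by norm_num)
    calc _ ≤ 3 * C₀ ^ 4 / δ ^ 4 + C₀ ^ 4 / δ ^ 4 := add_le_add a1 a2
      _ = L := by rw [hLdef]; ring
  obtain ⟨R, hR1, hR2, hR3⟩ := exists_holomorphic_near huw hubc hwc huC
    (by positivity : 0 ≤ C₃ * d) hubw (by positivity) hL (s := δ ^ 5) (by positivity) rfl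
  refine ⟨R, hR1, fun z hz => (hR2 z hz).trans (by
    have : 0 ≤ E * (1 + 4 * (j : ℝ)) ^ 2 := by positivity
    linarith), fun x hx => (hR3 x hx).trans ?_⟩
  set Λ : ℝ := 1 + Real.log (1 / δ) with hΛ
  have hlog0 : 0 ≤ Real.log (1 / δ) := Real.log_nonneg (by rw [le_div_iff₀ hδ]; linarith)
  have hΛ1 : 1 ≤ Λ := by linarith
  have hΛ2 : Λ ≤ Λ ^ 2 := le_self_pow₀ hΛ1 (by norm_num)
  have hδd : δ ≤ d := by
    calc δ = δ ^ (1 : ℝ) := (Real.rpow_one _).symm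
      _ ≤ d := by
        refine Real.rpow_le_rpow_of_exponent_ge hδ hδ1 ?_
        rw [div_le_one (by positivity)]; exact_mod_cast hj
  have hI : ∫ z in square 1, w z ^ 2 ≤ 8192 * C₀ ^ 2 * Λ ^ 2 := by
    refine (integral_laplacian_log_le hP hδ hδ1
      fun z hz => hPC z (square_subset_ball hz)).trans ?_
    have h1 : C₀ ^ 2 + 2 * Real.log (1 / δ) ≤ 2 * C₀ ^ 2 * Λ := by
      have : 1 ≤ C₀ ^ 2 := one_le_pow₀ hC₀
      rw [hΛ]; nlinarith
    calc _ ≤ 4096 * (2 * C₀ ^ 2 * Λ) := by gcongr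
      _ ≤ 4096 * (2 * C₀ ^ 2 * Λ ^ 2) := by gcongr
      _ = _ := by ring
  have hT : (2 * Real.arsinh (2 / δ ^ 5)) ^ 2 ≤ 100 * Λ ^ 2 := by
    have h0 : 0 ≤ Real.arsinh (2 / δ ^ 5) := Real.arsinh_nonneg_iff.2 (by positivity)
    have h1 := arsinh_two_div_pow_le hδ hδ1
    calc _ ≤ (2 * (5 * Λ)) ^ 2 := by gcongr
      _ = _ := by ring
  have hs2 : (δ ^ 5) ^ 2 ≤ d * Λ ^ 2 := by
    calc (δ ^ 5) ^ 2 = δ ^ 10 := by ring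
      _ ≤ δ := pow_le_of_le_one hδ.le hδ1 (by norm_num)
      _ ≤ d * 1 := by linarith
      _ ≤ _ := by gcongr; linarith
  have hLs : L * δ ^ 5 ≤ 4 * C₀ ^ 4 * d := by
    have : L * δ ^ 5 = 4 * C₀ ^ 4 * δ := by rw [hLdef]; field_simp
    rw [this]; gcongr
  calc 32 * c * (δ ^ 5) ^ 2 + C₃ * d * (∫ z in square 1, w z ^ 2) +
        (C₃ * d + L * δ ^ 5) * (2 * Real.arsinh (2 / δ ^ 5)) ^ 2
      ≤ 32 * c * (d * Λ ^ 2) + C₃ * d * (8192 * C₀ ^ 2 * Λ ^ 2) +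
        (C₃ * d + 4 * C₀ ^ 4 * d) * (100 * Λ ^ 2) := by gcongr
    _ = E * (d * Λ ^ 2) := by rw [hE]; ring
    _ ≤ E * ((1 + 4 * j) ^ 2 * δ ^ (1 / (2 * j) : ℝ)) :=
        mul_le_mul_of_nonneg_left (rpow_inv_mul_sq_log_le hj hδ hδ1) hE0.le
    _ ≤ _ := by
        rw [← mul_assoc]
        gcongr
        linarith

lemma norm_pow_sub_pow_le {a b : ℂ} {K : ℝ} (hK : 1 ≤ K) (ha : ‖a‖ ≤ K) (hb : ‖b‖ ≤ K) (n : ℕ) :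
    ‖a ^ n - b ^ n‖ ≤ n * K ^ n * ‖a - b‖ := by
  have h : ‖∑ i ∈ Finset.range n, a ^ i * b ^ (n - 1 - i)‖ ≤ n * K ^ n := by
    refine (norm_sum_le_of_le (f := fun i => a ^ i * b ^ (n - 1 - i)) (n := fun _ => K ^ n)
      _ fun i hi => ?_).trans (by simp)
    rw [norm_mul, norm_pow, norm_pow]
    have hi' := Finset.mem_range.1 hi
    calc ‖a‖ ^ i * ‖b‖ ^ (n - 1 - i) ≤ K ^ i * K ^ (n - 1 - i) := by gcongr
      _ = K ^ (i + (n - 1 - i)) := (pow_add _ _ _).symm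
      _ ≤ K ^ n := pow_le_pow_right₀ hK (by omega)
  rw [← (Commute.all a b).geom_sum₂_mul, norm_mul]
  gcongr

set_option maxHeartbeats 1000000 in
/-- If `F^j` and `F^{j+1}` are close to entire functions on an interval, then `F` is close to a
holomorphic function. -/
lemma exists_holomorphic_near_of_pow {j : ℕ} (hj : 1 ≤ j) {C₀ : ℝ} (hC₀ : 1 ≤ C₀) :
    ∃ C, 0 < C ∧ ∀ η : ℝ, 0 < η → η ≤ 1 → ∀ (F : ℝ → ℂ) (P Q : ℂ → ℂ), Differentiable ℂ P →
      Differentiable ℂ Q → (∀ z ∈ ball (0 : ℂ) 8, ‖P z‖ ≤ C₀) →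
      (∀ z ∈ ball (0 : ℂ) 8, ‖Q z‖ ≤ C₀) →
      (∀ x : ℝ, |x| < 8 → ‖F x ^ j - P x‖ ≤ C₀ * η) →
      (∀ x : ℝ, |x| < 8 → ‖F x ^ (j + 1) - Q x‖ ≤ C₀ * η) →
      ∃ R : ℂ → ℂ, DifferentiableOn ℂ R (ball 0 (1 / 8)) ∧
        (∀ z ∈ ball (0 : ℂ) (1 / 8), ‖R z‖ ≤ C) ∧
        ∀ x : ℝ, |x| < 1 / 8 → ‖F x - R x‖ ≤ C * η ^ (1 / (4 * j * (j + 1)) : ℝ) := by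
  have hj0 : j ≠ 0 := by omega
  set K : ℝ := 2 * C₀ with hK
  have hK1 : 1 ≤ K := by linarith
  set C₂ : ℝ := 2 * (j + 1) * K ^ (j + 2) with hC₂
  have hC₂1 : 0 < C₂ := by positivity
  obtain ⟨C, hC, hmain⟩ := exists_holomorphic_near_quotient hj hC₀
    (by linarith : (1 : ℝ) ≤ 1 + C₂)
  refine ⟨C + 5 * C₀ ^ 2, by positivity, ?_⟩
  intro η hη hη1 F P Q hP hQ hPC hQC hFP hFQ
  have hmem : ∀ x : ℝ, |x| < 8 → (x : ℂ) ∈ ball (0 : ℂ) 8 := fun x hx => by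
    simpa using hx
  have hFj : ∀ x : ℝ, |x| < 8 → ‖F x‖ ^ j ≤ ‖P x‖ + C₀ * η := fun x hx => by
    rw [← norm_pow]
    have := norm_add_le (F x ^ j - P x) (P x)
    rw [sub_add_cancel] at this
    linarith [hFP x hx]
  have hC₀η : C₀ * η ≤ C₀ := by nlinarith
  have hF : ∀ x : ℝ, |x| < 8 → ‖F x‖ ≤ K := fun x hx => by
    have := le_of_pow_le_rpow_inv hj hK1 zero_le_one (y := ‖F x‖)
      (by linarith [hFj x hx, hPC x (hmem x hx)])
    simpa using this
  -- the holomorphic function `P^{j+1} - Q^j`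
  have hG : ∀ z ∈ ball (0 : ℂ) 2, ‖P z ^ (j + 1) - Q z ^ j‖ ≤ C₂ * η ^ (1 / 2 : ℝ) := by
    have h := norm_le_of_norm_le_on_real (F := fun z => P z ^ (j + 1) - Q z ^ j) (r := 8)
      (a := C₂ * η) (b := C₂) (by norm_num)
      (((hP.pow (j + 1)).sub (hQ.pow j)).differentiableOn) (by positivity) (by nlinarith)
      (fun z hz => ?_) (fun x hx => ?_)
    · intro z hz
      refine (h z (by convert hz using 1; norm_num)).trans_eq ?_
      rw [Real.mul_rpow hC₂1.le hη.le, mul_right_comm, ← Real.rpow_add hC₂1]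
      norm_num
    · have h1 : ‖P z‖ ≤ K := (hPC z hz).trans (by linarith)
      have h2 : ‖Q z‖ ≤ K := (hQC z hz).trans (by linarith)
      refine (norm_sub_le _ _).trans ?_
      rw [norm_pow, norm_pow]
      calc ‖P z‖ ^ (j + 1) + ‖Q z‖ ^ j ≤ K ^ (j + 1) + K ^ j := by gcongr
        _ ≤ K ^ (j + 2) + K ^ (j + 2) := by gcongr <;> first | exact hK1 | omega
        _ = 2 * 1 * K ^ (j + 2) := by ring
        _ ≤ C₂ := by
          rw [hC₂]; gcongr
          have : (0 : ℝ) ≤ j := by positivity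
          linarith
    · have b0 : ∀ w : ℂ, ∀ y : ℂ, ‖y‖ ≤ C₀ → ‖w - y‖ ≤ C₀ * η → ‖w‖ ≤ K := fun w y h1 h2 => by
        have := norm_add_le (w - y) y
        rw [sub_add_cancel] at this
        linarith
      have p1 := hPC x (hmem x hx)
      have q1 := hQC x (hmem x hx)
      have h1 := norm_pow_sub_pow_le hK1 (b0 _ _ p1 (hFP x hx)) (p1.trans (by linarith)) (j + 1)
      have h2 := norm_pow_sub_pow_le hK1 (b0 _ _ q1 (hFQ x hx)) (q1.trans (by linarith)) j
      have e : P x ^ (j + 1) - Q x ^ j =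
          ((F x ^ (j + 1)) ^ j - Q x ^ j) - ((F x ^ j) ^ (j + 1) - P x ^ (j + 1)) := by
        rw [← pow_mul, ← pow_mul, mul_comm j (j + 1)]; ring
      rw [e]
      refine (norm_sub_le _ _).trans ((add_le_add h2 h1).trans ?_)
      have h3 := hFP x hx
      have h4 := hFQ x hx
      have hCK : C₀ ≤ K := by linarith
      push_cast
      calc (j : ℝ) * K ^ j * ‖F x ^ (j + 1) - Q x‖ + (j + 1) * K ^ (j + 1) * ‖F x ^ j - P x‖
          ≤ (j + 1) * K ^ (j + 1) * (K * η) + (j + 1) * K ^ (j + 1) * (K * η) := by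
            have h5 : C₀ * η ≤ K * η := by gcongr
            have h6 : (j : ℝ) * K ^ j ≤ (j + 1) * K ^ (j + 1) := by
              gcongr
              · linarith
              · omega
            gcongr
            · exact h4.trans h5
            · exact h3.trans h5
        _ = C₂ * η := by rw [hC₂]; ring
  set δ : ℝ := η ^ (1 / (2 * (j + 1)) : ℝ) with hδdef
  have hδ : 0 < δ := Real.rpow_pos_of_pos hη _
  have hδ1 : δ ≤ 1 := Real.rpow_le_one hη.le hη1 (by positivity)
  have hδj : δ ^ (j + 1) = η ^ (1 / 2 : ℝ) := by
    rw [hδdef, ← Real.rpow_natCast, ← Real.rpow_mul hη.le]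
    congr 1; push_cast; field_simp
  have hδη : η ≤ δ ^ 2 := by
    have : η = (δ ^ (j + 1)) ^ 2 := by
      rw [hδj, ← Real.rpow_natCast, ← Real.rpow_mul hη.le]; norm_num
    rw [this, ← pow_mul]
    exact pow_le_pow_of_le_one hδ.le hδ1 (by omega)
  have hδe : δ ^ (1 / (2 * j) : ℝ) = η ^ (1 / (4 * j * (j + 1)) : ℝ) := by
    rw [hδdef, ← Real.rpow_mul hη.le]
    congr 1; field_simp; norm_num
  obtain ⟨R, hR1, hR2, hR3⟩ := hmain δ hδ hδ1 P Q hP hQ hPC hQC fun z hz => by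
    have hzb : z ∈ ball (0 : ℂ) 2 := by
      rw [mem_square] at hz
      have hsq : ‖z‖ ^ 2 ≤ 2 := by
        rw [Complex.sq_norm, Complex.normSq_apply]
        nlinarith [sq_abs z.re, sq_abs z.im, abs_nonneg z.re, abs_nonneg z.im]
      rw [mem_ball_zero_iff]; nlinarith [norm_nonneg z]
    set τ := √(‖P z‖ ^ 2 + δ ^ 2)
    have hPτ : ‖P z‖ ≤ τ := Real.le_sqrt_of_sq_le (by nlinarith)
    have hδτ : δ ≤ τ := Real.le_sqrt_of_sq_le (by nlinarith [sq_nonneg ‖P z‖])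
    have h1 := hG z hzb
    have h2 := norm_sub_le (P z ^ (j + 1)) (P z ^ (j + 1) - Q z ^ j)
    rw [sub_sub_cancel, norm_pow, norm_pow] at h2
    calc ‖Q z‖ ^ j ≤ ‖P z‖ ^ (j + 1) + C₂ * δ ^ (j + 1) := by rw [hδj]; linarith
      _ ≤ τ ^ (j + 1) + C₂ * τ ^ (j + 1) := by gcongr
      _ = _ := by ring
  refine ⟨R, hR1, fun z hz => (hR2 z hz).trans (by nlinarith), fun x hx => ?_⟩
  have hx8 : |x| < 8 := by linarith
  set d : ℝ := δ ^ (1 / j : ℝ) with hd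
  have hjr : (1 : ℝ) ≤ j := by exact_mod_cast hj
  have hδd : δ ≤ d := by
    calc δ = δ ^ (1 : ℝ) := (Real.rpow_one _).symm
      _ ≤ d := Real.rpow_le_rpow_of_exponent_ge hδ hδ1 (by
        rw [div_le_one (by positivity)]; exact hjr)
  have hdle : d ≤ δ ^ (1 / (2 * j) : ℝ) :=
    Real.rpow_le_rpow_of_exponent_ge hδ hδ1 (by gcongr; linarith)
  set σ : ℂ := P x * (starRingEnd ℂ) (P x) + (δ : ℂ) ^ 2 with hσ
  have hσr : σ = ((‖P x‖ ^ 2 + δ ^ 2 : ℝ) : ℂ) := ofReal_normSq_add _ _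
  have hpos : 0 < ‖P x‖ ^ 2 + δ ^ 2 := by positivity
  set τ := √(‖P x‖ ^ 2 + δ ^ 2) with hτdef
  have hτ2 : ‖P x‖ ^ 2 + δ ^ 2 = τ ^ 2 := (Real.sq_sqrt hpos.le).symm
  have hτ : 0 < τ := Real.sqrt_pos.2 hpos
  have hPτ : ‖P x‖ ≤ τ := Real.le_sqrt_of_sq_le (by nlinarith)
  have hδτ : δ ≤ τ := Real.le_sqrt_of_sq_le (by nlinarith [sq_nonneg ‖P x‖])
  have hσ0 : σ ≠ 0 := by rw [hσr]; exact_mod_cast hpos.ne'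
  have hσn : ‖σ‖ = τ ^ 2 := by rw [hσr, Complex.norm_real, Real.norm_of_nonneg hpos.le, hτ2]
  have hFu : ‖F x - (starRingEnd ℂ) (P x) * Q x / σ‖ ≤ 5 * C₀ ^ 2 * d := by
    have e : F x - (starRingEnd ℂ) (P x) * Q x / σ =
        ((starRingEnd ℂ) (P x) * (F x * P x - Q x) + F x * (δ : ℂ) ^ 2) / σ := by
      field_simp
      rw [hσ]; ring
    have e2 : F x * P x - Q x = (F x ^ (j + 1) - Q x) - F x * (F x ^ j - P x) := by
      rw [pow_succ]; ring
    have h1 : ‖F x * P x - Q x‖ ≤ 3 * C₀ ^ 2 * η := by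
      rw [e2]
      refine (norm_sub_le _ _).trans ?_
      rw [norm_mul]
      calc _ ≤ C₀ * η + K * (C₀ * η) := by
            gcongr
            · exact hFQ x hx8
            · exact hF x hx8
            · exact hFP x hx8
        _ ≤ C₀ * C₀ * η + K * (C₀ * η) := by
            gcongr; nlinarith
        _ = _ := by rw [hK]; ring
    have h2 : ‖F x‖ ≤ K * τ ^ (1 / j : ℝ) := by
      refine le_of_pow_le_rpow_inv hj hK1 hτ.le ((hFj x hx8).trans ?_)
      have : η ≤ τ := by nlinarith
      calc _ ≤ τ + C₀ * τ := by gcongr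
        _ ≤ C₀ * τ + C₀ * τ := by gcongr; nlinarith
        _ = _ := by rw [hK]; ring
    have h3 := rpow_inv_mul_le hj hδ.le hδτ
    rw [e, norm_div, hσn, div_le_iff₀ (by positivity)]
    refine (norm_add_le _ _).trans ?_
    rw [norm_mul, norm_mul, Complex.norm_conj, norm_pow, Complex.norm_real,
      Real.norm_of_nonneg hδ.le]
    have h4 : η ≤ τ * d := hδη.trans (by rw [pow_two]; gcongr)
    calc ‖P x‖ * ‖F x * P x - Q x‖ + ‖F x‖ * δ ^ 2
        ≤ τ * (3 * C₀ ^ 2 * (τ * d)) + K * τ ^ (1 / j : ℝ) * δ ^ 2 := by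
          gcongr
          exact h1.trans (by gcongr)
      _ = 3 * C₀ ^ 2 * d * τ ^ 2 + K * δ * (τ ^ (1 / j : ℝ) * δ) := by ring
      _ ≤ 3 * C₀ ^ 2 * d * τ ^ 2 + K * τ * (d * τ) := by
          gcongr
      _ = 3 * C₀ ^ 2 * d * τ ^ 2 + 2 * C₀ * (d * τ ^ 2) := by rw [hK]; ring
      _ ≤ 3 * C₀ ^ 2 * d * τ ^ 2 + 2 * C₀ ^ 2 * (d * τ ^ 2) := by
          have : 0 ≤ d := hδ.le.trans hδd
          gcongr; exact le_self_pow₀ hC₀ two_ne_zero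
      _ = _ := by ring
  have h := norm_sub_le_norm_sub_add_norm_sub (F x) ((starRingEnd ℂ) (P x) * Q x / σ) (R x)
  rw [norm_sub_rev ((starRingEnd ℂ) (P x) * Q x / σ) (R x)] at h
  refine h.trans ((add_le_add hFu (hR3 x hx)).trans ?_)
  rw [hδe] at hdle ⊢
  calc _ ≤ 5 * C₀ ^ 2 * η ^ (1 / (4 * j * (j + 1)) : ℝ) + C * η ^ (1 / (4 * j * (j + 1)) : ℝ) := by
        gcongr
    _ = _ := by ring

section Taylor

variable {E F : Type*} [NormedAddCommGroup E] [NormedSpace ℝ E] [NormedAddCommGroup F]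
  [NormedSpace ℝ F]

lemma norm_sub_taylor_le_of_nonneg {g : ℝ → F} {b K : ℝ} {n : ℕ}
    (hg : ∀ t, |t| ≤ b → ContDiffAt ℝ (⊤ : ℕ∞) g t)
    (hK : ∀ t, |t| ≤ b → ‖iteratedDeriv (n + 1) g t‖ ≤ K) {t : ℝ} (ht0 : 0 ≤ t) (ht : t ≤ b) :
    ‖g t - ∑ k ∈ Finset.range (n + 1), ((k.factorial : ℝ)⁻¹ * t ^ k) • iteratedDeriv k g 0‖ ≤
      K * t ^ (n + 1) / n.factorial := by
  rcases eq_or_lt_of_le (ht0.trans ht) with hb | hb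
  · obtain rfl : t = 0 := by linarith
    rw [Finset.sum_range_succ']
    simp
  have habs : ∀ y ∈ Icc 0 b, |y| ≤ b := fun y hy => by rw [abs_of_nonneg hy.1]; exact hy.2
  have hu : UniqueDiffOn ℝ (Icc 0 b) := uniqueDiffOn_Icc hb
  have heq : ∀ k : ℕ, ∀ y ∈ Icc 0 b, iteratedDerivWithin k g (Icc 0 b) y = iteratedDeriv k g y :=
    fun k y hy => iteratedDerivWithin_eq_iteratedDeriv hu
      ((hg y (habs y hy)).of_le (by exact_mod_cast le_top)) hy
  have h := taylor_mean_remainder_bound (f := g) (a := 0) (b := b) (C := K) (x := t) (n := n) hb.le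
    (fun y hy => ((hg y (habs y hy)).of_le (by exact_mod_cast le_top)).contDiffWithinAt)
    ⟨ht0, ht⟩ (fun y hy => by rw [heq _ y hy]; exact hK y (habs y hy))
  rw [taylor_within_apply] at h
  simpa only [heq _ 0 ⟨le_rfl, hb.le⟩, sub_zero] using h

lemma norm_sub_taylor_le {g : ℝ → F} {b K : ℝ} {n : ℕ}
    (hg : ∀ t, |t| ≤ b → ContDiffAt ℝ (⊤ : ℕ∞) g t)
    (hK : ∀ t, |t| ≤ b → ‖iteratedDeriv (n + 1) g t‖ ≤ K) {t : ℝ} (ht : |t| ≤ b) :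
    ‖g t - ∑ k ∈ Finset.range (n + 1), ((k.factorial : ℝ)⁻¹ * t ^ k) • iteratedDeriv k g 0‖ ≤
      K * |t| ^ (n + 1) / n.factorial := by
  rcases le_total 0 t with h0 | h0
  · rw [abs_of_nonneg h0] at ht ⊢
    exact norm_sub_taylor_le_of_nonneg hg hK h0 ht
  · rw [abs_of_nonpos h0] at ht ⊢
    have h := norm_sub_taylor_le_of_nonneg (g := fun y => g (-y)) (b := b) (K := K) (n := n)
      (fun y hy => ContDiffAt.comp (g := g) (f := fun y : ℝ => -y) y (hg (-y) (by rwa [abs_neg]))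
        contDiffAt_id.neg)
      (fun y hy => by
        rw [iteratedDeriv_comp_neg, norm_smul, norm_pow, norm_neg, norm_one, one_pow, one_mul]
        exact hK (-y) (by rwa [abs_neg])) (neg_nonneg.2 h0) ht
    convert h using 3
    · rw [neg_neg]
    · refine Finset.sum_congr rfl fun k _ => ?_
      rw [iteratedDeriv_comp_neg, smul_smul, neg_zero, neg_pow t]
      have : (-1 : ℝ) ^ k * (-1) ^ k = 1 := by rw [← mul_pow]; norm_num
      congr 1
      linear_combination -((k.factorial : ℝ)⁻¹ * t ^ k) * this

lemma iteratedDeriv_line {f : E → F} {V : Set E} (hV : IsOpen V)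
    (hf : ContDiffOn ℝ (⊤ : ℕ∞) f V) (x v : E) (k : ℕ) :
    ∀ t : ℝ, x + t • v ∈ V →
      iteratedDeriv k (fun s : ℝ => f (x + s • v)) t =
        iteratedFDeriv ℝ k f (x + t • v) (fun _ => v) := by
  induction k with
  | zero => intro t _; simp
  | succ k ih =>
    intro t ht
    have hc : Continuous fun s : ℝ => x + s • v := by fun_prop
    have hev : iteratedDeriv k (fun s : ℝ => f (x + s • v)) =ᶠ[𝓝 t]
        fun s => iteratedFDeriv ℝ k f (x + s • v) (fun _ => v) := by
      filter_upwards [(hV.preimage hc).mem_nhds ht] with s hs using ih s hs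
    rw [iteratedDeriv_succ, hev.deriv_eq]
    have hd : DifferentiableAt ℝ (iteratedFDeriv ℝ k f) (x + t • v) :=
      ((hf.contDiffAt (hV.mem_nhds ht)).differentiableAt_iteratedFDeriv
        (by exact_mod_cast ENat.natCast_lt_top k))
    have hline : HasDerivAt (fun s : ℝ => x + s • v) v t := by
      simpa using ((hasDerivAt_id t).smul_const v).const_add x
    have h1 := hd.hasFDerivAt.comp_hasDerivAt t hline
    have h2 := ((ContinuousMultilinearMap.apply ℝ (fun _ : Fin k => E) F
      (fun _ => v)).hasFDerivAt (x := iteratedFDeriv ℝ k f (x + t • v))).comp_hasDerivAt t h1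
    exact h2.deriv

lemma contDiffAt_line {f : E → F} {V : Set E} (hV : IsOpen V)
    (hf : ContDiffOn ℝ (⊤ : ℕ∞) f V) (x v : E) {t : ℝ} (ht : x + t • v ∈ V) :
    ContDiffAt ℝ (⊤ : ℕ∞) (fun s : ℝ => f (x + s • v)) t :=
  ContDiffAt.comp t (hf.contDiffAt (hV.mem_nhds ht))
    (contDiffAt_const.add (contDiffAt_id.smul contDiffAt_const))

end Taylor

lemma mul_pow_le_one_of_le_GammaLower {m : ℕ → ℝ} (hm : ∀ k, 0 < m k) (hm0 : m 0 = 1) {t : ℝ}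
    (ht : 0 < t) (k : ℕ) (hk : k ≤ GammaLower m t) : m k * t ^ k ≤ 1 := by
  induction k with
  | zero => simp [hm0]
  | succ k ih =>
    have h := mul_lt_of_lt_GammaLower hm ht (Nat.lt_of_succ_le hk)
    calc m (k + 1) * t ^ (k + 1) = m (k + 1) * t * t ^ k := by ring
      _ ≤ m k * t ^ k := by gcongr
      _ ≤ 1 := ih (by omega)

/-- Optimal Taylor polynomials: a function with derivative bounds is close to an entire function on
a small interval. -/
lemma exists_entire_near {M N : ℕ → ℝ} (hM : IsWeightSeq M) (hN : IsWeightSeq N)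
    (hNr : RootsTendsto (lc N)) {B : ℝ} (hB : 1 ≤ B)
    (hΓ : ∀ t : ℝ, 0 < t → GammaUpper (lc N) (B * t) ≤ GammaLower (lc M) t)
    {C ρ ε : ℝ} (hC : 0 ≤ C) (hρ : 0 < ρ) (hε : 0 < ε) (hε1 : ε ≤ 1) {g : ℝ → ℂ}
    (hg : ∀ t, |t| ≤ 1 → ContDiffAt ℝ (⊤ : ℕ∞) g t)
    (hgC : ∀ t, |t| ≤ 1 → ∀ k, ‖iteratedDeriv k g t‖ ≤ C * ρ ^ k * M k) :
    ∃ P : ℂ → ℂ, Differentiable ℂ P ∧ (∀ z ∈ ball (0 : ℂ) 8, ‖P z‖ ≤ 2 * C) ∧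
      ∀ x : ℝ, |x| < 8 → ‖g (ε / 16 * x) - P x‖ ≤ C * hfn (lc N) (B * (ρ * ε)) := by
  have hm := lc_pos hM
  have hn := lc_pos hN
  have ht₀ : 0 < ρ * ε := by positivity
  have hfact : ∀ k, M k = lc M k * k.factorial := fun k => by rw [lc]; field_simp
  rw [hfn_GammaUpper hn hNr (by positivity)]
  have hle := le_pow_mul_of_GammaUpper_le hm hn (lc_zero hM) (lc_zero hN) hNr hB hΓ _ _ ht₀ rfl
  have hΓ' := hΓ _ ht₀
  set L := GammaUpper (lc N) (B * (ρ * ε)) with hL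
  refine ⟨fun z => ∑ k ∈ Finset.range L, ((k.factorial : ℝ)⁻¹ * (ε / 16) ^ k) •
    iteratedDeriv k g 0 * z ^ k, by fun_prop, fun z hz => ?_, fun x hx => ?_⟩
  · rw [mem_ball_zero_iff] at hz
    have hgeo := sum_geometric_two_le L
    calc _ ≤ ∑ k ∈ Finset.range L, C * (1 / 2 : ℝ) ^ k := norm_sum_le_of_le _ fun k hk => by
          have hk' : k ≤ GammaLower (lc M) (ρ * ε) := (Finset.mem_range.1 hk).le.trans hΓ'
          have h1 := mul_pow_le_one_of_le_GammaLower hm (lc_zero hM) ht₀ k hk'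
          have h2 := hgC 0 (by simp) k
          rw [norm_mul, norm_smul, norm_pow, Real.norm_of_nonneg (by positivity)]
          calc (k.factorial : ℝ)⁻¹ * (ε / 16) ^ k * ‖iteratedDeriv k g 0‖ * ‖z‖ ^ k
              ≤ (k.factorial : ℝ)⁻¹ * (ε / 16) ^ k * (C * ρ ^ k * M k) * 8 ^ k := by
                have := (hM.pos k).le
                gcongr
            _ = C * (lc M k * (ρ * ε) ^ k) * (1 / 2) ^ k := by
                have : (8 : ℝ) ^ k = 16 ^ k * (1 / 2) ^ k := by rw [← mul_pow]; norm_num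
                rw [hfact, this, div_pow, mul_pow]; field_simp
            _ ≤ C * 1 * (1 / 2) ^ k := by gcongr
            _ = _ := by ring
      _ = C * ∑ k ∈ Finset.range L, (1 / 2 : ℝ) ^ k := by rw [Finset.mul_sum]
      _ ≤ C * 2 := by gcongr
      _ = _ := by ring
  · have hxε : |ε / 16 * x| ≤ ε / 2 := by
      rw [abs_mul, abs_of_pos (by positivity)]; nlinarith
    have hx1 : |ε / 16 * x| ≤ 1 := by linarith
    rcases Nat.eq_zero_or_pos L with h0 | h0
    · rw [h0]
      have := hgC (ε / 16 * x) hx1 0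
      simpa [hM.first, lc_zero hN] using this
    obtain ⟨n, hn'⟩ : ∃ n, L = n + 1 := ⟨L - 1, by omega⟩
    have h := norm_sub_taylor_le (n := n) hg (fun t ht => hgC t ht (n + 1)) hx1
    rw [← hn'] at h
    have hsum : ∑ k ∈ Finset.range L, ((k.factorial : ℝ)⁻¹ * (ε / 16 * x) ^ k) •
        iteratedDeriv k g 0 = ∑ k ∈ Finset.range L, ((k.factorial : ℝ)⁻¹ * (ε / 16) ^ k) •
        iteratedDeriv k g 0 * (x : ℂ) ^ k := Finset.sum_congr rfl fun k _ => by
      simp only [Complex.real_smul]; push_cast; ring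
    rw [hsum] at h
    refine h.trans ?_
    have hN2 : (L : ℝ) * (1 / 2) ^ L ≤ 1 := by
      rw [one_div, inv_pow, ← div_eq_mul_inv, div_le_one (by positivity)]
      exact_mod_cast (Nat.lt_two_pow_self).le
    have hfac : (L.factorial : ℝ) = L * n.factorial := by
      rw [hn', Nat.factorial_succ]; push_cast; ring
    calc C * ρ ^ L * M L * |ε / 16 * x| ^ L / n.factorial
        ≤ C * ρ ^ L * M L * (ε / 2) ^ L / n.factorial := by
          have := (hM.pos L).le
          gcongr
      _ = C * (lc M L * (ρ * ε) ^ L) * (L * (1 / 2) ^ L) := by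
          rw [hfact, hfac, div_pow, mul_pow, div_pow, one_pow]; field_simp
      _ ≤ C * (lc M L * (ρ * ε) ^ L) * 1 := by
          have := (hm L).le
          gcongr
      _ ≤ C * (B ^ L * lc N L * (ρ * ε) ^ L) * 1 := by gcongr
      _ = _ := by rw [mul_pow]; ring

/-- A function whose `j`-th and `(j+1)`-st powers have derivative bounds is close to holomorphic
functions at every scale. -/
lemma exists_holomorphic_approx {j : ℕ} (hj : 1 ≤ j) {M N : ℕ → ℝ} (hM : IsWeightSeq M)
    (hN : IsWeightSeq N) (hNr : RootsTendsto (lc N)) {B : ℝ} (hB : 1 ≤ B)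
    (hΓ : ∀ t : ℝ, 0 < t → GammaUpper (lc N) (B * t) ≤ GammaLower (lc M) t)
    {C : ℝ} (hC : 0 ≤ C) :
    ∃ K, 0 < K ∧ ∀ ρ ε : ℝ, 0 < ρ → 0 < ε → ε ≤ 1 → ∀ F : ℝ → ℂ,
      (∀ q ∈ ({j, j + 1} : Set ℕ), ∀ t, |t| ≤ 1 → ContDiffAt ℝ (⊤ : ℕ∞) (fun s => F s ^ q) t) →
      (∀ q ∈ ({j, j + 1} : Set ℕ), ∀ t, |t| ≤ 1 → ∀ k,
        ‖iteratedDeriv k (fun s => F s ^ q) t‖ ≤ C * ρ ^ k * M k) →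
      ∃ R : ℂ → ℂ, DifferentiableOn ℂ R (ball 0 (1 / 128 * ε)) ∧
        (∀ z ∈ ball (0 : ℂ) (1 / 128 * ε), ‖R z‖ ≤ K) ∧
        ∀ x : ℝ, |x| < 1 / 128 * ε →
          ‖F x - R x‖ ≤ K * hfn (lc N) (B * (ρ * ε)) ^ (1 / (4 * j * (j + 1)) : ℝ) := by
  obtain ⟨K, hK, hmain⟩ := exists_holomorphic_near_of_pow hj (by linarith : (1 : ℝ) ≤ 2 * C + 1)
  refine ⟨K, hK, ?_⟩
  intro ρ ε hρ hε hε1 F hF hFC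
  have hn := lc_pos hN
  have ht : 0 < B * (ρ * ε) := by positivity
  have hη : 0 < hfn (lc N) (B * (ρ * ε)) := by
    rw [hfn_GammaUpper hn hNr ht]
    have := hn (GammaUpper (lc N) (B * (ρ * ε)))
    positivity
  have hη1 := hfn_le_one hn (lc_zero hN) ht
  set η := hfn (lc N) (B * (ρ * ε)) with hηdef
  obtain ⟨P, hP, hPC, hPF⟩ := exists_entire_near hM hN hNr hB hΓ hC hρ hε hε1
    (hF j (by simp)) (hFC j (by simp))
  obtain ⟨Q, hQ, hQC, hQF⟩ := exists_entire_near hM hN hNr hB hΓ hC hρ hε hε1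
    (hF (j + 1) (by simp)) (hFC (j + 1) (by simp))
  obtain ⟨R, hR, hRK, hRF⟩ := hmain η hη hη1 (fun x => F (ε / 16 * x)) P Q hP hQ
    (fun z hz => (hPC z hz).trans (by linarith)) (fun z hz => (hQC z hz).trans (by linarith))
    (fun x hx => (hPF x hx).trans (by rw [← hηdef]; gcongr; linarith))
    (fun x hx => (hQF x hx).trans (by rw [← hηdef]; gcongr; linarith))
  have hmaps : ∀ z ∈ ball (0 : ℂ) (1 / 128 * ε), ((16 / ε : ℝ) : ℂ) * z ∈ ball (0 : ℂ) (1 / 8) := by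
    intro z hz
    rw [mem_ball_zero_iff] at hz ⊢
    rw [norm_mul, Complex.norm_real, Real.norm_of_nonneg (by positivity), div_mul_eq_mul_div,
      div_lt_iff₀ hε]
    linarith
  refine ⟨fun z => R (((16 / ε : ℝ) : ℂ) * z), ?_, fun z hz => hRK _ (hmaps z hz), fun x hx => ?_⟩
  · exact hR.comp (by fun_prop) hmaps
  · have h := hRF (16 / ε * x) (by
      have := hmaps x (by simpa using hx)
      rw [mem_ball_zero_iff, ← Complex.ofReal_mul, Complex.norm_real] at this
      exact this)
    have e : ε / 16 * (16 / ε * x) = x := by field_simp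
    simp only [e] at h
    simpa using h

/-- Finite differences of a function approximated by holomorphic functions at every dyadic scale. -/
lemma norm_finDiff_le_of_approx {F : ℝ → ℂ} {R : ℕ → ℂ → ℂ} {K c A : ℝ} {a : ℕ → ℝ}
    (hK : 0 ≤ K) (hc : 0 < c) (hA : 0 ≤ A) {p : ℕ} (hp : 1 ≤ p)
    (hR : ∀ l, DifferentiableOn ℂ (R l) (ball 0 (c * (1 / 2) ^ l)))
    (hRK : ∀ l, ∀ z ∈ ball (0 : ℂ) (c * (1 / 2) ^ l), ‖R l z‖ ≤ K)
    (ha0 : ∀ l, 0 ≤ a l) (ha1 : ∀ l, a l ≤ 1) (ha : ∀ l, a (l + 1) ≤ a l)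
    (hFR : ∀ l, ∀ x : ℝ, |x| < c * (1 / 2) ^ l → ‖F x - R l x‖ ≤ K * a l)
    (haA : ∀ l, a l ^ (1 / 2 : ℝ) ≤ A * ((1 / 2) ^ l) ^ (p + 1))
    {h : ℝ} (h0 : 0 < h) (hh : p * h < c / 16) :
    ‖finDiff p (fun i => F (i * h))‖ ≤ K * (5 * A + 1) * (64 * (p * h) / c) ^ p := by
  have hp0 : (0 : ℝ) < p := by exact_mod_cast hp
  have hph : 0 < p * h := by positivity
  obtain ⟨n, hn1, hn2⟩ : ∃ n : ℕ, (1 / 2) ^ n ≤ 32 * (p * h) / c ∧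
      p * h < c / 8 * (1 / 2) ^ n := by
    obtain ⟨n, hn1, hn2⟩ := exists_nat_pow_near_of_lt_one (x := 16 * (p * h) / c)
      (y := (1 / 2 : ℝ)) (by positivity) (by rw [div_le_one hc]; linarith) (by norm_num)
      (by norm_num)
    refine ⟨n, ?_, ?_⟩
    · rw [pow_succ] at hn1
      calc (1 / 2 : ℝ) ^ n = 2 * ((1 / 2) ^ n * (1 / 2)) := by ring
        _ ≤ 2 * (16 * (p * h) / c) := by gcongr
        _ = _ := by ring
    · rw [div_le_iff₀ hc] at hn2
      have : 0 < (1 / 2 : ℝ) ^ n * c := by positivity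
      linarith
  have hmono : ∀ l ≤ n, (1 / 2 : ℝ) ^ n ≤ (1 / 2) ^ l := fun l hl =>
    pow_le_pow_of_le_one (by norm_num) (by norm_num) hl
  have hlt : ∀ l ≤ n, p * h < c / 8 * (1 / 2) ^ l := fun l hl =>
    hn2.trans_le (mul_le_mul_of_nonneg_left (hmono l hl) (by positivity))
  have hsum : (fun i : ℕ => F (i * h)) = fun i : ℕ => R 0 ((i * h : ℝ) : ℂ) +
      (∑ l ∈ Finset.range n, (R (l + 1) ((i * h : ℝ) : ℂ) - R l ((i * h : ℝ) : ℂ))) +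
      (F (i * h) - R n ((i * h : ℝ) : ℂ)) := by
    funext i
    rw [Finset.sum_range_sub (fun l => R l ((i * h : ℝ) : ℂ))]; ring
  rw [hsum, finDiff_add, finDiff_add, finDiff_sum]
  set X : ℝ := 32 * (p * h) / c with hX
  have hX0 : 0 ≤ X := by positivity
  have t1 : ‖finDiff p (fun i => R 0 ((i * h : ℝ) : ℂ))‖ ≤ K * X ^ p := by
    refine (norm_finDiff_le_of_holomorphic (by positivity) hK (hR 0) (hRK 0) p h0.le ?_).trans ?_
    · have := hlt 0 (Nat.zero_le _)
      simp only [pow_zero] at this ⊢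
      linarith
    · rw [pow_zero, mul_one, hX]
      gcongr
      norm_num
  have t2 : ∀ l ∈ Finset.range n,
      ‖finDiff p (fun i => R (l + 1) ((i * h : ℝ) : ℂ) - R l ((i * h : ℝ) : ℂ))‖ ≤
        2 * K * A * X ^ p * (1 / 2) ^ l := by
    intro l hl
    have hsub : c * (1 / 2 : ℝ) ^ (l + 1) ≤ c * (1 / 2) ^ l := by
      gcongr 1
      exact pow_le_pow_of_le_one (by norm_num) (by norm_num) (Nat.le_succ l)
    have hbsub := ball_subset_ball (x := (0 : ℂ)) hsub
    have hd : DifferentiableOn ℂ (fun z => R (l + 1) z - R l z) (ball 0 (c * (1 / 2) ^ (l + 1))) :=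
      (hR (l + 1)).sub ((hR l).mono hbsub)
    have hb := norm_le_of_norm_le_on_real (a := 2 * K * a l) (b := 2 * K) (by positivity) hd
      (by have := ha0 l; positivity)
      (by have := ha1 l; nlinarith)
      (fun z hz => by
        have h1 := hRK (l + 1) z hz
        have h2 := hRK l z (hbsub hz)
        have := norm_sub_le (R (l + 1) z) (R l z)
        linarith)
      (fun x hx => by
        have h1 := hFR (l + 1) x hx
        have h2 := hFR l x (hx.trans_le hsub)
        have h3 := norm_sub_le (F x - R l x) (F x - R (l + 1) x)
        rw [sub_sub_sub_cancel_left] at h3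
        have := mul_le_mul_of_nonneg_left (ha l) hK
        linarith)
    have hrad : c * (1 / 2 : ℝ) ^ (l + 1) / 4 = c / 8 * (1 / 2) ^ l := by rw [pow_succ]; ring
    have e : (2 * K * a l) ^ (1 / 2 : ℝ) * (2 * K) ^ (1 / 2 : ℝ) = 2 * K * a l ^ (1 / 2 : ℝ) := by
      rw [Real.mul_rpow (by positivity) (ha0 l), mul_right_comm, ← Real.sqrt_eq_rpow,
        ← Real.sqrt_eq_rpow, Real.mul_self_sqrt (by positivity)]
    rw [hrad, e] at hb
    have hrle : c / 8 * (1 / 2 : ℝ) ^ l ≤ c * (1 / 2 : ℝ) ^ (l + 1) := by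
      rw [pow_succ]
      have : 0 < c * (1 / 2 : ℝ) ^ l := by positivity
      linarith
    have h2a : 0 ≤ a l ^ (1 / 2 : ℝ) := Real.rpow_nonneg (ha0 l) _
    refine (norm_finDiff_le_of_holomorphic (G := fun z => R (l + 1) z - R l z) (by positivity)
      (by positivity) (hd.mono (ball_subset_ball hrle)) hb p h0.le
      (hlt l (Finset.mem_range.1 hl).le)).trans ?_
    have e2 : 4 * (p * h) / (c / 8 * (1 / 2) ^ l) = X * 2 ^ l := by
      rw [hX, one_div, inv_pow]; field_simp; norm_num
    have e3 : (1 / 2 : ℝ) ^ l * 2 ^ l = 1 := by rw [← mul_pow]; norm_num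
    rw [e2]
    calc 2 * K * a l ^ (1 / 2 : ℝ) * (X * 2 ^ l) ^ p
        ≤ 2 * K * (A * ((1 / 2) ^ l) ^ (p + 1)) * (X * 2 ^ l) ^ p := by
          gcongr; exact haA l
      _ = 2 * K * A * X ^ p * (1 / 2) ^ l * ((1 / 2) ^ l * 2 ^ l) ^ p := by
          rw [mul_pow X, mul_pow _ (2 ^ l), pow_succ]; ring
      _ = _ := by rw [e3, one_pow, mul_one]
  have t3 : ‖finDiff p (fun i => F (i * h) - R n ((i * h : ℝ) : ℂ))‖ ≤
      2 ^ p * (K * (A * X ^ p)) := by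
    refine norm_finDiff_le p fun i hi => ?_
    have hih : (i : ℝ) * h ≤ p * h := by gcongr
    refine (hFR n _ ?_).trans ?_
    · rw [abs_of_nonneg (by positivity)]
      have : 0 < c * (1 / 2 : ℝ) ^ n := by positivity
      linarith
    · gcongr
      calc a n = a n ^ (1 : ℝ) := (Real.rpow_one _).symm
        _ ≤ a n ^ (1 / 2 : ℝ) := by
          rcases eq_or_lt_of_le (ha0 n) with h | h
          · rw [← h, Real.zero_rpow one_ne_zero, Real.zero_rpow (by norm_num)]
          · exact Real.rpow_le_rpow_of_exponent_ge h (ha1 n) (by norm_num)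
        _ ≤ A * ((1 / 2) ^ n) ^ (p + 1) := haA n
        _ ≤ A * ((1 / 2) ^ n) ^ p := by
          gcongr A * ?_
          exact pow_le_pow_of_le_one (by positivity) (pow_le_one₀ (by norm_num) (by norm_num))
            (Nat.le_succ p)
        _ ≤ A * X ^ p := by gcongr
  have hgeo := sum_geometric_two_le n
  have h2p : (1 : ℝ) ≤ 2 ^ p := one_le_pow₀ (by norm_num)
  have hXp : 0 ≤ X ^ p := by positivity
  calc _ ≤ K * X ^ p + ∑ l ∈ Finset.range n, 2 * K * A * X ^ p * (1 / 2) ^ l +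
        2 ^ p * (K * (A * X ^ p)) :=
        norm_add₃_le.trans (add_le_add_three t1 (norm_sum_le_of_le _ t2) t3)
    _ = K * X ^ p + 2 * K * A * X ^ p * ∑ l ∈ Finset.range n, (1 / 2 : ℝ) ^ l +
        2 ^ p * (K * (A * X ^ p)) := by rw [Finset.mul_sum]
    _ ≤ K * X ^ p + 2 * K * A * X ^ p * 2 + 2 ^ p * (K * (A * X ^ p)) := by gcongr
    _ = 1 * (K * X ^ p) + 1 * (4 * K * A * X ^ p) + 2 ^ p * (K * (A * X ^ p)) := by ring
    _ ≤ 2 ^ p * (K * X ^ p) + 2 ^ p * (4 * K * A * X ^ p) + 2 ^ p * (K * (A * X ^ p)) := by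
        gcongr
    _ = K * (5 * A + 1) * (2 * X) ^ p := by rw [mul_pow]; ring
    _ = _ := by rw [hX]; ring

lemma hfn_mono {m : ℕ → ℝ} (hm : ∀ k, 0 < m k) {s t : ℝ} (hs : 0 < s) (hst : s ≤ t) :
    hfn m s ≤ hfn m t :=
  le_hfn (hs.trans_le hst) fun k => (hfn_le hm hs k).trans (by have := (hm k).le; gcongr)

/-- Uniform finite difference bounds for a function of one real variable whose `j`-th and
`(j+1)`-st powers have derivative bounds. -/
lemma exists_norm_finDiff_le {j : ℕ} (hj : 1 ≤ j) {k : ℕ}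
    (hk : k = Nat.clog 2 (j * (j + 1)) + 7) {M : ℕ → ℕ → ℝ}
    (hws : ∀ i, 1 ≤ i → i ≤ k → IsWeightSeq (M i))
    (hroots : ∀ i, 1 ≤ i → i ≤ k → RootsTendsto (lc (M i)))
    {B : ℝ} (hB : 1 ≤ B)
    (hGamma : ∀ t : ℝ, 0 < t → GammaUpper (lc (M 2)) (B * t) ≤ GammaLower (lc (M 1)) t)
    (hmg : ∀ i, 2 ≤ i → i ≤ k - 1 → mg (M i) (M (i + 1)) < ⊤) :
    ∃ D : ℝ, 0 < D ∧ ∀ ρ : ℝ, 0 < ρ → ∀ C : ℝ, 0 ≤ C → ∃ K : ℝ, 0 < K ∧ ∀ F : ℝ → ℂ,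
      (∀ q ∈ ({j, j + 1} : Set ℕ), ∀ t, |t| ≤ 1 → ContDiffAt ℝ (⊤ : ℕ∞) (fun s => F s ^ q) t) →
      (∀ q ∈ ({j, j + 1} : Set ℕ), ∀ t, |t| ≤ 1 → ∀ i,
        ‖iteratedDeriv i (fun s => F s ^ q) t‖ ≤ C * ρ ^ i * M 1 i) →
      ∀ (p : ℕ) (h : ℝ), 0 < h → p * h < 1 / 2048 →
        ‖finDiff p (fun i => F (i * h))‖ ≤ K * (D * ρ) ^ p * M k p * h ^ p := by
  set r := Nat.clog 2 (j * (j + 1)) with hr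
  obtain ⟨C₁, hC₁, hchain⟩ := exists_hfn_le_pow_two_pow M 2 (r + 4)
    (fun i h1 h2 => hws i (by omega) (by omega)) (fun i h1 h2 => hroots i (by omega) (by omega))
    (fun i h1 h2 => hmg i h1 (by omega))
  have hkr : 2 + (r + 4) + 1 = k := by omega
  obtain ⟨C₂, hC₂, hmgk⟩ := exists_le_pow_mul_of_mg_lt_top (hws (2 + (r + 4)) (by omega) (by omega))
    (hws k (by omega) le_rfl) (by have := hmg (2 + (r + 4)) (by omega) (by omega); rwa [hkr] at this)
  have hwk := hws k (by omega) le_rfl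
  have hmk := lc_pos hwk
  have hw2 := hws 2 (by omega) (by omega)
  have hm2 := lc_pos hw2
  have hw' := hws (2 + (r + 4)) (by omega) (by omega)
  have hm' := lc_pos hw'
  set E : ℝ := C₂ * (C₁ * B) with hE
  have hE1 : 1 ≤ E := one_le_mul_of_one_le_of_one_le hC₂ (one_le_mul_of_one_le_of_one_le hC₁ hB)
  refine ⟨8192 * Real.exp 1 * E, by positivity, fun ρ hρ C hC => ?_⟩
  obtain ⟨K, hK, hKR⟩ := exists_holomorphic_approx hj (hws 1 le_rfl (by omega)) hw2
    (hroots 2 (by omega) (by omega)) hB hGamma hC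
  obtain ⟨C₄, hC₄, hpow⟩ := (hroots k (by omega) le_rfl).exists_pow_le hmk
    (by positivity : 0 ≤ 1 / ρ)
  have hmk1 := hmk 1
  refine ⟨K * (5 * (E * ρ * lc (M k) 1) + C₄ + 2), by positivity, fun F hF hFC p h h0 hh => ?_⟩
  have hex : ∀ l : ℕ, ∃ R : ℂ → ℂ, DifferentiableOn ℂ R (ball 0 (1 / 128 * (1 / 2) ^ l)) ∧
      (∀ z ∈ ball (0 : ℂ) (1 / 128 * (1 / 2) ^ l), ‖R z‖ ≤ K) ∧
      ∀ x : ℝ, |x| < 1 / 128 * (1 / 2) ^ l → ‖F x - R x‖ ≤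
        K * hfn (lc (M 2)) (B * (ρ * (1 / 2) ^ l)) ^ (1 / (4 * j * (j + 1)) : ℝ) := fun l =>
    hKR ρ ((1 / 2) ^ l) hρ (by positivity) (pow_le_one₀ (by norm_num) (by norm_num)) F hF hFC
  choose R hR hRK hRF using hex
  have htl : ∀ l : ℕ, 0 < B * (ρ * (1 / 2) ^ l) := fun l => by positivity
  have hη0 : ∀ l : ℕ, 0 ≤ hfn (lc (M 2)) (B * (ρ * (1 / 2) ^ l)) := fun l => hfn_nonneg hm2 (htl l)
  have hη1 : ∀ l : ℕ, hfn (lc (M 2)) (B * (ρ * (1 / 2) ^ l)) ≤ 1 := fun l =>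
    hfn_le_one hm2 (lc_zero hw2) (htl l)
  have ha1 : ∀ l : ℕ, hfn (lc (M 2)) (B * (ρ * (1 / 2) ^ l)) ^ (1 / (4 * j * (j + 1)) : ℝ) ≤ 1 :=
    fun l => Real.rpow_le_one (hη0 l) (hη1 l) (by positivity)
  rcases Nat.eq_zero_or_pos p with rfl | hp
  · have h1 := hRF 0 0 (by simp)
    have h2 := hRK 0 0 (by simp)
    have h3 := mul_le_mul_of_nonneg_left (ha1 0) hK.le
    have h4 := norm_add_le (F 0 - R 0 (0 : ℝ)) (R 0 (0 : ℝ))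
    rw [sub_add_cancel] at h4
    have h5 : ‖F 0‖ ≤ 2 * K := by
      rw [Complex.ofReal_zero] at h1 h4
      linarith
    have h6 : 0 ≤ K * (5 * (E * ρ * lc (M k) 1) + C₄) := by positivity
    simp [finDiff, hwk.first]
    linarith
  have haA : ∀ l : ℕ, (hfn (lc (M 2)) (B * (ρ * (1 / 2) ^ l)) ^ (1 / (4 * j * (j + 1)) : ℝ)) ^
      (1 / 2 : ℝ) ≤ (lc (M (2 + (r + 4))) (p + 1) * (C₁ * B * ρ) ^ (p + 1)) *
        ((1 / 2) ^ l) ^ (p + 1) := by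
    intro l
    have htl' : 0 < C₁ * (B * (ρ * (1 / 2) ^ l)) := by have := htl l; positivity
    have hH0 := hfn_nonneg hm' htl'
    have hH1 := hfn_le_one hm' (lc_zero hw') htl'
    have hHle := hfn_le hm' htl' (p + 1)
    have hch := hchain _ (htl l)
    set H := hfn (lc (M (2 + (r + 4)))) (C₁ * (B * (ρ * (1 / 2) ^ l)))
    have hjr : (1 : ℝ) ≤ j := by exact_mod_cast hj
    have hexp : 8 * (j * (j + 1) : ℝ) ≤ (2 ^ (r + 4) : ℕ) := by
      have : j * (j + 1) ≤ 2 ^ r := Nat.le_pow_clog (by norm_num) _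
      have h2 : ((j * (j + 1) : ℕ) : ℝ) ≤ ((2 ^ r : ℕ) : ℝ) := by exact_mod_cast this
      push_cast at h2 ⊢
      rw [pow_add]
      nlinarith
    have hHH : (hfn (lc (M 2)) (B * (ρ * (1 / 2) ^ l)) ^ (1 / (4 * j * (j + 1)) : ℝ)) ^
        (1 / 2 : ℝ) ≤ H := by
      rw [← Real.rpow_mul (hη0 l)]
      calc _ ≤ (H ^ (2 ^ (r + 4))) ^ (1 / (4 * j * (j + 1)) * (1 / 2) : ℝ) :=
            Real.rpow_le_rpow (hη0 l) hch (by positivity)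
        _ = H ^ (((2 ^ (r + 4) : ℕ) : ℝ) * (1 / (4 * j * (j + 1)) * (1 / 2))) := by
            rw [Real.rpow_mul hH0, Real.rpow_natCast]
        _ ≤ H ^ (1 : ℝ) := by
            have hge : 1 ≤ ((2 ^ (r + 4) : ℕ) : ℝ) * (1 / (4 * j * (j + 1)) * (1 / 2)) := by
              have e : ((2 ^ (r + 4) : ℕ) : ℝ) * (1 / (4 * j * (j + 1)) * (1 / 2)) =
                  ((2 ^ (r + 4) : ℕ) : ℝ) / (8 * (j * (j + 1))) := by field_simp; norm_num
              rw [e, le_div_iff₀ (by positivity), one_mul]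
              exact hexp
            rcases eq_or_lt_of_le hH0 with h | h
            · rw [← h, Real.zero_rpow one_ne_zero, Real.zero_rpow (by linarith)]
            · exact Real.rpow_le_rpow_of_exponent_ge h hH1 hge
        _ = H := Real.rpow_one _
    refine hHH.trans (hHle.trans_eq ?_)
    rw [mul_assoc, ← mul_pow]
    congr 2
    ring
  have hmp := hmk p
  have hm'p := hm' (p + 1)
  have key := norm_finDiff_le_of_approx hK.le (by norm_num : (0 : ℝ) < 1 / 128)
    (A := lc (M (2 + (r + 4))) (p + 1) * (C₁ * B * ρ) ^ (p + 1)) (by positivity) hp hR hRK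
    (fun l => Real.rpow_nonneg (hη0 l) _) ha1
    (fun l => Real.rpow_le_rpow (hη0 _) (hfn_mono hm2 (htl _) (by
      have : (1 / 2 : ℝ) ^ (l + 1) ≤ (1 / 2) ^ l :=
        pow_le_pow_of_le_one (by norm_num) (by norm_num) (Nat.le_succ l)
      gcongr B * (ρ * ?_))) (by positivity))
    hRF haA h0 (by linarith)
  have hA : lc (M (2 + (r + 4))) (p + 1) * (C₁ * B * ρ) ^ (p + 1) ≤
      (E * ρ * lc (M k) 1) * ((E * ρ) ^ p * lc (M k) p) := by
    calc _ ≤ C₂ ^ (p + 1) * (lc (M k) p * lc (M k) 1) * (C₁ * B * ρ) ^ (p + 1) := by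
          gcongr; exact hmgk p 1
      _ = _ := by rw [hE]; simp only [mul_pow, pow_succ]; ring
  have hone : 1 ≤ C₄ * ((E * ρ) ^ p * lc (M k) p) := by
    have h1 := hpow p
    calc (1 : ℝ) = (1 / ρ) ^ p * (1 * ρ) ^ p := by
          rw [← mul_pow, one_mul, one_div_mul_cancel hρ.ne', one_pow]
      _ ≤ C₄ * lc (M k) p * (E * ρ) ^ p := by gcongr
      _ = _ := by ring
  have hpp : (p : ℝ) ^ p ≤ Real.exp 1 ^ p * p.factorial := by
    have := Real.pow_div_factorial_le_exp (x := (p : ℝ)) (Nat.cast_nonneg p) p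
    rw [div_le_iff₀ (by positivity)] at this
    rwa [← Real.exp_nat_mul, mul_one]
  have hMk : M k p = lc (M k) p * p.factorial := by rw [lc]; field_simp
  refine key.trans ?_
  calc K * (5 * (lc (M (2 + (r + 4))) (p + 1) * (C₁ * B * ρ) ^ (p + 1)) + 1) *
        (64 * (p * h) / (1 / 128)) ^ p
      ≤ K * (5 * ((E * ρ * lc (M k) 1) * ((E * ρ) ^ p * lc (M k) p)) +
          C₄ * ((E * ρ) ^ p * lc (M k) p)) * (64 * (p * h) / (1 / 128)) ^ p := by gcongr
    _ = K * (5 * (E * ρ * lc (M k) 1) + C₄) * ((E * ρ) ^ p * lc (M k) p) *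
          (8192 ^ p * (p ^ p) * h ^ p) := by
        rw [← mul_pow, ← mul_pow]
        have e : 64 * (p * h) / (1 / 128) = 8192 * p * h := by ring
        rw [e]; ring
    _ ≤ K * (5 * (E * ρ * lc (M k) 1) + C₄ + 2) * ((E * ρ) ^ p * lc (M k) p) *
          (8192 ^ p * (Real.exp 1 ^ p * p.factorial) * h ^ p) := by
        have h2 : 5 * (E * ρ * lc (M k) 1) + C₄ ≤ 5 * (E * ρ * lc (M k) 1) + C₄ + 2 := by linarith
        gcongr K * ?_ * _ * (_ * ?_ * _)
    _ = _ := by rw [hMk]; simp only [mul_pow]; ring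

section Symmetry

variable {E F : Type*} [NormedAddCommGroup E] [NormedSpace ℝ E]
  [NormedAddCommGroup F] [NormedSpace ℝ F]

lemma differentiableAt_iteratedFDeriv_of_contDiffAt {f : E → F} {x : E}
    (hf : ContDiffAt ℝ (⊤ : ℕ∞) f x) (n : ℕ) :
    DifferentiableAt ℝ (iteratedFDeriv ℝ n f) x :=
  ((hf.iteratedFDeriv_right (m := 1) (i := n) (by exact_mod_cast le_top)).differentiableAt
    one_ne_zero)

lemma iteratedFDeriv_add_two_apply {f : E → F} {x : E} (n : ℕ)
    (hf : ContDiffAt ℝ (⊤ : ℕ∞) f x) (m : Fin (n + 2) → E) :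
    iteratedFDeriv ℝ (n + 2) f x m
      = fderiv ℝ (fderiv ℝ (iteratedFDeriv ℝ n f)) x (m 0) (m 1) (Fin.tail (Fin.tail m)) := by
  rw [(differentiableAt_iteratedFDeriv_of_contDiffAt hf (n + 1)).iteratedFDeriv_succ_apply_left']
  have h2 : ContDiffAt ℝ 2 (iteratedFDeriv ℝ n f) x :=
    hf.iteratedFDeriv_right (by exact WithTop.coe_le_coe.2 (le_top : (2 + n : ℕ∞) ≤ ⊤))
  have h1 : DifferentiableAt ℝ (fderiv ℝ (iteratedFDeriv ℝ n f)) x :=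
    (h2.fderiv_right (m := 1) (by norm_num)).differentiableAt one_ne_zero
  have e : (fun y => iteratedFDeriv ℝ (n + 1) f y (Fin.tail m))
      = fun y => (fderiv ℝ (iteratedFDeriv ℝ n f) y (m 1)) (Fin.tail (Fin.tail m)) := by
    funext y
    rw [iteratedFDeriv_succ_apply_left]
    rfl
  rw [e, fderiv_continuousMultilinear_apply_const_apply]
  · congr 1
    rw [fderiv_clm_apply h1 (differentiableAt_const _)]
    simp
  · exact h1.clm_apply (differentiableAt_const _)

/-- Iterated derivatives of a smooth function are symmetric. -/
lemma iteratedFDeriv_comp_perm_of_contDiffOn {f : E → F} {V : Set E} (hV : IsOpen V)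
    (hf : ContDiffOn ℝ (⊤ : ℕ∞) f V) (n : ℕ) : ∀ x ∈ V, ∀ (m : Fin n → E)
    (σ : Equiv.Perm (Fin n)), iteratedFDeriv ℝ n f x (m ∘ σ) = iteratedFDeriv ℝ n f x m := by
  induction n with
  | zero => intro x hx m σ; congr 1; exact Subsingleton.elim _ _
  | succ n ih =>
    cases n with
    | zero =>
      intro x hx m σ
      rw [Equiv.ext fun a => Subsingleton.elim (α := Fin 1) (σ a) ((1 : Equiv.Perm (Fin 1)) a)]
      rfl
    | succ n =>
      intro x hx m σ
      have hfx : ContDiffAt ℝ (⊤ : ℕ∞) f x := hf.contDiffAt (hV.mem_nhds hx)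
      have hmem : σ ∈ Submonoid.closure
          (range fun i : Fin (n + 1) => Equiv.swap i.castSucc i.succ) := by
        rw [Equiv.Perm.mclosure_swap_castSucc_succ]; trivial
      revert m
      induction hmem using Submonoid.closure_induction with
      | one => intro m; rfl
      | mul s t _ _ hs ht =>
        intro m
        rw [Equiv.Perm.coe_mul, ← Function.comp_assoc, ht, hs]
      | mem s hs =>
        obtain ⟨i, rfl⟩ := hs
        intro m
        cases i using Fin.cases with
        | zero =>
          rw [iteratedFDeriv_add_two_apply n hfx, iteratedFDeriv_add_two_apply n hfx]
          have h2 : ContDiffAt ℝ 2 (iteratedFDeriv ℝ n f) x :=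
            hfx.iteratedFDeriv_right (by exact WithTop.coe_le_coe.2 (le_top : (2 + n : ℕ∞) ≤ ⊤))
          have hs := (h2.isSymmSndFDerivAt (by simp)).eq (m 1) (m 0)
          have e : Fin.tail (Fin.tail (m ∘ Equiv.swap (Fin.castSucc 0) (Fin.succ (0 : Fin (n + 1)))))
              = Fin.tail (Fin.tail m) := by
            funext a
            simp only [Fin.tail, Function.comp]
            refine congrArg m (Equiv.swap_apply_of_ne_of_ne (Fin.succ_ne_zero _) ?_)
            intro h
            exact Fin.succ_ne_zero _ (Fin.succ_injective _ h)
          rw [e]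
          simp only [Function.comp, Fin.castSucc_zero, Fin.succ_zero_eq_one, Equiv.swap_apply_left,
            Equiv.swap_apply_right]
          exact congrArg (fun L => L (Fin.tail (Fin.tail m))) hs
        | succ i =>
          have hd := differentiableAt_iteratedFDeriv_of_contDiffAt hfx (n + 1)
          rw [hd.iteratedFDeriv_succ_apply_left', hd.iteratedFDeriv_succ_apply_left']
          have e : Fin.tail (m ∘ Equiv.swap (Fin.castSucc i.succ) (Fin.succ i.succ))
              = Fin.tail m ∘ Equiv.swap (Fin.castSucc i) i.succ := by
            funext a
            simp only [Fin.tail, Function.comp]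
            refine congrArg m ?_
            rw [← Fin.succ_castSucc]
            exact (Fin.succ_injective _).swap_apply _ _ _
          have e0 : (m ∘ Equiv.swap (Fin.castSucc i.succ) (Fin.succ i.succ)) 0 = m 0 := by
            simp only [Function.comp]
            refine congrArg m ?_
            rw [← Fin.succ_castSucc]
            exact Equiv.swap_apply_of_ne_of_ne (Fin.succ_ne_zero _).symm (Fin.succ_ne_zero _).symm
          rw [e, e0]
          congr 1
          apply Filter.EventuallyEq.fderiv_eq
          filter_upwards [hV.mem_nhds hx] with y hy
          exact ih y hy _ _

end Symmetry

section Polarization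

variable {E F : Type*} [NormedAddCommGroup E] [NormedSpace ℝ E]
  [NormedAddCommGroup F] [NormedSpace ℝ F]

lemma sum_powerset_neg_one_pow_smul_ite_subset {ι : Type*} [Fintype ι] [DecidableEq ι]
    (T : Finset ι) (a : F) :
    ∑ R : Finset ι, ((-1 : ℝ) ^ R.card) • (if T ⊆ Rᶜ then a else 0)
      = if T = Finset.univ then a else 0 := by
  have h := congrArg (fun z : ℤ => (z : ℝ)) (Finset.sum_powerset_neg_one_pow_card (x := Tᶜ))
  simp only [Int.cast_sum, Int.cast_pow, Int.cast_neg, Int.cast_one] at h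
  have e : ∀ R : Finset ι, T ⊆ Rᶜ ↔ R ∈ Tᶜ.powerset := fun R => by
    rw [Finset.mem_powerset, Finset.subset_compl_comm]
  simp only [e, smul_ite, smul_zero]
  rw [← Finset.sum_filter, Finset.filter_mem_eq_inter, Finset.univ_inter, ← Finset.sum_smul, h]
  simp only [Finset.compl_eq_empty_iff]
  split_ifs <;> simp

/-- The polarization formula for symmetric multilinear maps. -/
lemma factorial_smul_eq_sum_diagonal {p : ℕ} (L : MultilinearMap ℝ (fun _ : Fin p => E) F)
    (hL : ∀ (m : Fin p → E) (σ : Equiv.Perm (Fin p)), L (m ∘ σ) = L m) (v : Fin p → E) :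
    (p.factorial : ℝ) • L v
      = ∑ R : Finset (Fin p), ((-1 : ℝ) ^ R.card) • L (fun _ => ∑ i ∈ Rᶜ, v i) := by
  classical
  have h1 : ∀ S : Finset (Fin p), L (fun _ => ∑ i ∈ S, v i)
      = ∑ r : Fin p → Fin p, if Finset.univ.image r ⊆ S then L (v ∘ r) else 0 := by
    intro S
    rw [L.map_sum_finset (fun _ i => v i) (fun _ => S), ← Finset.sum_filter]
    refine Finset.sum_congr ?_ fun r _ => rfl
    ext r
    simp [Finset.subset_iff]
  simp only [h1, Finset.smul_sum]
  rw [Finset.sum_comm]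
  simp only [sum_powerset_neg_one_pow_smul_ite_subset]
  have h2 : ∀ r : Fin p → Fin p, Finset.univ.image r = Finset.univ ↔ Function.Bijective r := by
    intro r
    rw [← Finite.surjective_iff_bijective, Finset.eq_univ_iff_forall]
    simp [Function.Surjective]
  simp only [h2]
  rw [← Finset.sum_filter]
  have h3 : ∑ r ∈ Finset.univ.filter (fun r : Fin p → Fin p => Function.Bijective r), L (v ∘ r)
      = ∑ σ : Equiv.Perm (Fin p), L (v ∘ σ) := by
    refine Finset.sum_bij (fun r h => Equiv.ofBijective r (Finset.mem_filter.1 h).2) ?_ ?_ ?_ ?_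
    · intros; exact Finset.mem_univ _
    · intro a _ b _ hab
      funext i
      exact congrArg (fun σ : Equiv.Perm (Fin p) => σ i) hab
    · intro σ _
      exact ⟨σ, Finset.mem_filter.2 ⟨Finset.mem_univ _, σ.bijective⟩, Equiv.ext fun _ => rfl⟩
    · intros; rfl
  rw [h3]
  simp only [hL, Finset.sum_const, Finset.card_univ, Fintype.card_perm, Fintype.card_fin]
  exact Nat.cast_smul_eq_nsmul ℝ _ _

lemma norm_le_of_norm_diagonal_le {p : ℕ} (L : ContinuousMultilinearMap ℝ (fun _ : Fin p => E) F)
    (hL : ∀ (m : Fin p → E) (σ : Equiv.Perm (Fin p)), L (m ∘ σ) = L m) {A : ℝ}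
    (hA : ∀ v : E, ‖v‖ ≤ 1 → ‖L (fun _ => v)‖ ≤ A) :
    ‖L‖ ≤ (2 * Real.exp 1) ^ p * A := by
  have hA0 : 0 ≤ A := (norm_nonneg _).trans (hA 0 (by simp))
  have hdiag : ∀ v : E, ‖L (fun _ => v)‖ ≤ A * ‖v‖ ^ p := by
    intro v
    rcases eq_or_ne v 0 with rfl | hv
    · rcases Nat.eq_zero_or_pos p with rfl | hp
      · simpa using hA 0 (by simp)
      · have : L (fun _ => (0 : E)) = 0 := L.map_coord_zero (⟨0, hp⟩ : Fin p) rfl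
        rw [this, norm_zero]
        positivity
    · have hv' : ‖v‖ ≠ 0 := norm_ne_zero_iff.2 hv
      have e : L (fun _ => v) = ‖v‖ ^ p • L (fun _ => ‖v‖⁻¹ • v) := by
        have := L.map_smul_univ (fun _ => ‖v‖) (fun _ => ‖v‖⁻¹ • v)
        simp only [smul_smul, mul_inv_cancel₀ hv', one_smul, Finset.prod_const, Finset.card_univ,
          Fintype.card_fin] at this
        exact this
      rw [e, norm_smul, norm_pow, norm_norm, mul_comm]
      gcongr
      apply hA
      rw [norm_smul, norm_inv, norm_norm, inv_mul_cancel₀ hv']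
  have hunit : ∀ v : Fin p → E, (∀ i, ‖v i‖ ≤ 1) → ‖L v‖ ≤ (2 * Real.exp 1) ^ p * A := by
    intro v hv
    have h := factorial_smul_eq_sum_diagonal L.toMultilinearMap hL v
    have hb : ‖(p.factorial : ℝ) • L v‖ ≤ ∑ R : Finset (Fin p), A * (p : ℝ) ^ p := by
      refine (congrArg norm h).trans_le ((norm_sum_le _ _).trans (Finset.sum_le_sum fun R _ => ?_))
      rw [norm_smul, norm_pow, norm_neg, norm_one, one_pow, one_mul]
      refine (hdiag _).trans ?_
      gcongr
      calc ‖∑ i ∈ Rᶜ, v i‖ ≤ ∑ i ∈ Rᶜ, ‖v i‖ := norm_sum_le _ _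
        _ ≤ ∑ i ∈ Rᶜ, (1 : ℝ) := Finset.sum_le_sum fun i _ => hv i
        _ ≤ p := by
          rw [Finset.sum_const, nsmul_eq_mul, mul_one]
          exact_mod_cast (Finset.card_le_univ _).trans (by simp)
    rw [norm_smul, Real.norm_natCast, Finset.sum_const, Finset.card_univ, Fintype.card_finset,
      Fintype.card_fin, nsmul_eq_mul] at hb
    have hexp := Real.pow_div_factorial_le_exp (p : ℝ) (Nat.cast_nonneg p) p
    have hfac : (0 : ℝ) < p.factorial := by exact_mod_cast p.factorial_pos
    have he : Real.exp p = Real.exp 1 ^ p := by rw [← Real.exp_nat_mul, mul_one]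
    rw [div_le_iff₀ hfac, he] at hexp
    have : (p.factorial : ℝ) * ‖L v‖ ≤ p.factorial * ((2 * Real.exp 1) ^ p * A) := by
      refine hb.trans ?_
      push_cast
      rw [mul_pow]
      calc (2 : ℝ) ^ p * (A * (p : ℝ) ^ p) ≤ 2 ^ p * (A * (Real.exp 1 ^ p * p.factorial)) := by
            gcongr
        _ = _ := by ring
    exact le_of_mul_le_mul_left this hfac
  refine L.opNorm_le_bound (by positivity) fun m => ?_
  by_cases hm : ∃ i, m i = 0
  · obtain ⟨i, hi⟩ := hm
    rw [L.map_coord_zero i hi, norm_zero]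
    positivity
  · push Not at hm
    have e : L m = (∏ i, ‖m i‖) • L (fun i => ‖m i‖⁻¹ • m i) := by
      have := L.map_smul_univ (fun i => ‖m i‖) (fun i => ‖m i‖⁻¹ • m i)
      simp only [smul_smul, mul_inv_cancel₀ (norm_ne_zero_iff.2 (hm _)), one_smul] at this
      exact this
    rw [e, norm_smul, Real.norm_of_nonneg (by positivity), mul_comm]
    gcongr
    apply hunit
    intro i
    rw [norm_smul, norm_inv, norm_norm, inv_mul_cancel₀ (norm_ne_zero_iff.2 (hm i))]

end Polarization

section FiniteDifferenceLimit

variable {F : Type*} [NormedAddCommGroup F] [NormedSpace ℝ F]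

lemma finDiff_taylor (p : ℕ) (h : ℝ) (D : ℕ → F) :
    finDiff p (fun i => ∑ k ∈ Finset.range (p + 1),
      ((k.factorial : ℝ)⁻¹ * ((i : ℝ) * h) ^ k) • D k) = h ^ p • D p := by
  have e : (fun i : ℕ => ∑ k ∈ Finset.range (p + 1),
      ((k.factorial : ℝ)⁻¹ * ((i : ℝ) * h) ^ k) • D k)
      = fun i : ℕ => ∑ k ∈ Finset.range (p + 1),
        ((i : ℝ) ^ k) • (((k.factorial : ℝ)⁻¹ * h ^ k) • D k) := by
    funext i
    refine Finset.sum_congr rfl fun k _ => ?_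
    rw [smul_smul, mul_pow]
    congr 1
    ring
  rw [e, finDiff_sum, Finset.sum_range_succ, Finset.sum_eq_zero, zero_add,
    finDiff_pow_self_smul, smul_smul]
  · congr 1
    have : (p.factorial : ℝ) ≠ 0 := by exact_mod_cast p.factorial_ne_zero
    field_simp
  · intro k hk
    exact finDiff_pow_smul_eq_zero (Finset.mem_range.1 hk) _

lemma exists_norm_iteratedDeriv_le_of_contDiffAt {G : ℝ → F} {b : ℝ}
    (hG : ∀ t, |t| ≤ b → ContDiffAt ℝ (⊤ : ℕ∞) G t) (n : ℕ) :
    ∃ K, 0 ≤ K ∧ ∀ t, |t| ≤ b → ‖iteratedDeriv n G t‖ ≤ K := by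
  have hc : ContinuousOn (iteratedFDeriv ℝ n G) (Icc (-b) b) := fun t ht =>
    ((differentiableAt_iteratedFDeriv_of_contDiffAt (hG t (abs_le.2 ht)) n).continuousAt
      ).continuousWithinAt
  obtain ⟨K, hK⟩ := isCompact_Icc.exists_bound_of_continuousOn hc
  refine ⟨max K 0, le_max_right _ _, fun t ht => ?_⟩
  rw [← norm_iteratedFDeriv_eq_norm_iteratedDeriv]
  exact (hK t (abs_le.1 ht)).trans (le_max_left _ _)

/-- A bound on `p`-th order finite differences passes to the `p`-th derivative. -/
lemma norm_iteratedDeriv_le_of_finDiff {G : ℝ → F} {b A δ : ℝ} (hb : 0 < b) (hδ : 0 < δ)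
    (hG : ∀ t, |t| ≤ b → ContDiffAt ℝ (⊤ : ℕ∞) G t) (p : ℕ)
    (hA : ∀ h : ℝ, 0 < h → h < δ → ‖finDiff p (fun i => G (i * h))‖ ≤ A * h ^ p) :
    ‖iteratedDeriv p G 0‖ ≤ A := by
  obtain ⟨K, hK0, hK⟩ := exists_norm_iteratedDeriv_le_of_contDiffAt hG (p + 1)
  set C : ℝ := 2 ^ p * (K * (p : ℝ) ^ (p + 1)) with hC
  have hC0 : 0 ≤ C := by positivity
  have key : ∀ h : ℝ, 0 < h → h < δ → p * h ≤ b → ‖iteratedDeriv p G 0‖ ≤ A + C * h := by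
    intro h hh hhδ hhb
    have hsplit : h ^ p • iteratedDeriv p G 0 = finDiff p (fun i => G (i * h))
        - finDiff p (fun i => G (i * h) - ∑ k ∈ Finset.range (p + 1),
          ((k.factorial : ℝ)⁻¹ * ((i : ℝ) * h) ^ k) • iteratedDeriv k G 0) := by
      rw [finDiff_sub, finDiff_taylor, sub_sub_cancel]
    have hrem : ‖finDiff p (fun i => G (i * h) - ∑ k ∈ Finset.range (p + 1),
          ((k.factorial : ℝ)⁻¹ * ((i : ℝ) * h) ^ k) • iteratedDeriv k G 0)‖
        ≤ 2 ^ p * (K * (p * h) ^ (p + 1)) := by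
      refine norm_finDiff_le p fun i hi => ?_
      have hip : (i : ℝ) ≤ p := by exact_mod_cast hi
      have hih : |(i : ℝ) * h| ≤ p * h := by
        rw [abs_of_nonneg (by positivity)]
        gcongr
      refine (norm_sub_taylor_le hG hK (hih.trans hhb)).trans ?_
      have h1 : (1 : ℝ) ≤ p.factorial := by exact_mod_cast p.factorial_pos
      refine (div_le_self (by positivity) h1).trans ?_
      gcongr
    have hn : h ^ p * ‖iteratedDeriv p G 0‖ ≤ h ^ p * (A + C * h) := by
      calc h ^ p * ‖iteratedDeriv p G 0‖ = ‖h ^ p • iteratedDeriv p G 0‖ := by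
            rw [norm_smul, Real.norm_of_nonneg (by positivity)]
        _ ≤ A * h ^ p + 2 ^ p * (K * (p * h) ^ (p + 1)) := by
            rw [hsplit]
            exact (norm_sub_le _ _).trans (add_le_add (hA h hh hhδ) hrem)
        _ = h ^ p * (A + C * h) := by rw [hC]; ring
    exact le_of_mul_le_mul_left hn (by positivity)
  refine le_of_forall_pos_le_add fun ε hε => ?_
  have hp1 : (0 : ℝ) < p + 1 := by positivity
  have hC1 : (0 : ℝ) < C + 1 := by positivity
  set h := min (δ / 2) (min (b / (p + 1)) (ε / (C + 1))) with hh
  have hpos : 0 < h := by positivity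
  refine (key h hpos ((min_le_left _ _).trans_lt (by linarith)) ?_).trans ?_
  · have : h ≤ b / (p + 1) := (min_le_right _ _).trans (min_le_left _ _)
    rw [le_div_iff₀ hp1] at this
    nlinarith
  · have : h ≤ ε / (C + 1) := (min_le_right _ _).trans (min_le_right _ _)
    rw [le_div_iff₀ hC1] at this
    nlinarith

/-- Bounds on finite differences along all lines through `x` bound the full derivative at `x`. -/
lemma norm_iteratedFDeriv_le_of_finDiff {E : Type*} [NormedAddCommGroup E] [NormedSpace ℝ E]
    {f : E → F} {V : Set E} (hV : IsOpen V) (hf : ContDiffOn ℝ (⊤ : ℕ∞) f V) {x : E} (hx : x ∈ V)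
    {A δ : ℝ} (hδ : 0 < δ) (p : ℕ)
    (hA : ∀ v : E, ‖v‖ ≤ 1 → ∀ h : ℝ, 0 < h → h < δ →
      ‖finDiff p (fun i => f (x + ((i : ℝ) * h) • v))‖ ≤ A * h ^ p) :
    ‖iteratedFDeriv ℝ p f x‖ ≤ (2 * Real.exp 1) ^ p * A := by
  refine norm_le_of_norm_diagonal_le _
    (fun m σ => iteratedFDeriv_comp_perm_of_contDiffOn hV hf p x hx m σ) fun v hv => ?_
  obtain ⟨b, hb, hbV⟩ := Metric.nhds_basis_closedBall.mem_iff.1 (hV.mem_nhds hx)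
  have hmem : ∀ t : ℝ, |t| ≤ b → x + t • v ∈ V := fun t ht => hbV (by
    rw [mem_closedBall, dist_eq_norm, add_sub_cancel_left, norm_smul, Real.norm_eq_abs]
    nlinarith [norm_nonneg v, abs_nonneg t])
  have h0 := iteratedDeriv_line hV hf x v p 0 (by simpa using hx)
  rw [zero_smul, add_zero] at h0
  rw [← h0]
  exact norm_iteratedDeriv_le_of_finDiff hb hδ
    (fun t ht => contDiffAt_line hV hf x v (hmem t ht)) p (hA v hv)

end FiniteDifferenceLimit

section SmoothLimits

variable {E : Type} [NormedAddCommGroup E] [NormedSpace ℝ E]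

/-- Landau's inequality: a bound for the first derivative in terms of bounds for the function and
its second derivative. -/
lemma norm_fderiv_le_of_norm_le {F : Type} [NormedAddCommGroup F] [NormedSpace ℝ F]
    {u : E → F} {V : Set E} (hV : IsOpen V) (hu : ContDiffOn ℝ (⊤ : ℕ∞) u V) {y : E} {s a b : ℝ}
    (hs : 0 < s) (hyV : closedBall y s ⊆ V) (ha : ∀ z ∈ closedBall y s, ‖u z‖ ≤ a)
    (hb : ∀ z ∈ closedBall y s, ‖iteratedFDeriv ℝ 2 u z‖ ≤ b) :
    ‖fderiv ℝ u y‖ ≤ 2 * a / s + b * s := by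
  have hy : y ∈ closedBall y s := mem_closedBall_self hs.le
  have ha0 : 0 ≤ a := (norm_nonneg _).trans (ha y hy)
  have hb0 : 0 ≤ b := (norm_nonneg _).trans (hb y hy)
  refine ContinuousLinearMap.opNorm_le_of_unit_norm (by positivity) fun v hv => ?_
  have hmem : ∀ t : ℝ, |t| ≤ s → y + t • v ∈ closedBall y s := fun t ht => by
    rw [mem_closedBall, dist_eq_norm, add_sub_cancel_left, norm_smul, Real.norm_eq_abs, hv, mul_one]
    exact ht
  have hss : |s| ≤ s := (abs_of_pos hs).le
  have hT := norm_sub_taylor_le (n := 1) (K := b)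
    (fun t ht => contDiffAt_line hV hu y v (hyV (hmem t ht)))
    (fun t ht => by
      rw [iteratedDeriv_line hV hu y v 2 t (hyV (hmem t ht))]
      refine ((iteratedFDeriv ℝ 2 u (y + t • v)).le_opNorm _).trans ?_
      simp only [hv, Finset.prod_const_one, mul_one]
      exact hb _ (hmem t ht)) hss
  have h1 := iteratedDeriv_line hV hu y v 1 0 (by simpa using hyV hy)
  rw [zero_smul, add_zero, iteratedFDeriv_one_apply] at h1
  rw [Finset.sum_range_succ, Finset.sum_range_one, h1, abs_of_pos hs] at hT
  simp only [Nat.factorial_zero, Nat.cast_one, inv_one, pow_zero, mul_one, one_smul,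
    iteratedDeriv_zero, zero_smul, add_zero, Nat.factorial_one, pow_one, one_mul, div_one,
    Nat.reduceAdd] at hT
  have hb1 := ha _ (hmem s hss)
  have hb2 := ha y hy
  have h2 : ‖s • fderiv ℝ u y v‖ ≤ 2 * a + b * s ^ 2 := by
    have e : s • fderiv ℝ u y v
        = u (y + s • v) - u y - (u (y + s • v) - (u y + s • fderiv ℝ u y v)) := by abel
    rw [e]
    refine (norm_sub_le _ _).trans ?_
    have := norm_sub_le (u (y + s • v)) (u y)
    linarith
  rw [norm_smul, Real.norm_of_nonneg hs.le] at h2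
  have e2 : 2 * a / s + b * s = (2 * a + b * s ^ 2) / s := by field_simp
  rw [e2, le_div_iff₀ hs]
  linarith

lemma exists_tendstoUniformlyOn_fderiv {F : Type} [NormedAddCommGroup F] [NormedSpace ℝ F]
    [CompleteSpace F] {g : ℕ → E → F} {G : E → F} {V : Set E} (hV : IsOpen V)
    (hg : ∀ m, ContDiffOn ℝ (⊤ : ℕ∞) (g m) V) {K : ℝ}
    (hK : ∀ m, ∀ x ∈ V, ‖iteratedFDeriv ℝ 2 (g m) x‖ ≤ K)
    (hG : ∀ x ∈ V, ∃ s > 0, ball x s ⊆ V ∧ TendstoUniformlyOn g G atTop (ball x s)) :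
    ∃ G' : E → E →L[ℝ] F, ∀ x ∈ V, ∃ s > 0, ball x s ⊆ V ∧
      TendstoUniformlyOn (fun m => fderiv ℝ (g m)) G' atTop (ball x s) := by
  have hloc : ∀ x ∈ V, ∃ s > 0, ball x s ⊆ V ∧
      UniformCauchySeqOn (fun m => fderiv ℝ (g m)) atTop (ball x s) := by
    intro x hx
    have hK0 : 0 ≤ K := (norm_nonneg _).trans (hK 0 x hx)
    obtain ⟨s, hs, hsV, hs'⟩ := hG x hx
    refine ⟨s / 2, by positivity, (ball_subset_ball (by linarith)).trans hsV, ?_⟩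
    have hc := Metric.uniformCauchySeqOn_iff.1 hs'.uniformCauchySeqOn
    refine Metric.uniformCauchySeqOn_iff.2 fun ε hε => ?_
    set r : ℝ := min (s / 4) (ε / (4 * (K + 1))) with hr
    have hr0 : 0 < r := by positivity
    have hr1 : r ≤ s / 4 := min_le_left _ _
    have hr2 : r ≤ ε / (4 * (K + 1)) := min_le_right _ _
    rw [le_div_iff₀ (by positivity)] at hr2
    obtain ⟨N, hN⟩ := hc (ε * r / 8) (by positivity)
    refine ⟨N, fun m hm n hn y hy => ?_⟩
    have hsub : closedBall y r ⊆ ball x s := fun z hz => by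
      rw [mem_ball] at hy ⊢
      rw [mem_closedBall] at hz
      linarith [dist_triangle z y x]
    have hyV : y ∈ V := hsV (hsub (mem_closedBall_self hr0.le))
    have hd : ∀ m, ∀ z ∈ V, ContDiffAt ℝ (⊤ : ℕ∞) (g m) z := fun m z hz =>
      (hg m).contDiffAt (hV.mem_nhds hz)
    have hL := norm_fderiv_le_of_norm_le (u := fun z => g m z - g n z) (a := ε * r / 8)
      (b := K + K) hV ((hg m).sub (hg n)) hr0 (hsub.trans hsV)
      (fun z hz => by
        rw [← dist_eq_norm]
        exact (hN m hm n hn z (hsub hz)).le)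
      (fun z hz => by
        have hzV := hsV (hsub hz)
        have e := iteratedFDeriv_sub_apply (i := 2)
          ((hd m z hzV).of_le (by exact WithTop.coe_le_coe.2 (le_top : (2 : ℕ∞) ≤ ⊤)))
          ((hd n z hzV).of_le (by exact WithTop.coe_le_coe.2 (le_top : (2 : ℕ∞) ≤ ⊤)))
        have e' : iteratedFDeriv ℝ 2 (fun z => g m z - g n z) z
          = iteratedFDeriv ℝ 2 (g m) z - iteratedFDeriv ℝ 2 (g n) z := e
        rw [e']
        exact (norm_sub_le _ _).trans (add_le_add (hK m z hzV) (hK n z hzV)))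
    rw [fderiv_fun_sub ((hd m y hyV).differentiableAt (by simp))
      ((hd n y hyV).differentiableAt (by simp))] at hL
    rw [dist_eq_norm]
    refine hL.trans_lt ?_
    have e : 2 * (ε * r / 8) / r = ε / 4 := by field_simp; ring
    rw [e]
    nlinarith
  have hlim : ∀ x : E, ∃ l : E →L[ℝ] F,
      x ∈ V → Tendsto (fun m => fderiv ℝ (g m) x) atTop (𝓝 l) := by
    intro x
    by_cases hx : x ∈ V
    · obtain ⟨s, hs, -, hc⟩ := hloc x hx
      obtain ⟨l, hl⟩ := cauchySeq_tendsto_of_complete (hc.cauchySeq (mem_ball_self hs))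
      exact ⟨l, fun _ => hl⟩
    · exact ⟨0, fun h => absurd h hx⟩
  choose G' hG' using hlim
  refine ⟨G', fun x hx => ?_⟩
  obtain ⟨s, hs, hsV, hc⟩ := hloc x hx
  exact ⟨s, hs, hsV, hc.tendstoUniformlyOn_of_tendsto fun y hy => hG' y (hsV hy)⟩

/-- A locally uniform limit of smooth functions all of whose derivatives are uniformly bounded
is smooth. -/
lemma contDiffOn_of_tendstoUniformlyOn {V : Set E} (hV : IsOpen V) (n : ℕ) :
    ∀ {F : Type} [NormedAddCommGroup F] [NormedSpace ℝ F] [CompleteSpace F]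
      {g : ℕ → E → F} {G : E → F},
    (∀ m, ContDiffOn ℝ (⊤ : ℕ∞) (g m) V) →
    (∀ p, ∃ K, ∀ m, ∀ x ∈ V, ‖iteratedFDeriv ℝ p (g m) x‖ ≤ K) →
    (∀ x ∈ V, ∃ s > 0, ball x s ⊆ V ∧ TendstoUniformlyOn g G atTop (ball x s)) →
    ContDiffOn ℝ n G V := by
  induction n with
  | zero =>
    intro F _ _ _ g G hg hK hG
    rw [Nat.cast_zero, contDiffOn_zero]
    intro x hx
    obtain ⟨s, hs, hsV, hu⟩ := hG x hx
    have hc := hu.continuousOn (Frequently.of_forall fun m => ((hg m).continuousOn.mono hsV))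
    exact (hc.continuousAt (ball_mem_nhds x hs)).continuousWithinAt
  | succ n ih =>
    intro F _ _ _ g G hg hK hG
    obtain ⟨K, hK2⟩ := hK 2
    obtain ⟨G', hG'⟩ := exists_tendstoUniformlyOn_fderiv hV hg hK2 hG
    have hsm : ContDiffOn ℝ n G' V := by
      refine ih (g := fun m => fderiv ℝ (g m)) (fun m => ?_) (fun p => ?_) hG'
      · exact (hg m).fderiv_of_isOpen hV (by simp)
      · obtain ⟨K, hK⟩ := hK (p + 1)
        refine ⟨K, fun m x hx => ?_⟩
        rw [norm_iteratedFDeriv_fderiv]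
        exact hK m x hx
    have hlu : TendstoLocallyUniformlyOn (fun m => fderiv ℝ (g m)) G' atTop V := by
      refine tendstoLocallyUniformlyOn_of_forall_exists_nhds fun y hy => ?_
      obtain ⟨s, hs, -, hu⟩ := hG' y hy
      exact ⟨ball y s, mem_nhdsWithin_of_mem_nhds (ball_mem_nhds y hs), hu⟩
    have hder : ∀ x ∈ V, HasFDerivAt G (G' x) x := by
      intro x hx
      refine hasFDerivAt_of_tendstoLocallyUniformlyOn hV hlu
        (fun m y hy => (((hg m).contDiffAt (hV.mem_nhds hy)).differentiableAt
          (by simp)).hasFDerivAt) (fun y hy => ?_) hx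
      obtain ⟨s, hs, -, hu⟩ := hG y hy
      exact hu.tendsto_at (mem_ball_self hs)
    rw [Nat.cast_succ, contDiffOn_succ_iff_hasFDerivWithinAt_of_uniqueDiffOn hV.uniqueDiffOn]
    exact ⟨fun h => absurd h (by simp), G', hsm, fun x hx => (hder x hx).hasFDerivWithinAt⟩

end SmoothLimits

section Mollification

open MeasureTheory Convolution

variable {E : Type} [NormedAddCommGroup E] [InnerProductSpace ℝ E] [FiniteDimensional ℝ E]
  [MeasurableSpace E] [BorelSpace E]

lemma norm_finDiff_convolution_le (φ : ContDiffBump (0 : E)) {g : E → ℂ}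
    (hg : LocallyIntegrable g (volume : Measure E)) (y : ℕ → E) (p : ℕ) {c : ℝ}
    (h : ∀ t : E, ‖t‖ < φ.rOut → ‖finDiff p (fun i => g (y i - t))‖ ≤ c) :
    ‖finDiff p (fun i =>
      (φ.normed volume ⋆[ContinuousLinearMap.lsmul ℝ ℝ, (volume : Measure E)] g) (y i))‖ ≤ c := by
  have hex : ConvolutionExists (φ.normed volume) g (ContinuousLinearMap.lsmul ℝ ℝ)
      (volume : Measure E) :=
    φ.hasCompactSupport_normed.convolutionExists_left _ φ.continuous_normed hg
  have e : finDiff p (fun i =>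
      (φ.normed volume ⋆[ContinuousLinearMap.lsmul ℝ ℝ, (volume : Measure E)] g) (y i))
      = ∫ t, φ.normed volume t • finDiff p (fun i => g (y i - t)) := by
    simp only [finDiff, convolution_def, ContinuousLinearMap.lsmul_apply, Finset.smul_sum]
    rw [integral_finsetSum]
    · refine Finset.sum_congr rfl fun i _ => ?_
      rw [← integral_smul]
      refine integral_congr_ae (Eventually.of_forall fun t => ?_)
      exact smul_comm ((-1 : ℝ) ^ (p - i) * (p.choose i : ℝ)) (φ.normed volume t) (g (y i - t))
    · intro i _
      have hi := (hex (y i)).smul ((-1 : ℝ) ^ (p - i) * (p.choose i : ℝ))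
      refine hi.congr (Eventually.of_forall fun t => ?_)
      exact smul_comm ((-1 : ℝ) ^ (p - i) * (p.choose i : ℝ)) (φ.normed volume t) (g (y i - t))
  rw [e]
  calc ‖∫ t, φ.normed volume t • finDiff p (fun i => g (y i - t))‖
      ≤ ∫ t, φ.normed volume t * c := by
        refine norm_integral_le_of_norm_le (φ.integrable_normed.mul_const c)
          (Eventually.of_forall fun t => ?_)
        rw [norm_smul, Real.norm_of_nonneg (φ.nonneg_normed t)]
        by_cases ht : φ.normed volume t = 0
        · simp [ht]
        · have hts : t ∈ Function.support (φ.normed volume) := ht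
          rw [φ.support_normed_eq, mem_ball_zero_iff] at hts
          exact mul_le_mul_of_nonneg_left (h t hts) (φ.nonneg_normed t)
    _ = c := by rw [integral_mul_const, φ.integral_normed, one_mul]

/-- A continuous function whose finite differences of every order are uniformly controlled along
lines is smooth. -/
lemma contDiffOn_of_finDiff_le {f : E → ℂ} {U : Set E} (hU : IsOpen U) (hc : ContinuousOn f U)
    {A δ : ℕ → ℝ} (hδ : ∀ p, 0 < δ p)
    (hA : ∀ p, ∀ x ∈ U, ∀ v : E, ‖v‖ ≤ 1 → ∀ h : ℝ, 0 < h → h < δ p →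
      ‖finDiff p (fun i => f (x + ((i : ℝ) * h) • v))‖ ≤ A p * h ^ p) :
    ContDiffOn ℝ (⊤ : ℕ∞) f U := by
  intro x₀ hx₀
  obtain ⟨R, hR, hRU⟩ := Metric.nhds_basis_closedBall.mem_iff.1 (hU.mem_nhds hx₀)
  set r : ℝ := R / 4 with hr
  have hr0 : 0 < r := by positivity
  set g : E → ℂ := indicator (closedBall x₀ R) f with hg
  have hgf : ∀ z, dist z x₀ ≤ R → g z = f z := fun z hz => indicator_of_mem (by exact hz) f
  have hcR : ContinuousOn f (closedBall x₀ R) := hc.mono hRU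
  have hgi : LocallyIntegrable g (volume : Measure E) := by
    refine Integrable.locallyIntegrable ?_
    exact (hcR.integrableOn_compact (isCompact_closedBall _ _)).integrable_indicator
      measurableSet_closedBall
  have hτ : ∀ m : ℕ, 0 < r / (m + 1) := fun m => by positivity
  let φ : ℕ → ContDiffBump (0 : E) := fun m =>
    ⟨r / (m + 1) / 2, r / (m + 1), half_pos (hτ m), half_lt_self (hτ m)⟩
  have hφ : ∀ m, (φ m).rOut ≤ r := fun m => div_le_self hr0.le (by simp)
  set G : ℕ → E → ℂ := fun m =>
    (φ m).normed volume ⋆[ContinuousLinearMap.lsmul ℝ ℝ, (volume : Measure E)] g with hG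
  have hGs : ∀ m, ContDiff ℝ (⊤ : ℕ∞) (G m) := fun m =>
    (φ m).hasCompactSupport_normed.contDiff_convolution_left _ (φ m).contDiff_normed hgi
  have hbound : ∀ p, ∃ K, ∀ m, ∀ x ∈ ball x₀ r, ‖iteratedFDeriv ℝ p (G m) x‖ ≤ K := by
    intro p
    refine ⟨(2 * Real.exp 1) ^ p * A p, fun m x hx => ?_⟩
    refine norm_iteratedFDeriv_le_of_finDiff isOpen_univ (hGs m).contDiffOn (mem_univ x)
      (δ := min (δ p) (r / (p + 1))) (lt_min (hδ p) (by positivity)) p fun v hv h hh0 hh => ?_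
    refine norm_finDiff_convolution_le (φ m) hgi _ p fun t ht => ?_
    have htr : ‖t‖ < r := ht.trans_le (hφ m)
    rw [mem_ball, dist_eq_norm] at hx
    have hxt : x - t ∈ U := hRU (by
      rw [mem_closedBall, dist_eq_norm]
      have := norm_sub_le (x - x₀) t
      rw [show x - t - x₀ = x - x₀ - t by abel]
      linarith)
    have hfd := hA p (x - t) hxt v hv h hh0 (hh.trans_le (min_le_left _ _))
    have hhp : h * (p + 1) < r := by
      rw [← lt_div_iff₀ (by positivity)]
      exact hh.trans_le (min_le_right _ _)
    have heq : finDiff p (fun i => g (x + ((i : ℝ) * h) • v - t))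
        = finDiff p (fun i => f (x - t + ((i : ℝ) * h) • v)) := by
      refine Finset.sum_congr rfl fun i hi => ?_
      have hip : (i : ℝ) ≤ p := by exact_mod_cast Nat.lt_succ_iff.1 (Finset.mem_range.1 hi)
      congr 1
      beta_reduce
      rw [hgf]
      · congr 1
        abel
      · have h1 : ‖((i : ℝ) * h) • v‖ ≤ r := by
          rw [norm_smul, Real.norm_of_nonneg (by positivity)]
          have h2 : (i : ℝ) * h * ‖v‖ ≤ i * h * 1 := by gcongr
          nlinarith
        rw [dist_eq_norm, show x + ((i : ℝ) * h) • v - t - x₀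
          = (x - x₀) + ((i : ℝ) * h) • v - t by abel]
        have h2 := norm_sub_le ((x - x₀) + ((i : ℝ) * h) • v) t
        have h3 := norm_add_le (x - x₀) (((i : ℝ) * h) • v)
        linarith
    rw [heq]
    exact hfd
  have hunif : TendstoUniformlyOn G f atTop (ball x₀ r) := by
    have huc := (isCompact_closedBall x₀ R).uniformContinuousOn_of_continuous hcR
    rw [Metric.uniformContinuousOn_iff] at huc
    rw [Metric.tendstoUniformlyOn_iff]
    intro ε hε
    obtain ⟨η, hη, hηf⟩ := huc (ε / 2) (by positivity)
    obtain ⟨N, hN⟩ := exists_nat_gt (r / η)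
    filter_upwards [eventually_ge_atTop N] with m hm x hx
    rw [mem_ball] at hx
    have hxR : dist x x₀ ≤ R := by linarith
    have hsmall : (φ m).rOut < η := by
      change r / (m + 1) < η
      have : (N : ℝ) ≤ m := by exact_mod_cast hm
      rw [div_lt_iff₀ hη] at hN
      rw [div_lt_iff₀ (by positivity)]
      nlinarith
    have hd := ContDiffBump.dist_normed_convolution_le (φ := φ m) (μ := volume) (g := g)
      (x₀ := x) (ε := ε / 2) hgi.aestronglyMeasurable (fun z hz => by
        rw [mem_ball] at hz
        have hzR : dist z x₀ ≤ R := by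
          linarith [dist_triangle z x x₀, hφ m]
        rw [hgf z hzR, hgf x hxR]
        exact (hηf z hzR x hxR (hz.trans hsmall)).le)
    rw [hgf x hxR, dist_comm] at hd
    exact hd.trans_lt (by linarith)
  have hsm : ContDiffOn ℝ (⊤ : ℕ∞) f (ball x₀ r) := by
    refine contDiffOn_infty.2 fun n => ?_
    refine contDiffOn_of_tendstoUniformlyOn isOpen_ball n (fun m => (hGs m).contDiffOn) hbound
      fun x hx => ?_
    obtain ⟨s, hs, hsV⟩ := Metric.isOpen_iff.1 isOpen_ball x hx
    exact ⟨s, hs, hsV, hunif.mono hsV⟩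
  exact (hsm.contDiffAt (ball_mem_nhds x₀ hr0)).contDiffWithinAt

end Mollification

lemma isOpen_VU {E : Type*} [NormedAddCommGroup E] [NormedSpace ℝ E] {U : Set E}
    (hU : IsOpen U) : IsOpen (VU U) := by
  have e : VU U = ⋃ w ∈ closedBall (0 : E) 1, (fun x => x + w) '' U := by
    ext z
    simp only [VU, mem_iUnion, mem_closedBall, dist_eq_norm, exists_prop, sub_zero, mem_image]
    constructor
    · rintro ⟨x, hx, hz⟩
      exact ⟨z - x, hz, x, hx, by abel⟩
    · rintro ⟨w, hw, x, hx, rfl⟩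
      exact ⟨x, hx, by rwa [add_sub_cancel_left]⟩
  rw [e]
  exact isOpen_biUnion fun w _ => isOpenMap_add_right w U hU

lemma continuousOn_of_pow_of_pow_succ {X : Type*} [TopologicalSpace X] {f : X → ℂ} {V : Set X}
    {j : ℕ} (hj : 1 ≤ j) (h1 : ContinuousOn (fun x => f x ^ j) V)
    (h2 : ContinuousOn (fun x => f x ^ (j + 1)) V) : ContinuousOn f V := by
  intro x hx
  by_cases hfx : f x = 0
  · rw [ContinuousWithinAt, Metric.tendsto_nhds]
    intro ε hε
    have h := Metric.tendsto_nhds.1 (h1 x hx) (ε ^ j) (by positivity)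
    filter_upwards [h] with y hy
    rw [hfx, zero_pow (by omega), dist_zero_right, norm_pow] at hy
    rw [hfx, dist_zero_right]
    exact lt_of_pow_lt_pow_left₀ j hε.le hy
  · have hne : f x ^ j ≠ 0 := pow_ne_zero _ hfx
    refine ((h2 x hx).div (h1 x hx) hne).congr_of_eventuallyEq ?_ ?_
    · filter_upwards [(h1 x hx).eventually_ne hne] with y hy
      exact (by rw [pow_succ, mul_div_cancel_left₀ _ hy] : f y = f y ^ (j + 1) / f y ^ j)
    · exact (by rw [pow_succ, mul_div_cancel_left₀ _ hne] : f x = f x ^ (j + 1) / f x ^ j)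

lemma GlobalClass.line {E : Type*} [NormedAddCommGroup E] [NormedSpace ℝ E] {U : Set E}
    (hU : IsOpen U) {M : ℕ → ℝ} {ρ C : ℝ} {f : E → ℂ} (hf : ContDiffOn ℝ (⊤ : ℕ∞) f (VU U))
    (hb : ∀ x ∈ VU U, ∀ k : ℕ, ‖iteratedFDerivWithin ℝ k f (VU U) x‖ ≤ C * ρ ^ k * M k)
    {x v : E} (hx : x ∈ U) (hv : ‖v‖ ≤ 1) {t : ℝ} (ht : |t| ≤ 1) :
    ContDiffAt ℝ (⊤ : ℕ∞) (fun s : ℝ => f (x + s • v)) t ∧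
      ∀ i, ‖iteratedDeriv i (fun s : ℝ => f (x + s • v)) t‖ ≤ C * ρ ^ i * M i := by
  have hV := isOpen_VU hU
  have hmem : x + t • v ∈ VU U := by
    refine mem_biUnion hx ?_
    rw [mem_closedBall, dist_eq_norm, add_sub_cancel_left, norm_smul, Real.norm_eq_abs]
    exact mul_le_one₀ ht (norm_nonneg _) hv
  refine ⟨contDiffAt_line hV hf x v hmem, fun i => ?_⟩
  rw [iteratedDeriv_line hV hf x v i t hmem]
  refine ((iteratedFDeriv ℝ i f (x + t • v)).le_opNorm _).trans ?_
  have hp : ∏ _k : Fin i, ‖v‖ ≤ 1 := by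
    rw [Finset.prod_const]
    exact pow_le_one₀ (norm_nonneg _) hv
  refine (mul_le_of_le_one_right (norm_nonneg _) hp).trans ?_
  rw [← iteratedFDerivWithin_of_isOpen i hV hmem]
  exact hb _ hmem i

/-- The core proposition: uniform bounds for `f` from bounds on `f^j` and `f^{j+1}`. -/
theorem statement11 {d : ℕ} (U : Set (EuclideanSpace ℝ (Fin d))) (hU : IsOpen U)
    (j : ℕ) (hj : 1 ≤ j) (k : ℕ) (hk : k = Nat.clog 2 (j * (j + 1)) + 7)
    (M : ℕ → ℕ → ℝ)
    (hws : ∀ i, 1 ≤ i → i ≤ k → IsWeightSeq (M i))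
    (hroots : ∀ i, 1 ≤ i → i ≤ k → RootsTendsto (lc (M i)))
    (B : ℝ) (hB : 1 ≤ B)
    (hGamma : ∀ t : ℝ, 0 < t → GammaUpper (lc (M 2)) (B * t) ≤ GammaLower (lc (M 1)) t)
    (hmg : ∀ i, 2 ≤ i → i ≤ k - 1 → mg (M i) (M (i + 1)) < ⊤) :
    ∃ D : ℝ, 0 < D ∧ ∀ ρ : ℝ, 0 < ρ → ∀ f : EuclideanSpace ℝ (Fin d) → ℂ,
      GlobalClass (M 1) ρ (fun x => f x ^ j) (VU U) →
      GlobalClass (M 1) ρ (fun x => f x ^ (j + 1)) (VU U) →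
      GlobalClass (M k) (D * ρ) f U := by
  obtain ⟨D, hD, hmain⟩ := exists_norm_finDiff_le hj hk hws hroots hB hGamma hmg
  refine ⟨2 * Real.exp 1 * D, by positivity, fun ρ hρ f h1 h2 => ?_⟩
  obtain ⟨hs1, C1, hb1⟩ := h1
  obtain ⟨hs2, C2, hb2⟩ := h2
  have hM1 := hws 1 le_rfl (by omega)
  set C : ℝ := max (max C1 C2) 0 with hC
  obtain ⟨K, hK, hmain⟩ := hmain ρ hρ C (le_max_right _ _)
  have hs : ∀ q ∈ ({j, j + 1} : Set ℕ), ContDiffOn ℝ (⊤ : ℕ∞) (fun x => f x ^ q) (VU U) := by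
    rintro q (rfl | rfl)
    exacts [hs1, hs2]
  have hb : ∀ q ∈ ({j, j + 1} : Set ℕ), ∀ x ∈ VU U, ∀ i : ℕ,
      ‖iteratedFDerivWithin ℝ i (fun x => f x ^ q) (VU U) x‖ ≤ C * ρ ^ i * M 1 i := by
    intro q hq x hx i
    have hpos := (hM1.pos i).le
    rcases hq with rfl | rfl
    · refine (hb1 x hx i).trans ?_
      gcongr
      exact (le_max_left _ _).trans (le_max_left _ _)
    · refine (hb2 x hx i).trans ?_
      gcongr
      exact (le_max_right _ _).trans (le_max_left _ _)
  have hUV : U ⊆ VU U := fun x hx => mem_biUnion hx (mem_closedBall_self zero_le_one)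
  have hδ : ∀ p : ℕ, (0 : ℝ) < 1 / (2048 * (p + 1)) := fun p => by positivity
  have hfd : ∀ p : ℕ, ∀ x ∈ U, ∀ v : EuclideanSpace ℝ (Fin d), ‖v‖ ≤ 1 → ∀ h : ℝ, 0 < h →
      h < 1 / (2048 * (p + 1)) → ‖finDiff p (fun i => f (x + ((i : ℝ) * h) • v))‖
        ≤ K * (D * ρ) ^ p * M k p * h ^ p := by
    intro p x hx v hv h hh0 hh
    refine hmain (fun t => f (x + t • v))
      (fun q hq t ht => (GlobalClass.line hU (hs q hq) (hb q hq) hx hv ht).1)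
      (fun q hq t ht => (GlobalClass.line hU (hs q hq) (hb q hq) hx hv ht).2) p h hh0 ?_
    rw [lt_div_iff₀ (by positivity)] at hh
    linarith
  have hcont : ContinuousOn f U :=
    continuousOn_of_pow_of_pow_succ hj (hs1.continuousOn.mono hUV) (hs2.continuousOn.mono hUV)
  have hsm : ContDiffOn ℝ (⊤ : ℕ∞) f U := contDiffOn_of_finDiff_le hU hcont hδ hfd
  refine ⟨hsm, K, fun x hx p => ?_⟩
  rw [iteratedFDerivWithin_of_isOpen p hU hx]
  refine (norm_iteratedFDeriv_le_of_finDiff hU hsm hx (hδ p) p (hfd p x hx)).trans_eq ?_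
  rw [mul_assoc (2 * Real.exp 1), mul_pow (2 * Real.exp 1)]
  ring

end JorisPaper
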